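/- Every C₄-free 3-planar finite simple graph on n ≥ 2 vertices and m edges satisfies m ≤ (3764475/31360)^{1/3}·n; in particular m < 4.933·n. -/

import Mathlib

open unitInterval

/-- A (good) drawing of a simple graph in the plane: vertices map to distinct
points, each edge is drawn as a simple continuous arc between its endpoints,
arcs avoid vertex points other than their endpoints, two arcs meet in finitely
many points, and no three arcs pass through a common interior point. -/
structure PlaneDrawing {V : Type*} (G : SimpleGraph V) where
  pos : V → ℝ × ℝ
  pos_inj : Function.Injective pos
  arc : ∀ ⦃u v : V⦄, G.Adj u v → Path (pos u) (pos v)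
  arc_symm : ∀ ⦃u v : V⦄ (h : G.Adj u v), arc h.symm = (arc h).symm
  arc_inj : ∀ ⦃u v : V⦄ (h : G.Adj u v), Function.Injective (arc h)
  no_vertex_mem : ∀ ⦃u v : V⦄ (h : G.Adj u v) (w : V) (t : I),
      arc h t = pos w → w = u ∨ w = v
  finite_inter : ∀ ⦃u v x y : V⦄ (h₁ : G.Adj u v) (h₂ : G.Adj x y),
      s(u, v) ≠ s(x, y) →
      (Set.range (arc h₁) ∩ Set.range (arc h₂)).Finite
  no_triple_point : ∀ ⦃u₁ v₁ u₂ v₂ u₃ v₃ : V⦄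
      (h₁ : G.Adj u₁ v₁) (h₂ : G.Adj u₂ v₂) (h₃ : G.Adj u₃ v₃),
      s(u₁, v₁) ≠ s(u₂, v₂) → s(u₁, v₁) ≠ s(u₃, v₃) → s(u₂, v₂) ≠ s(u₃, v₃) →
      ∀ t₁ t₂ t₃ : I, t₁ ≠ 0 → t₁ ≠ 1 → t₂ ≠ 0 → t₂ ≠ 1 → t₃ ≠ 0 → t₃ ≠ 1 →
      arc h₁ t₁ = arc h₂ t₂ → arc h₂ t₂ = arc h₃ t₃ → False

namespace PlaneDrawing

variable {V : Type*} {G : SimpleGraph V} (D : PlaneDrawing G)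

/-- `p` is an interior point of the arc of the edge `uv`. -/
def IsInteriorPoint {u v : V} (h : G.Adj u v) (p : ℝ × ℝ) : Prop :=
  ∃ t : I, t ≠ 0 ∧ t ≠ 1 ∧ D.arc h t = p

/-- The set of crossing points of the drawing: points where the interiors of
the arcs of two distinct edges meet. -/
def crossings : Set (ℝ × ℝ) :=
  {p | ∃ (u v x y : V) (h₁ : G.Adj u v) (h₂ : G.Adj x y),
    s(u, v) ≠ s(x, y) ∧ D.IsInteriorPoint h₁ p ∧ D.IsInteriorPoint h₂ p}

/-- The number of crossings of the drawing. -/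
noncomputable def crossingCount : ℕ := D.crossings.ncard

/-- The set of crossing points lying on the edge `uv`. -/
def edgeCrossings {u v : V} (h : G.Adj u v) : Set (ℝ × ℝ) :=
  {p | D.IsInteriorPoint h p ∧
    ∃ (x y : V) (h₂ : G.Adj x y), s(u, v) ≠ s(x, y) ∧ D.IsInteriorPoint h₂ p}

/-- A drawing is `k`-plane if every edge is involved in at most `k` crossings. -/
def IsKPlane (k : ℕ) : Prop :=
  ∀ ⦃u v : V⦄ (h : G.Adj u v), (D.edgeCrossings h).ncard ≤ k

end PlaneDrawing

/-- The crossing number of a graph: the minimum number of crossings over all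
drawings. -/
noncomputable def crossingNumber {V : Type*} (G : SimpleGraph V) : ℕ :=
  sInf {c : ℕ | ∃ D : PlaneDrawing G, D.crossingCount = c}

/-- A graph is `k`-planar if it admits a drawing in which every edge is
involved in at most `k` crossings. -/
def KPlanar {V : Type*} (G : SimpleGraph V) (k : ℕ) : Prop :=
  ∃ D : PlaneDrawing G, D.IsKPlane k

/-- `G` has no cycle of length `ℓ`. -/
def HasNoCycleOfLength {V : Type*} (G : SimpleGraph V) (ℓ : ℕ) : Prop :=
  ∀ (v : V) (c : G.Walk v v), c.IsCycle → c.length ≠ ℓ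

section TwoBasis

open Finset

/-- `φ` is a finite family spanning `Z`, summing to zero, in which every coordinate is nonzero
in at most two members.  For the cycle space of a graph this is MacLane's planarity criterion. -/
structure IsTwoBasis {E ι : Type*} [Fintype ι] (φ : ι → E → ZMod 2)
    (Z : Submodule (ZMod 2) (E → ZMod 2)) : Prop where
  span_eq : Submodule.span (ZMod 2) (Set.range φ) = Z
  sum_eq : ∑ i, φ i = 0
  card_le : ∀ e, #{i | φ i e ≠ 0} ≤ 2

/-- The subspace `Z` has a 2-basis. -/
def HasTwoBasis {E : Type*} (Z : Submodule (ZMod 2) (E → ZMod 2)) : Prop :=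
  ∃ (ι : Type) (_ : Fintype ι) (φ : ι → E → ZMod 2), IsTwoBasis φ Z

lemma zmod_two_ne_zero {x : ZMod 2} : x ≠ 0 ↔ x = 1 := by
  revert x; decide

variable {E : Type*} {Z : Submodule (ZMod 2) (E → ZMod 2)}

lemma IsTwoBasis.mem {ι : Type*} [Fintype ι] {φ : ι → E → ZMod 2} (h : IsTwoBasis φ Z) (i : ι) :
    φ i ∈ Z :=
  h.span_eq ▸ Submodule.subset_span ⟨i, rfl⟩

lemma IsTwoBasis.exists_coeff {ι : Type*} [Fintype ι] {φ : ι → E → ZMod 2}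
    (h : IsTwoBasis φ Z) {z : E → ZMod 2} (hz : z ∈ Z) : ∃ c : ι → ZMod 2, ∑ i, c i • φ i = z := by
  rw [← h.span_eq] at hz
  exact (Submodule.mem_span_range_iff_exists_fun _).1 hz

/-- Replace two members of a family by their sum and zero. -/
def mergeFamily {ι M : Type*} [DecidableEq ι] [AddCommMonoid M] (φ : ι → M) (i₀ i₁ : ι) : ι → M :=
  fun i => if i = i₀ then φ i₀ + φ i₁ else if i = i₁ then 0 else φ i

lemma sum_smul_mergeFamily {ι M : Type*} [DecidableEq ι] [Fintype ι] [AddCommGroup M]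
    [Module (ZMod 2) M] (φ : ι → M) {i₀ i₁ : ι} (hne : i₀ ≠ i₁) (c : ι → ZMod 2)
    (hc : c i₀ = c i₁) : ∑ i, c i • mergeFamily φ i₀ i₁ i = ∑ i, c i • φ i := by
  have key : ∀ i, c i • mergeFamily φ i₀ i₁ i =
      c i • φ i + ((if i = i₀ then c i₀ • φ i₁ else 0) - (if i = i₁ then c i₁ • φ i₁ else 0)) := by
    intro i
    unfold mergeFamily
    by_cases h0 : i = i₀
    · subst h0; simp [hne, smul_add]
    · by_cases h1 : i = i₁
      · subst h1; simp [h0]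
      · simp [h0, h1]
  rw [sum_congr rfl fun i _ => key i, sum_add_distrib, sum_sub_distrib]
  simp [hc]

lemma card_mergeFamily_le {ι : Type*} [DecidableEq ι] [Fintype ι] (φ : ι → E → ZMod 2)
    (i₀ i₁ : ι) (e : E) :
    #{i | mergeFamily φ i₀ i₁ i e ≠ 0} ≤ #{i | φ i e ≠ 0} := by
  refine card_le_card_of_injOn (fun i => if i = i₀ ∧ φ i₀ e = 0 then i₁ else i) ?_ ?_
  · intro i hi
    have hi := (mem_filter.1 (mem_coe.1 hi)).2
    refine mem_coe.2 (mem_filter.2 ⟨mem_univ _, ?_⟩)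
    simp only [mergeFamily] at hi ⊢
    split_ifs at hi ⊢ <;> simp_all
  · intro i hi j hj hij
    have hi := (mem_filter.1 (mem_coe.1 hi)).2
    have hj := (mem_filter.1 (mem_coe.1 hj)).2
    simp only [mergeFamily] at hi hj hij
    split_ifs at hi hj <;> (try simp only [Pi.zero_apply, Pi.add_apply] at hi hj) <;> grind

lemma IsTwoBasis.merge {ι : Type*} [DecidableEq ι] [Fintype ι] {φ : ι → E → ZMod 2}
    (h : IsTwoBasis φ Z) {i₀ i₁ : ι} (hne : i₀ ≠ i₁) {Z' : Submodule (ZMod 2) (E → ZMod 2)}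
    (hZ' : Submodule.span (ZMod 2) (Set.range (mergeFamily φ i₀ i₁)) = Z') :
    IsTwoBasis (mergeFamily φ i₀ i₁) Z' where
  span_eq := hZ'
  sum_eq := by
    have := sum_smul_mergeFamily φ hne (fun _ => 1) rfl
    simpa [h.sum_eq] using this
  card_le e := (card_mergeFamily_le φ i₀ i₁ e).trans (h.card_le e)

lemma even_card_of_sum_eq_zero {ι : Type*} [Fintype ι] (f : ι → ZMod 2) (hf : ∑ i, f i = 0) :
    Even #{i | f i ≠ 0} := by
  have h1 : ∑ i, f i = ∑ i, if f i ≠ 0 then (1 : ZMod 2) else 0 := by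
    refine sum_congr rfl fun i _ => ?_
    split_ifs with h
    · exact zmod_two_ne_zero.1 h
    · simpa using h
  rw [hf, sum_boole] at h1
  exact (ZMod.natCast_eq_zero_iff_even).1 h1.symm

/-- A functional that is nonzero on at most two members of a 2-basis cuts out a subspace with a
2-basis. -/
lemma IsTwoBasis.inf_ker {ι : Type} [Fintype ι] {φ : ι → E → ZMod 2} (h : IsTwoBasis φ Z)
    (l : (E → ZMod 2) →ₗ[ZMod 2] ZMod 2) (hl : #{i | l (φ i) ≠ 0} ≤ 2) :
    HasTwoBasis (Z ⊓ LinearMap.ker l) := by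
  classical
  have hsum : ∑ i, l (φ i) = 0 := by rw [← map_sum, h.sum_eq, map_zero]
  have hev := even_card_of_sum_eq_zero _ hsum
  have hcases : #{i | l (φ i) ≠ 0} = 0 ∨ #{i | l (φ i) ≠ 0} = 2 := by
    obtain ⟨k, hk⟩ := hev
    omega
  rcases hcases with h0 | h2
  · refine ⟨ι, inferInstance, φ, ⟨?_, h.sum_eq, h.card_le⟩⟩
    rw [h.span_eq, eq_comm, inf_eq_left, ← h.span_eq, Submodule.span_le]
    rintro _ ⟨i, rfl⟩
    rw [card_eq_zero, filter_eq_empty_iff] at h0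
    simpa using h0 (mem_univ i)
  · obtain ⟨i₀, i₁, hne, hs⟩ := card_eq_two.1 h2
    have hmem : ∀ i, l (φ i) ≠ 0 ↔ i = i₀ ∨ i = i₁ := by
      intro i
      have := Finset.ext_iff.1 hs i
      simpa using this
    have h0 : l (φ i₀) = 1 := zmod_two_ne_zero.1 ((hmem i₀).2 (Or.inl rfl))
    have h1 : l (φ i₁) = 1 := zmod_two_ne_zero.1 ((hmem i₁).2 (Or.inr rfl))
    have hoth : ∀ i, i ≠ i₀ → i ≠ i₁ → l (φ i) = 0 := by
      intro i hi hi'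
      by_contra hcon
      rcases (hmem i).1 hcon with h | h <;> contradiction
    refine ⟨ι, inferInstance, mergeFamily φ i₀ i₁, h.merge hne (le_antisymm ?_ ?_)⟩
    · rw [Submodule.span_le]
      rintro _ ⟨i, rfl⟩
      unfold mergeFamily
      split_ifs with hi hi'
      · refine ⟨Z.add_mem (h.mem _) (h.mem _), ?_⟩
        change l _ = 0
        rw [map_add, h0, h1]; decide
      · exact Submodule.zero_mem _
      · exact ⟨h.mem _, hoth i hi hi'⟩
    · rintro z ⟨hz, hlz⟩
      obtain ⟨c, rfl⟩ := h.exists_coeff hz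
      have hlz' : l (∑ i, c i • φ i) = 0 := hlz
      have hc : c i₀ = c i₁ := by
        rw [map_sum, ← Finset.sum_subset (Finset.subset_univ {i₀, i₁}), sum_pair hne] at hlz'
        · simp only [map_smul, h0, h1, smul_eq_mul, mul_one] at hlz'
          generalize c i₀ = x at *
          generalize c i₁ = y at *
          revert x y; decide
        · intro i _ hi
          simp only [mem_insert, mem_singleton, not_or] at hi
          rw [map_smul, hoth i hi.1 hi.2, smul_zero]
      rw [← sum_smul_mergeFamily φ hne c hc]
      exact (Submodule.mem_span_range_iff_exists_fun _).2 ⟨c, rfl⟩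

/-- Deleting coordinates preserves the existence of a 2-basis. -/
lemma HasTwoBasis.delete (h : HasTwoBasis Z) (S : Finset E) {Z' : Submodule (ZMod 2) (E → ZMod 2)}
    (hZ' : ∀ z, z ∈ Z' ↔ z ∈ Z ∧ ∀ e ∈ S, z e = 0) : HasTwoBasis Z' := by
  classical
  induction S using Finset.induction_on generalizing Z' with
  | empty =>
    have : Z' = Z := by ext z; simp [hZ']
    exact this ▸ h
  | insert a S _ ih =>
    obtain ⟨ι, _, φ, hφ⟩ := ih (Z' := Z ⊓ ⨅ e ∈ S, LinearMap.ker (LinearMap.proj e)) (by simp)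
    have : Z' = (Z ⊓ ⨅ e ∈ S, LinearMap.ker (LinearMap.proj e)) ⊓
        LinearMap.ker (LinearMap.proj a) := by
      ext z; simp [hZ']; tauto
    rw [this]
    exact hφ.inf_ker _ (hφ.card_le a)

/-- A linear map that only copies or erases coordinates preserves 2-bases. -/
lemma HasTwoBasis.map {E' : Type*} (h : HasTwoBasis Z) (L : (E → ZMod 2) →ₗ[ZMod 2] (E' → ZMod 2))
    (hL : ∀ e, (∀ z ∈ Z, L z e = 0) ∨ ∃ e', ∀ z ∈ Z, L z e = z e') : HasTwoBasis (Z.map L) := by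
  obtain ⟨ι, _, φ, hφ⟩ := h
  refine ⟨ι, inferInstance, fun i => L (φ i), ?_, ?_, ?_⟩
  · rw [← hφ.span_eq, Submodule.map_span, ← Set.range_comp]; rfl
  · rw [← map_sum, hφ.sum_eq, map_zero]
  · intro e
    rcases hL e with h0 | ⟨e', he'⟩
    · simp [fun i => h0 _ (hφ.mem i)]
    · simpa only [fun i => he' _ (hφ.mem i)] using hφ.card_le e'

/-- If every coordinate is nonzero in at most two members of a spanning family, adding the sum of
the family yields a 2-basis. -/
lemma hasTwoBasis_of_card_le {ι : Type} [Fintype ι] (φ : ι → E → ZMod 2)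
    (hspan : Submodule.span (ZMod 2) (Set.range φ) = Z) (hcard : ∀ e, #{i | φ i e ≠ 0} ≤ 2) :
    HasTwoBasis Z := by
  classical
  refine ⟨Option ι, inferInstance, fun o => o.elim (∑ i, φ i) φ, ?_, ?_, ?_⟩
  · rw [← hspan]
    refine le_antisymm (Submodule.span_le.2 ?_) (Submodule.span_mono ?_)
    · rintro _ ⟨o, rfl⟩
      cases o with
      | none => exact Submodule.sum_mem _ fun i _ => Submodule.subset_span ⟨i, rfl⟩
      | some i => exact Submodule.subset_span ⟨i, rfl⟩
    · rintro _ ⟨i, rfl⟩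
      exact ⟨some i, rfl⟩
  · rw [Fintype.sum_option]
    ext e
    exact CharTwo.add_self_eq_zero _
  · intro e
    have hset : (univ.filter fun o : Option ι => o.elim (∑ i, φ i) φ e ≠ 0) ⊆
        (if (∑ i, φ i) e ≠ 0 then {none} else ∅) ∪
          (univ.filter fun i => φ i e ≠ 0).image some := by
      intro o ho
      cases o with
      | none => simp_all
      | some i => simp_all
    refine (card_le_card hset).trans ((card_union_le _ _).trans ?_)
    rw [card_image_of_injective _ (Option.some_injective _)]
    have := hcard e
    split_ifs with hne
    · have hodd : ¬ Even #{i | φ i e ≠ 0} := by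
        intro hev
        apply hne
        have h1 : ∑ i, φ i e = ∑ i, if φ i e ≠ 0 then (1 : ZMod 2) else 0 := by
          refine sum_congr rfl fun i _ => ?_
          split_ifs with h
          · exact zmod_two_ne_zero.1 h
          · simpa using h
        rw [Finset.sum_apply, h1, sum_boole]
        exact (ZMod.natCast_eq_zero_iff_even).2 hev
      have h2 : #{i | φ i e ≠ 0} ≠ 2 := fun h2 => hodd (by rw [h2]; exact even_two)
      rw [card_singleton]
      omega
    · simpa using this

/-- If `Z` splits as a direct sum along the coordinate set `S`, two coordinates on either side can
be identified. -/
lemma IsTwoBasis.inf_ker_of_split {ι : Type} [Fintype ι] {φ : ι → E → ZMod 2}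
    (h : IsTwoBasis φ Z) (S : Set E) (hS : ∀ z ∈ Z, S.indicator z ∈ Z) {a b : E} (ha : a ∈ S)
    (hb : b ∉ S) : HasTwoBasis (Z ⊓ LinearMap.ker
      ((LinearMap.proj a : (E → ZMod 2) →ₗ[ZMod 2] ZMod 2) + LinearMap.proj b)) := by
  classical
  set l : (E → ZMod 2) →ₗ[ZMod 2] ZMod 2 :=
    (LinearMap.proj a : (E → ZMod 2) →ₗ[ZMod 2] ZMod 2) + LinearMap.proj b with hl
  have hScompl : ∀ z ∈ Z, Sᶜ.indicator z ∈ Z := by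
    intro z hz
    have : Sᶜ.indicator z = z - S.indicator z := by
      rw [Set.indicator_compl]
    rw [this]
    exact Z.sub_mem hz (hS z hz)
  set ψ : ι ⊕ ι → E → ZMod 2 :=
    Sum.elim (fun i => S.indicator (φ i)) (fun i => Sᶜ.indicator (φ i)) with hψ
  have hsumS : ∑ i, S.indicator (φ i) = 0 := by
    ext e
    have := congrFun h.sum_eq e
    simp only [Finset.sum_apply, Pi.zero_apply] at this ⊢
    by_cases he : e ∈ S <;> simp [he, this]
  have hsumSc : ∑ i, Sᶜ.indicator (φ i) = 0 := by
    ext e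
    have := congrFun h.sum_eq e
    simp only [Finset.sum_apply, Pi.zero_apply] at this ⊢
    by_cases he : e ∈ S <;> simp [he, this]
  have hψZ : IsTwoBasis ψ Z := by
    refine ⟨le_antisymm (Submodule.span_le.2 ?_) ?_, ?_, ?_⟩
    · rintro _ ⟨i | i, rfl⟩
      · exact hS _ (h.mem i)
      · exact hScompl _ (h.mem i)
    · rw [← h.span_eq, Submodule.span_le]
      rintro _ ⟨i, rfl⟩
      rw [← Set.indicator_self_add_compl S (φ i)]
      exact Submodule.add_mem _ (Submodule.subset_span ⟨Sum.inl i, rfl⟩)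
        (Submodule.subset_span ⟨Sum.inr i, rfl⟩)
    · rw [Fintype.sum_sum_type]
      change ∑ i, S.indicator (φ i) + ∑ i, Sᶜ.indicator (φ i) = 0
      rw [hsumS, hsumSc, add_zero]
    · intro e
      refine le_trans ?_ (h.card_le e)
      by_cases he : e ∈ S
      · refine card_le_card_of_injOn (Sum.elim id id) ?_ ?_
        · rintro (i | i) <;> simp [hψ, he]
        · rintro (i | i) hi (j | j) hj <;> simp_all
      · refine card_le_card_of_injOn (Sum.elim id id) ?_ ?_
        · rintro (i | i) <;> simp [hψ, he]
        · rintro (i | i) hi (j | j) hj <;> simp_all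
  by_cases hA : ∃ i, φ i a ≠ 0
  · by_cases hB : ∃ j, φ j b ≠ 0
    · obtain ⟨i, hi⟩ := hA
      obtain ⟨j, hj⟩ := hB
      have hne : (Sum.inl i : ι ⊕ ι) ≠ Sum.inr j := by simp
      have hmerge : IsTwoBasis (mergeFamily ψ (Sum.inl i) (Sum.inr j)) Z := by
        refine hψZ.merge hne (le_antisymm (Submodule.span_le.2 ?_) ?_)
        · rintro _ ⟨k, rfl⟩
          unfold mergeFamily
          split_ifs
          · exact Z.add_mem (hψZ.mem _) (hψZ.mem _)
          · exact Z.zero_mem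
          · exact hψZ.mem _
        · set T := Submodule.span (ZMod 2) (Set.range (mergeFamily ψ (Sum.inl i) (Sum.inr j)))
          have hk : ∀ k, k ≠ Sum.inl i → k ≠ Sum.inr j → ψ k ∈ T := by
            intro k h1 h2
            refine Submodule.subset_span ⟨k, ?_⟩
            simp [mergeFamily, h1, h2]
          have hi' : ψ (Sum.inl i) ∈ T := by
            have : ψ (Sum.inl i) = -∑ k ∈ univ.erase i, ψ (Sum.inl k) := by
              rw [eq_neg_iff_add_eq_zero, Finset.add_sum_erase _ (fun k => ψ (Sum.inl k))
                (mem_univ i)]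
              exact hsumS
            rw [this]
            refine T.neg_mem (T.sum_mem fun k hk' => hk _ ?_ (by simp))
            simpa using ne_of_mem_erase hk'
          have hj' : ψ (Sum.inr j) ∈ T := by
            have h1 : ψ (Sum.inl i) + ψ (Sum.inr j) ∈ T :=
              Submodule.subset_span ⟨Sum.inl i, by simp [mergeFamily]⟩
            simpa using T.sub_mem h1 hi'
          rw [← hψZ.span_eq, Submodule.span_le]
          rintro _ ⟨k, rfl⟩
          by_cases h1 : k = Sum.inl i
          · exact h1 ▸ hi'
          by_cases h2 : k = Sum.inr j
          · exact h2 ▸ hj'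
          exact hk k h1 h2
      refine hmerge.inf_ker l ?_
      have hab : ∀ k, l (Sum.elim (fun i => S.indicator (φ i)) (fun i => Sᶜ.indicator (φ i)) k) =
          Sum.elim (fun i => φ i a) (fun i => φ i b) k := by
        rintro (k | k) <;> simp [hl, ha, hb]
      have hsub : (univ.filter fun k => l (mergeFamily ψ (Sum.inl i) (Sum.inr j) k) ≠ 0) ⊆
          ((univ.filter fun k => φ k a ≠ 0).erase i).image Sum.inl ∪
            ((univ.filter fun k => φ k b ≠ 0).erase j).image Sum.inr := by
        intro k hk
        replace hk := (mem_filter.1 hk).2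
        simp only [mergeFamily] at hk
        by_cases h1 : k = Sum.inl i
        · rw [if_pos h1, map_add, hψ, hab, hab] at hk
          simp only [Sum.elim_inl, Sum.elim_inr] at hk
          rw [zmod_two_ne_zero.1 hi, zmod_two_ne_zero.1 hj] at hk
          exact absurd (by decide) hk
        · by_cases h2 : k = Sum.inr j
          · simp [h2] at hk
          · rw [if_neg h1, if_neg h2, hψ, hab] at hk
            rcases k with k | k
            · simp_all
            · simp_all
      refine (card_le_card hsub).trans ((card_union_le _ _).trans ?_)
      refine (Nat.add_le_add card_image_le card_image_le).trans ?_
      rw [card_erase_of_mem (by simpa using hi), card_erase_of_mem (by simpa using hj)]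
      have h1 := h.card_le a
      have h2 := h.card_le b
      omega
    · push Not at hB
      refine h.inf_ker l ?_
      simpa [hl, hB] using h.card_le a
  · push Not at hA
    refine h.inf_ker l ?_
    simpa [hl, hA] using h.card_le b

end TwoBasis

section CycleSpace

open Finset

variable {W : Type*} [Fintype W]

/-- The boundary over `ZMod 2` of a set of edges (as a function on unordered pairs). -/
def pairBoundary (W : Type*) [Fintype W] : (Sym2 W → ZMod 2) →ₗ[ZMod 2] (W → ZMod 2) where
  toFun z w := ∑ u, z s(w, u)
  map_add' y z := by ext w; simp [sum_add_distrib]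
  map_smul' c z := by ext w; simp [mul_sum]

lemma pairBoundary_apply (z : Sym2 W → ZMod 2) (w : W) :
    pairBoundary W z w = ∑ u, z s(w, u) := rfl

/-- The cycle space over `ZMod 2` of a finite simple graph. -/
def cycleSpace (P : SimpleGraph W) : Submodule (ZMod 2) (Sym2 W → ZMod 2) where
  carrier := {z | (∀ e ∉ P.edgeSet, z e = 0) ∧ pairBoundary W z = 0}
  add_mem' := by
    rintro y z ⟨hy, hy'⟩ ⟨hz, hz'⟩
    exact ⟨fun e he => by simp [hy e he, hz e he], by rw [map_add, hy', hz', add_zero]⟩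
  zero_mem' := ⟨fun _ _ => rfl, map_zero _⟩
  smul_mem' := by
    rintro c z ⟨hz, hz'⟩
    exact ⟨fun e he => by simp [hz e he], by rw [map_smul, hz', smul_zero]⟩

lemma mem_cycleSpace {P : SimpleGraph W} {z : Sym2 W → ZMod 2} :
    z ∈ cycleSpace P ↔ (∀ e ∉ P.edgeSet, z e = 0) ∧ ∀ w, ∑ u, z s(w, u) = 0 := by
  change (_ ∧ _) ↔ _
  rw [funext_iff]
  rfl

lemma pairBoundary_single [DecidableEq W] {a b : W} (hab : a ≠ b) :
    pairBoundary W (Pi.single s(a, b) 1) = Pi.single a 1 + Pi.single b 1 := by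
  ext w
  rw [pairBoundary_apply]
  by_cases hwa : w = a
  · subst hwa
    rw [sum_eq_single b]
    · simp [hab]
    · intro u _ hu
      rw [Pi.single_apply, if_neg]
      simp [hu, hab]
    · simp
  · by_cases hwb : w = b
    · subst hwb
      rw [sum_eq_single a]
      · simp [hwa, Sym2.eq_swap]
      · intro u _ hu
        rw [Pi.single_apply, if_neg]
        simp [hu, hab.symm]
      · simp
    · simp only [Pi.add_apply, Pi.single_apply, hwa, hwb, if_false, add_zero]
      refine sum_eq_zero fun u _ => ?_
      simp [hwa, hwb]

/-- The cycle space has dimension at least the number of edges minus the number of non-isolated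
vertices. -/
lemma card_le_finrank_cycleSpace_add (P : SimpleGraph W) (S : Finset (Sym2 W))
    (hS : ↑S = P.edgeSet) (C : Finset W) (hC : ∀ e ∈ S, ∀ w ∈ e, w ∈ C) :
    #S ≤ Module.finrank (ZMod 2) (cycleSpace P) + #C := by
  classical
  let ext : (S → ZMod 2) →ₗ[ZMod 2] (Sym2 W → ZMod 2) :=
    { toFun := fun z e => if h : e ∈ S then z ⟨e, h⟩ else 0
      map_add' := by intro y z; ext e; by_cases h : e ∈ S <;> simp [h]
      map_smul' := by intro c z; ext e; by_cases h : e ∈ S <;> simp [h] }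
  let T : (S → ZMod 2) →ₗ[ZMod 2] (C → ZMod 2) :=
    (LinearMap.funLeft (ZMod 2) (ZMod 2) (Subtype.val : C → W)) ∘ₗ pairBoundary W ∘ₗ ext
  have hT := T.finrank_range_add_finrank_ker
  have h1 : Module.finrank (ZMod 2) (LinearMap.range T) ≤ #C := by
    refine (Submodule.finrank_le _).trans ?_
    simp
  have h2 : Module.finrank (ZMod 2) (LinearMap.ker T) ≤
      Module.finrank (ZMod 2) (cycleSpace P) := by
    have hmem : ∀ z ∈ LinearMap.ker T, ext z ∈ cycleSpace P := by
      intro z hz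
      refine ⟨fun e he => ?_, ?_⟩
      · rw [← hS] at he
        exact dif_neg (by simpa using he)
      · funext w
        by_cases hw : w ∈ C
        · exact congrFun (LinearMap.mem_ker.1 hz) ⟨w, hw⟩
        · refine sum_eq_zero fun u _ => dif_neg fun h => hw (hC _ h w (by simp))
    let F : LinearMap.ker T →ₗ[ZMod 2] cycleSpace P :=
      (ext ∘ₗ (LinearMap.ker T).subtype).codRestrict _ fun z => hmem z z.2
    refine LinearMap.finrank_le_finrank_of_injective (f := F) ?_
    intro y z hyz
    ext e
    have := congrFun (congrArg Subtype.val hyz) e.1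
    change (if h : e.1 ∈ S then y.1 ⟨e.1, h⟩ else 0) = (if h : e.1 ∈ S then z.1 ⟨e.1, h⟩ else 0)
      at this
    simpa using this
  have h3 : Module.finrank (ZMod 2) (S → ZMod 2) = #S := by simp
  omega

end CycleSpace

section Minor

open Finset

variable {A W : Type*} [Fintype A]

/-- Inside connected fibers of a partial map `f`, any function of vanishing fiber sums is the boundary
of a set of edges inside the fibers. -/
lemma exists_pairBoundary_eq [DecidableEq W] (N : SimpleGraph A) (f : A → Option W)
    (hconn : ∀ w a b, f a = some w → f b = some w →
      Relation.ReflTransGen (fun x y => N.Adj x y ∧ f x = some w ∧ f y = some w) a b)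
    (p : A → ZMod 2) (hnone : ∀ a, f a = none → p a = 0)
    (hp : ∀ w, (∑ a, if f a = some w then p a else 0) = 0) :
    ∃ t : Sym2 A → ZMod 2, pairBoundary A t = p ∧
      ∀ e, t e ≠ 0 → e ∈ N.edgeSet ∧ ∃ w, e.map f = s(some w, some w) := by
  classical
  let Q : Submodule (ZMod 2) (Sym2 A → ZMod 2) :=
    { carrier := {t | ∀ e, t e ≠ 0 → e ∈ N.edgeSet ∧ ∃ w, e.map f = s(some w, some w)}
      add_mem' := by
        intro y z hy hz e he
        by_cases h : y e = 0
        · refine hz e fun h' => he ?_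
          simp [h, h']
        · exact hy e h
      zero_mem' := by intro e he; simp at he
      smul_mem' := by
        intro c z hz e he
        refine hz e fun h' => he ?_
        simp [h'] }
  suffices h : p ∈ Q.map (pairBoundary A) by
    obtain ⟨t, ht, rfl⟩ := h
    exact ⟨t, rfl, ht⟩
  have hpair : ∀ w a b, f a = some w → f b = some w →
      (Pi.single a 1 + Pi.single b 1 : A → ZMod 2) ∈ Q.map (pairBoundary A) := by
    intro w a b ha hb
    have := hconn w a b ha hb
    clear hb
    induction this with
    | refl =>
      convert Submodule.zero_mem _
      ext x
      exact CharTwo.add_self_eq_zero _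
    | @tail x y _ hxy ih =>
      have h1 : (Pi.single x 1 + Pi.single y 1 : A → ZMod 2) ∈ Q.map (pairBoundary A) := by
        refine ⟨Pi.single s(x, y) 1, ?_, pairBoundary_single hxy.1.ne⟩
        intro e he
        have : e = s(x, y) := by
          by_contra hcon
          exact he (by simp [hcon])
        subst this
        exact ⟨hxy.1, w, by simp [hxy.2.1, hxy.2.2]⟩
      convert Submodule.add_mem _ ih h1 using 1
      ext v
      have key : ∀ q₁ q₂ q₃ : ZMod 2, q₁ + q₃ = (q₁ + q₂) + (q₂ + q₃) := by decide
      exact key _ _ _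
  let root : ∀ o : Option W, (∃ b, f b = o) → A := fun o h => h.choose
  have hroot : ∀ o h, f (root o h) = o := fun o h => h.choose_spec
  let r : A → A := fun a => root (f a) ⟨a, rfl⟩
  have hfr : ∀ a, f (r a) = f a := fun a => hroot _ _
  have hr : ∀ a b, f a = f b → r a = r b := by
    intro a b hab
    change root (f a) _ = root (f b) _
    congr 1
  have hzero : ∑ a, p a • (Pi.single (r a) 1 : A → ZMod 2) = 0 := by
    ext x
    rw [Finset.sum_apply, Pi.zero_apply]
    cases hx : f x with
    | none =>
      refine sum_eq_zero fun a _ => ?_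
      by_cases hax : r a = x
      · rw [hnone a (by rw [← hfr, hax, hx]), zero_smul, Pi.zero_apply]
      · simp [Ne.symm hax]
    | some w =>
      by_cases hrx : r x = x
      · rw [← hp w]
        refine sum_congr rfl fun a _ => ?_
        by_cases ha : f a = some w
        · have : r a = x := by rw [hr a x (ha.trans hx.symm), hrx]
          simp [ha, this]
        · have : x ≠ r a := fun h => ha (by rw [← hfr, ← h, hx])
          simp [ha, this]
      · refine sum_eq_zero fun a _ => ?_
        have : x ≠ r a := by
          intro h
          apply hrx
          have := hr x a (by rw [h, hfr])
          rw [this, ← h]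
        simp [this]
  have hsum : p = ∑ a, p a • (Pi.single a 1 + Pi.single (r a) 1 : A → ZMod 2) := by
    simp only [smul_add, sum_add_distrib, hzero, add_zero]
    ext x
    simp [Finset.sum_apply, Pi.single_apply]
  rw [hsum]
  refine Submodule.sum_mem _ fun a _ => ?_
  cases ha : f a with
  | none => rw [hnone a ha, zero_smul]; exact Submodule.zero_mem _
  | some w => exact Submodule.smul_mem _ _ (hpair w a (r a) ha (by rw [hfr, ha]))

/-- MacLane's condition passes to minors: `f` records the branch sets. -/
lemma HasTwoBasis.of_minor [Fintype W] (N : SimpleGraph A) (P : SimpleGraph W) (f : A → Option W)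
    (hconn : ∀ w a b, f a = some w → f b = some w →
      Relation.ReflTransGen (fun x y => N.Adj x y ∧ f x = some w ∧ f y = some w) a b)
    (hlink : ∀ u v, P.Adj u v → ∃ a b, N.Adj a b ∧ f a = some u ∧ f b = some v)
    (hN : HasTwoBasis (cycleSpace N)) : HasTwoBasis (cycleSpace P) := by
  classical
  have hg : ∀ e : P.edgeSet, ∃ e' ∈ N.edgeSet, e'.map f = e.1.map some := by
    rintro ⟨e, he⟩
    induction e using Sym2.ind with
    | _ u v =>
      obtain ⟨a, b, hab, ha, hb⟩ := hlink u v he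
      exact ⟨s(a, b), hab, by simp [ha, hb]⟩
  choose g hgN hgf using hg
  have hginj : Function.Injective g := by
    intro d e hde
    have h := hgf d
    rw [hde, hgf e] at h
    exact Subtype.ext (Sym2.map.injective (Option.some_injective _) h.symm)
  let L : (Sym2 A → ZMod 2) →ₗ[ZMod 2] (Sym2 W → ZMod 2) :=
    { toFun := fun z e => if h : e ∈ P.edgeSet then z (g ⟨e, h⟩) else 0
      map_add' := by intro y z; ext e; by_cases h : e ∈ P.edgeSet <;> simp [h]
      map_smul' := by intro c z; ext e; by_cases h : e ∈ P.edgeSet <;> simp [h] }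
  have hL : ∀ z e (h : e ∈ P.edgeSet), L z e = z (g ⟨e, h⟩) := fun z e h => dif_pos h
  have hL' : ∀ z e, e ∉ P.edgeSet → L z e = 0 := fun z e h => dif_neg h
  let fs : (A → ZMod 2) →ₗ[ZMod 2] (W → ZMod 2) :=
    { toFun := fun p w => ∑ a, if f a = some w then p a else 0
      map_add' := by
        intro p q; ext w
        simp only [Pi.add_apply, ← sum_add_distrib]
        exact sum_congr rfl fun a _ => by split_ifs <;> simp
      map_smul' := by
        intro c p; ext w
        simp [mul_sum] }
  have hfs : ∀ a u, f a = some u → fs (Pi.single a 1) = Pi.single u 1 := by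
    intro a u hau
    ext w
    change (∑ b, if f b = some w then (Pi.single a 1 : A → ZMod 2) b else 0) = _
    rw [sum_eq_single a (by intro b _ hb; simp [hb]) (by simp)]
    by_cases huw : u = w
    · subst huw; simp [hau]
    · have : w ≠ u := Ne.symm huw
      simp [hau, huw, this]
  have hfiber : ∀ e' : Sym2 A, (∃ w, e'.map f = s(some w, some w)) → ∀ e, g e ≠ e' := by
    rintro e' ⟨w, hw⟩ e rfl
    rw [hgf] at hw
    have h1 : (e : Sym2 W) = s(w, w) :=
      Sym2.map.injective (Option.some_injective _) (by rw [hw]; rfl)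
    have h2 := e.2
    rw [h1] at h2
    exact P.loopless.irrefl w h2
  have key : ∀ z : Sym2 A → ZMod 2, (∀ e', z e' ≠ 0 → e' ∈ N.edgeSet ∧
      ((∃ w, e'.map f = s(some w, some w)) ∨ ∃ e, g e = e')) →
      fs (pairBoundary A z) = pairBoundary W (L z) := by
    intro z hz
    have hsum : z = ∑ e', z e' • (Pi.single e' 1 : Sym2 A → ZMod 2) := by
      ext x
      simp [Finset.sum_apply, Pi.single_apply]
    rw [hsum]
    simp only [map_sum, map_smul]
    refine sum_congr rfl fun e' _ => ?_
    by_cases hze : z e' = 0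
    · rw [hze, zero_smul, zero_smul]
    congr 1
    obtain ⟨heN, hw | ⟨e, rfl⟩⟩ := hz e' hze
    · have h0 : L (Pi.single e' 1) = 0 := by
        ext e
        by_cases he : e ∈ P.edgeSet
        · rw [hL _ _ he]
          simp [hfiber e' hw ⟨e, he⟩]
        · exact hL' _ _ he
      rw [h0, map_zero]
      obtain ⟨w, hw⟩ := hw
      induction e' using Sym2.ind with
      | _ a b =>
        have hab : f a = some w ∧ f b = some w := by simpa using hw
        rw [pairBoundary_single (N.ne_of_adj heN), map_add, hfs a w hab.1, hfs b w hab.2]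
        ext x
        exact CharTwo.add_self_eq_zero _
    · have h1 : L (Pi.single (g e) 1) = Pi.single e.1 1 := by
        ext d
        by_cases hd : d ∈ P.edgeSet
        · rw [hL _ _ hd]
          by_cases hde : d = e.1
          · subst hde; simp
          · have : g ⟨d, hd⟩ ≠ g e := fun h => hde (congrArg Subtype.val (hginj h))
            simp [hde, this]
        · rw [hL' _ _ hd, Pi.single_apply, if_neg]
          rintro rfl
          exact hd e.2
      rw [h1]
      have h2 := hgf e
      obtain ⟨e, he⟩ := e
      generalize g ⟨e, he⟩ = e' at heN h2 ⊢
      induction e using Sym2.ind with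
      | _ u v =>
      induction e' using Sym2.ind with
      | _ a b =>
        rw [pairBoundary_single (N.ne_of_adj heN), pairBoundary_single (P.ne_of_adj he), map_add]
        simp only [Sym2.map_mk, Sym2.eq_iff] at h2
        rcases h2 with ⟨ha, hb⟩ | ⟨ha, hb⟩
        · rw [hfs a u ha, hfs b v hb]
        · rw [hfs a v ha, hfs b u hb, add_comm]
  let allowed : Sym2 A → Prop := fun e' => (∃ w, e'.map f = s(some w, some w)) ∨ ∃ e, g e = e'
  let Z₀ : Submodule (ZMod 2) (Sym2 A → ZMod 2) :=
    cycleSpace N ⊓ ⨅ e' ∈ (univ.filter fun e' => ¬ allowed e'), LinearMap.ker (LinearMap.proj e')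
  have hZ₀ : ∀ z, z ∈ Z₀ ↔ z ∈ cycleSpace N ∧ ∀ e' ∈ (univ.filter fun e' => ¬ allowed e'),
      z e' = 0 := by
    intro z
    simp [Z₀]
  have h₀ : HasTwoBasis Z₀ := hN.delete _ hZ₀
  have hmap : Z₀.map L = cycleSpace P := by
    refine le_antisymm ?_ ?_
    · rintro _ ⟨z, hz, rfl⟩
      obtain ⟨⟨hzN, hz0⟩, hzal⟩ := (hZ₀ z).1 hz
      refine ⟨hL' z, ?_⟩
      rw [← key z, hz0, map_zero]
      intro e' he'
      refine ⟨not_imp_comm.1 (hzN e') he', ?_⟩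
      by_contra hcon
      exact he' (hzal e' (by simpa [allowed] using hcon))
    · rintro y ⟨hyP, hy0⟩
      let z : Sym2 A → ZMod 2 := ∑ e : P.edgeSet, y e • Pi.single (g e) 1
      have hzg : ∀ e, z (g e) = y e := by
        intro e
        simp only [z, Finset.sum_apply, Pi.smul_apply, Pi.single_apply, smul_eq_mul, mul_ite,
          mul_one, mul_zero]
        rw [sum_eq_single e (by intro d _ hd; rw [if_neg fun h => hd (hginj h.symm)]) (by simp)]
        simp
      have hz' : ∀ e', z e' ≠ 0 → ∃ e, g e = e' := by
        intro e' he'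
        simp only [z, Finset.sum_apply] at he'
        obtain ⟨e, _, he⟩ := exists_ne_zero_of_sum_ne_zero he'
        refine ⟨e, ?_⟩
        by_contra hcon
        exact he (by simp [Ne.symm hcon])
      have hLz : L z = y := by
        ext e
        by_cases he : e ∈ P.edgeSet
        · rw [hL _ _ he, hzg]
        · rw [hL' _ _ he, hyP e he]
      have hzal : ∀ e', z e' ≠ 0 → e' ∈ N.edgeSet ∧
          ((∃ w, e'.map f = s(some w, some w)) ∨ ∃ e, g e = e') := by
        intro e' he'
        obtain ⟨e, rfl⟩ := hz' e' he'
        exact ⟨hgN e, Or.inr ⟨e, rfl⟩⟩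
      obtain ⟨t, ht, htf⟩ := exists_pairBoundary_eq N f hconn (pairBoundary A z)
        (by
          intro a ha
          refine sum_eq_zero fun b _ => ?_
          by_contra hcon
          obtain ⟨e, he⟩ := hz' _ hcon
          have h1 := hgf e
          rw [he, Sym2.map_mk, ha] at h1
          have h2 : (none : Option W) ∈ e.1.map some := h1 ▸ Sym2.mem_mk_left _ _
          simp [Sym2.mem_map] at h2)
        (by
          intro w
          have h1 := congrFun (key z hzal) w
          rw [hLz, hy0] at h1
          exact h1)
      refine ⟨z + t, (hZ₀ _).2 ⟨⟨?_, ?_⟩, ?_⟩, ?_⟩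
      · intro e' he'
        have h1 : z e' = 0 := not_imp_comm.1 (fun h => (hzal e' h).1) he'
        have h2 : t e' = 0 := not_imp_comm.1 (fun h => (htf e' h).1) he'
        simp [h1, h2]
      · rw [map_add, ht]
        ext x
        exact CharTwo.add_self_eq_zero _
      · intro e' he'
        have he'' : ¬ allowed e' := (mem_filter.1 he').2
        have h1 : z e' = 0 := not_imp_comm.1 (fun h => (hzal e' h).2) he''
        have h2 : t e' = 0 := not_imp_comm.1 (fun h => Or.inl (htf e' h).2) he''
        simp [h1, h2]
      · have h0 : L t = 0 := by
          ext e
          by_cases he : e ∈ P.edgeSet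
          · rw [hL _ _ he]
            by_contra hcon
            exact hfiber _ (htf _ hcon).2 ⟨e, he⟩ rfl
          · exact hL' _ _ he
        rw [map_add, h0, add_zero, hLz]
  rw [← hmap]
  refine h₀.map L fun e => ?_
  by_cases he : e ∈ P.edgeSet
  · exact Or.inr ⟨_, fun z _ => hL z e he⟩
  · exact Or.inl fun z _ => hL' z e he

end Minor

section Grid

open Finset

/-- The square grid graph with `(n + 1)²` vertices. -/
abbrev gridGraph (n : ℕ) : SimpleGraph (Fin (n + 1) × Fin (n + 1)) :=
  SimpleGraph.pathGraph (n + 1) □ SimpleGraph.pathGraph (n + 1)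

variable {n : ℕ}

lemma gridGraph_adj {p q : Fin (n + 1) × Fin (n + 1)} : (gridGraph n).Adj p q ↔
    ((p.1.val + 1 = q.1.val ∨ q.1.val + 1 = p.1.val) ∧ p.2 = q.2) ∨
      ((p.2.val + 1 = q.2.val ∨ q.2.val + 1 = p.2.val) ∧ p.1 = q.1) := by
  rw [SimpleGraph.boxProd_adj, SimpleGraph.pathGraph_adj, SimpleGraph.pathGraph_adj]

/-- The horizontal edge of the grid with left end `(i, j)`. -/
def horizontalEdge (i : Fin n) (j : Fin (n + 1)) : Sym2 (Fin (n + 1) × Fin (n + 1)) :=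
  s((i.castSucc, j), (i.succ, j))

/-- The vertical edge of the grid with lower end `(i, j)`. -/
def verticalEdge (i : Fin (n + 1)) (j : Fin n) : Sym2 (Fin (n + 1) × Fin (n + 1)) :=
  s((i, j.castSucc), (i, j.succ))

lemma horizontalEdge_inj {i i' : Fin n} {j j' : Fin (n + 1)}
    (h : horizontalEdge i j = horizontalEdge i' j') : i = i' ∧ j = j' := by
  simp only [horizontalEdge, Sym2.eq_iff, Prod.mk.injEq, Fin.ext_iff, Fin.val_castSucc,
    Fin.val_succ] at h ⊢
  omega

lemma verticalEdge_inj {i i' : Fin (n + 1)} {j j' : Fin n}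
    (h : verticalEdge i j = verticalEdge i' j') : i = i' ∧ j = j' := by
  simp only [verticalEdge, Sym2.eq_iff, Prod.mk.injEq, Fin.ext_iff, Fin.val_castSucc,
    Fin.val_succ] at h ⊢
  omega

lemma horizontalEdge_ne_verticalEdge (i j' : Fin n) (j i' : Fin (n + 1)) :
    horizontalEdge i j ≠ verticalEdge i' j' := by
  intro h
  simp only [verticalEdge, horizontalEdge, Sym2.eq_iff, Prod.mk.injEq, Fin.ext_iff,
    Fin.val_castSucc, Fin.val_succ] at h
  omega

/-- The boundary of a unit square of the grid. -/
def gridSquare (x : Fin n × Fin n) : Sym2 (Fin (n + 1) × Fin (n + 1)) → ZMod 2 :=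
  Pi.single (horizontalEdge x.1 x.2.castSucc) 1 + Pi.single (horizontalEdge x.1 x.2.succ) 1 +
    (Pi.single (verticalEdge x.1.castSucc x.2) 1 + Pi.single (verticalEdge x.1.succ x.2) 1)

lemma gridSquare_mem (x : Fin n × Fin n) : gridSquare x ∈ cycleSpace (gridGraph n) := by
  constructor
  · intro e he
    simp only [gridSquare, Pi.add_apply]
    rw [Pi.single_eq_of_ne, Pi.single_eq_of_ne, Pi.single_eq_of_ne, Pi.single_eq_of_ne]
    · simp
    all_goals
      rintro rfl
      apply he
      simp [horizontalEdge, verticalEdge, SimpleGraph.mem_edgeSet, SimpleGraph.pathGraph_adj]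
  · simp only [gridSquare, map_add, horizontalEdge, verticalEdge]
    rw [pairBoundary_single (by simp [Fin.ext_iff]), pairBoundary_single (by simp [Fin.ext_iff]),
      pairBoundary_single (by simp [Fin.ext_iff]), pairBoundary_single (by simp [Fin.ext_iff])]
    ext w
    have key : ∀ a b c d : ZMod 2, a + b + (c + d) + (a + c + (b + d)) = 0 := by decide
    exact key _ _ _ _

lemma gridSquare_ne_zero {x : Fin n × Fin n} {e : Sym2 (Fin (n + 1) × Fin (n + 1))}
    (h : gridSquare x e ≠ 0) :
    (e = horizontalEdge x.1 x.2.castSucc ∨ e = verticalEdge x.1.castSucc x.2) ∨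
      (e = horizontalEdge x.1 x.2.succ ∨ e = verticalEdge x.1.succ x.2) := by
  contrapose! h
  simp [gridSquare, h]

lemma card_gridSquare_le (e : Sym2 (Fin (n + 1) × Fin (n + 1))) :
    #{x : Fin n × Fin n | gridSquare x e ≠ 0} ≤ 2 := by
  classical
  refine (?_ : _ ≤ #(univ : Finset Bool)).trans (by simp)
  refine card_le_card_of_injOn (fun x => decide (e = horizontalEdge x.1 x.2.castSucc ∨
    e = verticalEdge x.1.castSucc x.2)) (fun _ _ => mem_coe.2 (mem_univ _)) ?_
  intro x hx y hy hxy
  have hx := gridSquare_ne_zero (mem_filter.1 (mem_coe.1 hx)).2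
  have hy := gridSquare_ne_zero (mem_filter.1 (mem_coe.1 hy)).2
  have hiff := decide_eq_decide.1 hxy
  have hH : ∀ (i i' : Fin n) (j j' : Fin (n + 1)), e = horizontalEdge i j →
      e = horizontalEdge i' j' → i = i' ∧ j = j' := fun _ _ _ _ h h' =>
    horizontalEdge_inj (h.symm.trans h')
  have hV : ∀ (i i' : Fin (n + 1)) (j j' : Fin n), e = verticalEdge i j →
      e = verticalEdge i' j' → i = i' ∧ j = j' := fun _ _ _ _ h h' =>
    verticalEdge_inj (h.symm.trans h')
  have hHV : ∀ (i j' : Fin n) (j i' : Fin (n + 1)), e = horizontalEdge i j →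
      e ≠ verticalEdge i' j' := fun _ _ _ _ h h' =>
    horizontalEdge_ne_verticalEdge _ _ _ _ (h.symm.trans h')
  by_cases hlow : e = horizontalEdge x.1 x.2.castSucc ∨ e = verticalEdge x.1.castSucc x.2
  · rcases hlow with h1 | h1 <;> rcases hiff.1 (by tauto) with h2 | h2
    · have := hH _ _ _ _ h1 h2
      exact Prod.ext this.1 (Fin.castSucc_injective _ this.2)
    · exact absurd h2 (hHV _ _ _ _ h1)
    · exact absurd h1 (hHV _ _ _ _ h2)
    · have := hV _ _ _ _ h1 h2
      exact Prod.ext (Fin.castSucc_injective _ this.1) this.2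
  · have hlow' := fun h => hlow (hiff.2 h)
    rcases hx.resolve_left hlow with h1 | h1 <;> rcases hy.resolve_left hlow' with h2 | h2
    · have := hH _ _ _ _ h1 h2
      exact Prod.ext this.1 (Fin.succ_injective _ this.2)
    · exact absurd h2 (hHV _ _ _ _ h1)
    · exact absurd h1 (hHV _ _ _ _ h2)
    · have := hV _ _ _ _ h1 h2
      exact Prod.ext (Fin.succ_injective _ this.1) this.2

lemma mem_span_gridSquare (d : ℕ) : ∀ z ∈ cycleSpace (gridGraph n),
    (∀ p q, p.1.val * (n + 1) + p.2.val + d < (n + 1) * (n + 1) → z s(p, q) = 0) →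
    z ∈ Submodule.span (ZMod 2) (Set.range (gridSquare (n := n))) := by
  induction d with
  | zero =>
    intro z _ hz
    have : z = 0 := by
      ext e
      induction e using Sym2.ind with
      | _ p q =>
        refine hz p q ?_
        have h1 := p.1.is_lt
        have h2 := p.2.is_lt
        nlinarith
    rw [this]
    exact Submodule.zero_mem _
  | succ d ih =>
    intro z hzc hz
    obtain ⟨hzs, hzb⟩ := mem_cycleSpace.1 hzc
    by_cases hp : ∃ p : Fin (n + 1) × Fin (n + 1),
        p.1.val * (n + 1) + p.2.val + (d + 1) = (n + 1) * (n + 1)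
    swap
    · refine ih z hzc fun p q hpq => hz p q ?_
      push Not at hp
      have := hp p
      omega
    obtain ⟨⟨p₁, p₂⟩, hp⟩ := hp
    simp only at hp
    have huniq : ∀ q : Fin (n + 1) × Fin (n + 1),
        q.1.val * (n + 1) + q.2.val + (d + 1) = (n + 1) * (n + 1) → q = (p₁, p₂) := by
      intro q hq
      have h1 := q.2.is_lt
      have h2 := p₂.is_lt
      have h3 : q.1.val = p₁.val := by
        rcases lt_trichotomy q.1.val p₁.val with h | h | h
        · nlinarith
        · exact h
        · nlinarith
      have h4 : q.2.val = p₂.val := by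
        rw [h3] at hq; omega
      exact Prod.ext (Fin.ext h3) (Fin.ext h4)
    have hsmall : ∀ q, z s((p₁, p₂), q) ≠ 0 →
        (p₁.val + 1 = q.1.val ∧ p₂ = q.2) ∨ (p₂.val + 1 = q.2.val ∧ p₁ = q.1) := by
      intro q hq
      have hadj : (gridGraph n).Adj (p₁, p₂) q := not_imp_comm.1 (hzs s((p₁, p₂), q)) hq
      rw [gridGraph_adj] at hadj
      rw [Sym2.eq_swap] at hq
      have hge := mt (hz q (p₁, p₂)) hq
      rcases hadj with ⟨h | h, h'⟩ | ⟨h | h, h'⟩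
      · exact Or.inl ⟨h, h'⟩
      · exfalso
        simp only at h h'
        rw [← h'] at hge
        rw [← h] at hp
        nlinarith
      · exact Or.inr ⟨h, h'⟩
      · exfalso
        simp only at h h'
        rw [← h'] at hge
        omega
    have hb := hzb (p₁, p₂)
    have hnext : ∀ y ∈ cycleSpace (gridGraph n),
        (∀ p q, p.1.val * (n + 1) + p.2.val + (d + 1) < (n + 1) * (n + 1) → y s(p, q) = 0) →
        (∀ q, y s((p₁, p₂), q) = 0) →
        y ∈ Submodule.span (ZMod 2) (Set.range (gridSquare (n := n))) := by
      intro y hy hy' hyp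
      refine ih y hy fun p q hpq => ?_
      by_cases h : p.1.val * (n + 1) + p.2.val + (d + 1) < (n + 1) * (n + 1)
      · exact hy' p q h
      · rw [huniq p (by omega)]
        exact hyp q
    induction p₁ using Fin.lastCases with
    | last =>
      refine hnext z hzc hz fun q => ?_
      by_contra hq
      rw [sum_eq_single q ?_ (by simp)] at hb
      · exact hq hb
      · intro q' _ hne
        by_contra hq'
        have h1 := hsmall q hq
        have h2 := hsmall q' hq'
        have h3 := q.1.is_lt
        have h4 := q'.1.is_lt
        simp only [Fin.val_last, Fin.ext_iff] at h1 h2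
        exact hne (Prod.ext (Fin.ext (by omega)) (Fin.ext (by omega)))
    | cast i =>
    induction p₂ using Fin.lastCases with
    | last =>
      refine hnext z hzc hz fun q => ?_
      by_contra hq
      rw [sum_eq_single q ?_ (by simp)] at hb
      · exact hq hb
      · intro q' _ hne
        by_contra hq'
        have h1 := hsmall q hq
        have h2 := hsmall q' hq'
        have h3 := q.2.is_lt
        have h4 := q'.2.is_lt
        simp only [Fin.val_last, Fin.ext_iff] at h1 h2
        exact hne (Prod.ext (Fin.ext (by omega)) (Fin.ext (by omega)))
    | cast j =>
      have hq2 : ∀ q, z s((i.castSucc, j.castSucc), q) ≠ 0 →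
          q = (i.succ, j.castSucc) ∨ q = (i.castSucc, j.succ) := by
        intro q hq
        rcases hsmall q hq with ⟨h, h'⟩ | ⟨h, h'⟩
        · exact Or.inl (Prod.ext (Fin.ext (by simpa using h.symm)) h'.symm)
        · exact Or.inr (Prod.ext h'.symm (Fin.ext (by simpa using h.symm)))
      have hne : ((i.succ, j.castSucc) : Fin (n + 1) × Fin (n + 1)) ≠ (i.castSucc, j.succ) := by
        simp [Fin.ext_iff]
      have hsum : z (horizontalEdge i j.castSucc) + z (verticalEdge i.castSucc j) = 0 := by
        rw [← sum_subset (subset_univ {(i.succ, j.castSucc), (i.castSucc, j.succ)}) ?_,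
          sum_pair hne] at hb
        · exact hb
        · intro q _ hq
          by_contra hcon
          exact hq (by simpa using hq2 q hcon)
      set c := z (horizontalEdge i j.castSucc) with hc
      have hc' : z (verticalEdge i.castSucc j) = c := by
        revert hsum
        generalize z (verticalEdge i.castSucc j) = c'
        generalize c = c
        revert c c'; decide
      have hmem : z + c • gridSquare (i, j) ∈
          Submodule.span (ZMod 2) (Set.range (gridSquare (n := n))) := by
        refine hnext _ (Submodule.add_mem _ hzc (Submodule.smul_mem _ _ (gridSquare_mem _))) ?_ ?_
        · intro p q hpq
          have h0 : gridSquare (i, j) s(p, q) = 0 := by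
            by_contra hcon
            have := gridSquare_ne_zero hcon
            simp only [horizontalEdge, verticalEdge, Sym2.eq_iff, Prod.ext_iff, Fin.ext_iff,
              Fin.val_castSucc, Fin.val_succ] at this hp
            have h1 : i.val ≤ p.1.val ∧ j.val ≤ p.2.val := by omega
            nlinarith
          simp [h0, hz p q hpq]
        · intro q
          have hE : ∀ e e' : Sym2 (Fin (n + 1) × Fin (n + 1)), e ≠ e' →
              (Pi.single e' 1 : Sym2 (Fin (n + 1) × Fin (n + 1)) → ZMod 2) e = 0 := by
            intro e e' h
            simp [h]
          have hHH : horizontalEdge i j.castSucc ≠ horizontalEdge i j.succ := fun h => by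
            simpa [Fin.ext_iff] using (horizontalEdge_inj h).2
          have hVV : verticalEdge i.castSucc j ≠ verticalEdge i.succ j := fun h => by
            simpa [Fin.ext_iff] using (verticalEdge_inj h).1
          have hHV := fun a b c d => horizontalEdge_ne_verticalEdge (n := n) a b c d
          have hcc : c + c = 0 := CharTwo.add_self_eq_zero c
          by_cases h1 : q = (i.succ, j.castSucc)
          · subst h1
            change z (horizontalEdge i j.castSucc) +
              c * gridSquare (i, j) (horizontalEdge i j.castSucc) = 0
            simp only [gridSquare, Pi.add_apply]
            rw [hE _ _ hHH, hE _ _ (hHV _ _ _ _), hE _ _ (hHV _ _ _ _), ← hc]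
            simpa using hcc
          by_cases h2 : q = (i.castSucc, j.succ)
          · subst h2
            change z (verticalEdge i.castSucc j) +
              c * gridSquare (i, j) (verticalEdge i.castSucc j) = 0
            simp only [gridSquare, Pi.add_apply]
            rw [hE _ _ hVV, hE _ _ (hHV _ _ _ _).symm, hE _ _ (hHV _ _ _ _).symm, hc']
            simpa using hcc
          · have hz0 : z s((i.castSucc, j.castSucc), q) = 0 := by
              by_contra hcon
              rcases hq2 q hcon with h | h <;> contradiction
            have h0 : gridSquare (i, j) s((i.castSucc, j.castSucc), q) = 0 := by
              by_contra hcon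
              have := gridSquare_ne_zero hcon
              simp only [horizontalEdge, verticalEdge, Sym2.eq_iff, Prod.ext_iff, Fin.ext_iff,
                Fin.val_castSucc, Fin.val_succ] at this h1 h2
              omega
            simp [hz0, h0]
      have hz2 : z = (z + c • gridSquare (i, j)) - c • gridSquare (i, j) := by
        rw [add_sub_cancel_right]
      rw [hz2]
      exact Submodule.sub_mem _ hmem (Submodule.smul_mem _ _ (Submodule.subset_span ⟨_, rfl⟩))

/-- The cycle space of a grid has a 2-basis, the unit squares together with the outer boundary. -/
lemma hasTwoBasis_gridGraph (n : ℕ) : HasTwoBasis (cycleSpace (gridGraph n)) := by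
  refine hasTwoBasis_of_card_le (gridSquare (n := n)) (le_antisymm ?_ ?_) card_gridSquare_le
  · rw [Submodule.span_le]
    rintro _ ⟨x, rfl⟩
    exact gridSquare_mem x
  · intro z hz
    exact mem_span_gridSquare ((n + 1) * (n + 1)) z hz fun p q h => by omega

end Grid

section PlanarSets

open Filter Topology

/-- The lattice of mesh `h` based at `(-M, -M)`. -/
def latticePoint (h M : ℝ) {n : ℕ} (p : Fin (n + 1) × Fin (n + 1)) : ℝ × ℝ :=
  (h * p.1.val - M, h * p.2.val - M)

/-- The lattice points at distance less than `R` from `K`. -/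
def pixels (h M : ℝ) (n : ℕ) (R : ℝ) (K : Set (ℝ × ℝ)) : Set (Fin (n + 1) × Fin (n + 1)) :=
  {p | ∃ k ∈ K, dist (latticePoint h M p) k < R}

/-- Walkability inside a set of grid vertices. -/
def GridConn {n : ℕ} (S : Set (Fin (n + 1) × Fin (n + 1))) :
    Fin (n + 1) × Fin (n + 1) → Fin (n + 1) × Fin (n + 1) → Prop :=
  Relation.ReflTransGen fun x y => (gridGraph n).Adj x y ∧ x ∈ S ∧ y ∈ S

lemma GridConn.mono {n : ℕ} {S T : Set (Fin (n + 1) × Fin (n + 1))} (hST : S ⊆ T)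
    {p q : Fin (n + 1) × Fin (n + 1)} (h : GridConn S p q) : GridConn T p q :=
  Relation.ReflTransGen.mono (fun _ _ hxy => ⟨hxy.1, hST hxy.2.1, hST hxy.2.2⟩) _ _ h

lemma GridConn.symm {n : ℕ} {S : Set (Fin (n + 1) × Fin (n + 1))}
    {p q : Fin (n + 1) × Fin (n + 1)} (h : GridConn S p q) : GridConn S q p :=
  have : Std.Symm fun x y => (gridGraph n).Adj x y ∧ x ∈ S ∧ y ∈ S :=
    ⟨fun _ _ hxy => ⟨hxy.1.symm, hxy.2.2, hxy.2.1⟩⟩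
  Std.Symm.symm (r := Relation.ReflTransGen fun x y => (gridGraph n).Adj x y ∧ x ∈ S ∧ y ∈ S) _ _ h

lemma reflTransGen_pathGraph_of_ordConnected {n : ℕ} (A : Set (Fin (n + 1))) [hI : A.OrdConnected]
    {a b : Fin (n + 1)} (ha : a ∈ A) (hb : b ∈ A) :
    Relation.ReflTransGen (fun x y => (SimpleGraph.pathGraph (n + 1)).Adj x y ∧ x ∈ A ∧ y ∈ A)
      a b := by
  have hadj : ∀ i j : Fin (n + 1), i < j → (SimpleGraph.pathGraph (n + 1)).Adj i (Order.succ i) := by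
    intro i j hij
    exact Or.inl (Order.covBy_succ_of_not_isMax fun h => (h.isTop j).not_gt hij)
  refine reflTransGen_of_succ _ (fun i hi => ?_) fun i hi => ?_
  · have h1 : i ∈ A := hI.out ha hb ⟨hi.1, hi.2.le⟩
    have h2 : Order.succ i ∈ A :=
      hI.out ha hb ⟨hi.1.trans (Order.le_succ i), Order.succ_le_of_lt hi.2⟩
    exact ⟨hadj i _ hi.2, h1, h2⟩
  · have h1 : i ∈ A := hI.out hb ha ⟨hi.1, hi.2.le⟩
    have h2 : Order.succ i ∈ A :=
      hI.out hb ha ⟨hi.1.trans (Order.le_succ i), Order.succ_le_of_lt hi.2⟩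
    exact ⟨(hadj i _ hi.2).symm, h2, h1⟩

lemma gridConn_prod {n : ℕ} (A J : Set (Fin (n + 1))) [A.OrdConnected] [J.OrdConnected]
    {p q : Fin (n + 1) × Fin (n + 1)} (hp : p ∈ A ×ˢ J) (hq : q ∈ A ×ˢ J) :
    GridConn (A ×ˢ J) p q := by
  have h1 : GridConn (A ×ˢ J) p (q.1, p.2) := by
    have := reflTransGen_pathGraph_of_ordConnected A hp.1 hq.1
    refine Relation.ReflTransGen.lift (fun x => (x, p.2)) (fun x y hxy => ?_) _ _ this
    exact ⟨Or.inl ⟨hxy.1, rfl⟩, ⟨hxy.2.1, hp.2⟩, ⟨hxy.2.2, hp.2⟩⟩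
  have h2 : GridConn (A ×ˢ J) (q.1, p.2) q := by
    have := reflTransGen_pathGraph_of_ordConnected J hp.2 hq.2
    refine Relation.ReflTransGen.lift (fun x => (q.1, x)) (fun x y hxy => ?_) _ _ this
    exact ⟨Or.inr ⟨hxy.1, rfl⟩, ⟨hq.1, hxy.2.1⟩, ⟨hq.1, hxy.2.2⟩⟩
  exact h1.trans h2

variable {h M : ℝ} {n : ℕ}

lemma ordConnected_lattice (hh : 0 < h) (R c : ℝ) :
    {i : Fin (n + 1) | dist (h * i.val - M) c < R}.OrdConnected := by
  refine ⟨fun a ha b hb i hi => ?_⟩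
  have h1 : (a.val : ℝ) ≤ i.val := by exact_mod_cast hi.1
  have h2 : (i.val : ℝ) ≤ b.val := by exact_mod_cast hi.2
  have h3 := mul_le_mul_of_nonneg_left h1 hh.le
  have h4 := mul_le_mul_of_nonneg_left h2 hh.le
  have ha' : |h * a.val - M - c| < R := ha
  have hb' : |h * b.val - M - c| < R := hb
  change |h * i.val - M - c| < R
  rw [abs_lt] at *
  constructor <;> linarith

lemma gridConn_pixels_singleton (hh : 0 < h) (R : ℝ) (k : ℝ × ℝ)
    {p q : Fin (n + 1) × Fin (n + 1)} (hp : p ∈ pixels h M n R {k}) (hq : q ∈ pixels h M n R {k}) :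
    GridConn (pixels h M n R {k}) p q := by
  have heq : pixels h M n R {k} = {i : Fin (n + 1) | dist (h * i.val - M) k.1 < R} ×ˢ
      {i : Fin (n + 1) | dist (h * i.val - M) k.2 < R} := by
    ext p
    simp [pixels, latticePoint, Prod.dist_eq]
  rw [heq] at hp hq ⊢
  have := ordConnected_lattice (M := M) (n := n) hh R k.1
  have := ordConnected_lattice (M := M) (n := n) hh R k.2
  exact gridConn_prod _ _ hp hq

lemma exists_lattice_dist_lt (hh : 0 < h) (hn : 2 * M ≤ n * h) {x : ℝ} (hx : |x| ≤ M) :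
    ∃ i : Fin (n + 1), dist (h * i.val - M) x < h := by
  rw [abs_le] at hx
  have h0 : 0 ≤ (x + M) / h := div_nonneg (by linarith) hh.le
  have h1 : ⌊(x + M) / h⌋₊ ≤ n := by
    refine Nat.floor_le_of_le ?_
    rw [div_le_iff₀ hh]
    linarith
  refine ⟨⟨⌊(x + M) / h⌋₊, by omega⟩, ?_⟩
  have h2 := Nat.floor_le h0
  have h3 := Nat.lt_floor_add_one ((x + M) / h)
  rw [le_div_iff₀ hh] at h2
  rw [div_lt_iff₀ hh] at h3
  rw [Real.dist_eq, abs_lt]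
  constructor <;> simp only <;> linarith

lemma exists_mem_pixels (hh : 0 < h) (hn : 2 * M ≤ n * h) {R : ℝ} (hR : h ≤ R) {k : ℝ × ℝ}
    (hk : k ∈ Metric.closedBall (0 : ℝ × ℝ) M) : ∃ p, p ∈ pixels h M n R {k} := by
  rw [mem_closedBall_zero_iff, Prod.norm_def, max_le_iff] at hk
  obtain ⟨i, hi⟩ := exists_lattice_dist_lt hh hn hk.1
  obtain ⟨j, hj⟩ := exists_lattice_dist_lt hh hn hk.2
  refine ⟨(i, j), k, rfl, ?_⟩
  rw [Prod.dist_eq, max_lt_iff]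
  exact ⟨hi.trans_le hR, hj.trans_le hR⟩

lemma pixels_singleton_subset {R : ℝ} {K : Set (ℝ × ℝ)} {k : ℝ × ℝ} (hk : k ∈ K) :
    pixels h M n R {k} ⊆ pixels h M n R K := by
  rintro p ⟨k', rfl, hp⟩
  exact ⟨_, hk, hp⟩

/-- Pixelations of preconnected sets are connected in the grid. -/
lemma gridConn_pixels (hh : 0 < h) (hn : 2 * M ≤ n * h) {R : ℝ} (hR : h ≤ R) {K : Set (ℝ × ℝ)}
    (hK : IsPreconnected K) (hKM : K ⊆ Metric.closedBall 0 M) {p q : Fin (n + 1) × Fin (n + 1)}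
    (hp : p ∈ pixels h M n R K) (hq : q ∈ pixels h M n R K) : GridConn (pixels h M n R K) p q := by
  obtain ⟨k, hk, hpk⟩ := hp
  obtain ⟨l, hl, hql⟩ := hq
  have hP := hK.induction₂ (fun x y => x ∈ K → y ∈ K → ∀ p ∈ pixels h M n R {x},
    ∀ q ∈ pixels h M n R {y}, GridConn (pixels h M n R K) p q) ?_ ?_ ?_ hk hl
  · exact hP hk hl p ⟨k, rfl, hpk⟩ q ⟨l, rfl, hql⟩
  · intro x hx
    obtain ⟨m, hm⟩ := exists_mem_pixels hh hn hR (hKM hx)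
    have hmx : dist (latticePoint h M m) x < R := by
      obtain ⟨_, rfl, h'⟩ := hm
      exact h'
    have hev : ∀ᶠ y in 𝓝 x, dist (latticePoint h M m) y < R :=
      (continuous_const.dist continuous_id).continuousAt.eventually_lt continuousAt_const hmx
    filter_upwards [mem_nhdsWithin_of_mem_nhds hev] with y hy _ hyK p hp q hq
    have h1 := (gridConn_pixels_singleton hh R x hp hm).mono (pixels_singleton_subset hx)
    have h2 := (gridConn_pixels_singleton hh R y ⟨y, rfl, hy⟩ hq).mono
      (pixels_singleton_subset hyK)
    exact Relation.ReflTransGen.trans h1 h2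
  · intro x y z hx hy hz hxy hyz _ _ p hp q hq
    obtain ⟨m, hm⟩ := exists_mem_pixels hh hn hR (hKM hy)
    exact Relation.ReflTransGen.trans (hxy hx hy p hp m hm) (hyz hy hz m hm q hq)
  · intro x y hx hy hxy _ _ p hp q hq
    exact (hxy hx hy q hq p hp).symm

lemma eventually_le_dist {K L : Set (ℝ × ℝ)} (hK : IsCompact K) (hL : IsCompact L)
    (hKL : Disjoint K L) : ∀ᶠ r in 𝓝[>] (0 : ℝ), ∀ x ∈ K, ∀ y ∈ L, 4 * r ≤ dist x y := by
  obtain ⟨r, hr, hrd⟩ := Metric.exists_pos_forall_lt_edist hK hL.isClosed hKL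
  have h4 : (0 : ℝ) < r / 4 := by positivity
  filter_upwards [Ioo_mem_nhdsGT h4] with s hs x hx y hy
  have h1 := hrd x hx y hy
  rw [edist_dist, ENNReal.lt_ofReal_iff_toReal_lt (by simp)] at h1
  simp only [ENNReal.coe_toReal] at h1
  have := hs.2
  linarith

/-- A graph whose vertices are represented by pairwise disjoint compact preconnected plane sets, and
whose edges by compact preconnected sets meeting only the sets of their ends and meeting each other
only inside the vertex sets, satisfies MacLane's condition. -/
lemma hasTwoBasis_of_planar_sets {W : Type*} [Fintype W] (P : SimpleGraph W)
    (B : W → Set (ℝ × ℝ)) (Γ : Sym2 W → Set (ℝ × ℝ)) (hBc : ∀ w, IsCompact (B w))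
    (hBp : ∀ w, IsPreconnected (B w)) (hBd : ∀ u w, u ≠ w → Disjoint (B u) (B w))
    (hΓc : ∀ e ∈ P.edgeSet, IsCompact (Γ e)) (hΓp : ∀ e ∈ P.edgeSet, IsPreconnected (Γ e))
    (hmeet : ∀ e ∈ P.edgeSet, ∀ u ∈ e, (Γ e ∩ B u).Nonempty)
    (hmiss : ∀ e ∈ P.edgeSet, ∀ w ∉ e, Disjoint (Γ e) (B w))
    (hΓd : ∀ e ∈ P.edgeSet, ∀ e' ∈ P.edgeSet, e ≠ e' → Γ e ∩ Γ e' ⊆ ⋃ w, B w) :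
    HasTwoBasis (cycleSpace P) := by
  classical
  obtain ⟨M, hBM, hΓM⟩ : ∃ M, (∀ w, B w ⊆ Metric.closedBall 0 M) ∧
      ∀ e ∈ P.edgeSet, Γ e ⊆ Metric.closedBall 0 M := by
    have hcomp : IsCompact ((⋃ w, B w) ∪ ⋃ e : P.edgeSet, Γ e) :=
      (isCompact_iUnion hBc).union (isCompact_iUnion fun e => hΓc e e.2)
    obtain ⟨M, hM⟩ := hcomp.isBounded.subset_closedBall 0
    refine ⟨M, fun w => ?_, fun e he => ?_⟩
    · exact (Set.subset_iUnion B w).trans (Set.subset_union_left.trans hM)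
    · exact (Set.subset_iUnion (fun e : P.edgeSet => Γ e) ⟨e, he⟩).trans
        (Set.subset_union_right.trans hM)
  obtain ⟨r, hr0, hrB, hrΓ⟩ : ∃ r : ℝ, 0 < r ∧
      (∀ u w, u ≠ w → ∀ x ∈ B u, ∀ y ∈ B w, 4 * r ≤ dist x y) ∧
      ∀ e ∈ P.edgeSet, ∀ w ∉ e, ∀ x ∈ Γ e, ∀ y ∈ B w, 4 * r ≤ dist x y := by
    have h1 : ∀ᶠ r in 𝓝[>] (0 : ℝ), ∀ u w, u ≠ w → ∀ x ∈ B u, ∀ y ∈ B w, 4 * r ≤ dist x y := by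
      refine eventually_all.2 fun u => eventually_all.2 fun w => eventually_imp_distrib_left.2 ?_
      exact fun huw => eventually_le_dist (hBc u) (hBc w) (hBd u w huw)
    have h2 : ∀ᶠ r in 𝓝[>] (0 : ℝ), ∀ e ∈ P.edgeSet, ∀ w ∉ e, ∀ x ∈ Γ e, ∀ y ∈ B w,
        4 * r ≤ dist x y := by
      refine eventually_all.2 fun e => eventually_imp_distrib_left.2 fun he =>
        eventually_all.2 fun w => eventually_imp_distrib_left.2 fun hw => ?_
      exact eventually_le_dist (hΓc e he) (hBc w) (hmiss e he w hw)
    obtain ⟨r, hr0, hr1, hr2⟩ := (eventually_mem_nhdsWithin.and (h1.and h2)).exists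
    exact ⟨r, hr0, hr1, hr2⟩
  let K : Sym2 W → Set (ℝ × ℝ) := fun e => Γ e \ ⋃ w, Metric.thickening (r / 2) (B w)
  have hKc : ∀ e ∈ P.edgeSet, IsCompact (K e) := fun e he =>
    (hΓc e he).diff (isOpen_iUnion fun w => Metric.isOpen_thickening)
  have hKd : ∀ e ∈ P.edgeSet, ∀ e' ∈ P.edgeSet, e ≠ e' → Disjoint (K e) (K e') := by
    intro e he e' he' hne
    rw [Set.disjoint_left]
    intro x hx hx'
    obtain ⟨w, hw⟩ := Set.mem_iUnion.1 (hΓd e he e' he' hne ⟨hx.1, hx'.1⟩)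
    exact hx.2 (Set.mem_iUnion.2 ⟨w, Metric.self_subset_thickening (by positivity) _ hw⟩)
  obtain ⟨h, hh0, hhr, hhK⟩ : ∃ h : ℝ, 0 < h ∧ h < r / 2 ∧
      ∀ e ∈ P.edgeSet, ∀ e' ∈ P.edgeSet, e ≠ e' → ∀ x ∈ K e, ∀ y ∈ K e', 4 * h ≤ dist x y := by
    have h1 : ∀ᶠ h in 𝓝[>] (0 : ℝ), ∀ e ∈ P.edgeSet, ∀ e' ∈ P.edgeSet, e ≠ e' → ∀ x ∈ K e,
        ∀ y ∈ K e', 4 * h ≤ dist x y := by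
      refine eventually_all.2 fun e => eventually_imp_distrib_left.2 fun he =>
        eventually_all.2 fun e' => eventually_imp_distrib_left.2 fun he' =>
        eventually_imp_distrib_left.2 fun hne => ?_
      exact eventually_le_dist (hKc e he) (hKc e' he') (hKd e he e' he' hne)
    have h2 : ∀ᶠ h in 𝓝[>] (0 : ℝ), h ∈ Set.Ioo 0 (r / 2) := Ioo_mem_nhdsGT (by positivity)
    obtain ⟨h, hh1, hh2⟩ := (h1.and h2).exists
    exact ⟨h, hh2.1, hh2.2, hh1⟩
  obtain ⟨n, hn⟩ : ∃ n : ℕ, 2 * M ≤ n * h := by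
    obtain ⟨n, hn⟩ := exists_nat_ge (2 * M / h)
    exact ⟨n, (div_le_iff₀ hh0).1 hn⟩
  let X : W → Set (Fin (n + 1) × Fin (n + 1)) := fun w => pixels h M n r (B w)
  let C : Sym2 W → Set (Fin (n + 1) × Fin (n + 1)) := fun e => pixels h M n h (Γ e)
  have hX : ∀ w p q, p ∈ X w → q ∈ X w → GridConn (X w) p q := fun w p q hp hq =>
    gridConn_pixels hh0 hn (by linarith) (hBp w) (hBM w) hp hq
  have hC : ∀ e ∈ P.edgeSet, ∀ p q, p ∈ C e → q ∈ C e → GridConn (C e) p q :=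
    fun e he p q hp hq => gridConn_pixels hh0 hn le_rfl (hΓp e he) (hΓM e he) hp hq
  have hXX : ∀ u w p, p ∈ X u → p ∈ X w → u = w := by
    rintro u w p ⟨x, hx, hpx⟩ ⟨y, hy, hpy⟩
    by_contra hne
    have h1 := hrB u w hne x hx y hy
    have h2 := dist_triangle_left x y (latticePoint h M p)
    linarith
  have hCX : ∀ e ∈ P.edgeSet, ∀ w p, p ∈ C e → p ∈ X w → w ∈ e := by
    rintro e he w p ⟨x, hx, hpx⟩ ⟨y, hy, hpy⟩
    by_contra hne
    have h1 := hrΓ e he w hne x hx y hy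
    have h2 := dist_triangle_left x y (latticePoint h M p)
    linarith
  have hCC : ∀ e ∈ P.edgeSet, ∀ e' ∈ P.edgeSet, ∀ p, p ∈ C e → p ∈ C e' → (∀ w, p ∉ X w) →
      e = e' := by
    rintro e he e' he' p ⟨x, hx, hpx⟩ ⟨y, hy, hpy⟩ hp
    by_contra hne
    have hmem : ∀ z, dist (latticePoint h M p) z < h →
        z ∉ ⋃ w, Metric.thickening (r / 2) (B w) := by
      intro z hz hz'
      obtain ⟨w, hw⟩ := Set.mem_iUnion.1 hz'
      obtain ⟨b, hb, hzb⟩ := Metric.mem_thickening_iff.1 hw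
      refine hp w ⟨b, hb, ?_⟩
      have := dist_triangle (latticePoint h M p) z b
      linarith
    have h1 := hhK e he e' he' hne x ⟨hx, hmem x hpx⟩ y ⟨hy, hmem y hpy⟩
    have h2 := dist_triangle_left x y (latticePoint h M p)
    linarith
  let t : Sym2 W → W := fun e => e.out.1
  have ht : ∀ e, t e ∈ e := fun e => Sym2.out_fst_mem e
  let Λ : W → Set (Fin (n + 1) × Fin (n + 1)) := fun u =>
    X u ∪ {p | (∀ w, p ∉ X w) ∧ ∃ e ∈ P.edgeSet, t e = u ∧ p ∈ C e}
  have hΛ : ∀ u w p, p ∈ Λ u → p ∈ Λ w → u = w := by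
    rintro u w p (hp | ⟨hp, e, he, rfl, hpe⟩) (hp' | ⟨hp', e', he', rfl, hpe'⟩)
    · exact hXX u w p hp hp'
    · exact absurd hp (hp' u)
    · exact absurd hp' (hp w)
    · rw [hCC e he e' he' p hpe hpe' hp]
  let F : W → Set (Fin (n + 1) × Fin (n + 1)) := fun u => {p | ∃ x ∈ X u, GridConn (Λ u) x p}
  have hXF : ∀ u, X u ⊆ F u := fun u x hx => ⟨x, hx, Relation.ReflTransGen.refl⟩
  have hFΛ : ∀ u, F u ⊆ Λ u := by
    rintro u p ⟨x, hx, hxp⟩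
    rcases Relation.ReflTransGen.cases_tail hxp with rfl | ⟨y, _, hy⟩
    · exact Or.inl hx
    · exact hy.2.2
  have hstep : ∀ u x y, x ∈ F u → (gridGraph n).Adj x y → y ∈ Λ u → y ∈ F u := by
    rintro u x y hx hxy hy
    obtain ⟨x₀, hx₀, hx₀x⟩ := id hx
    exact ⟨x₀, hx₀, hx₀x.tail ⟨hxy, hFΛ u hx, hy⟩⟩
  have hFX : ∀ u p, p ∈ F u → ∃ x ∈ X u, GridConn (F u) x p := by
    rintro u p ⟨x, hx, hxp⟩
    refine ⟨x, hx, ?_⟩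
    have hboth : GridConn (F u) x p ∧ p ∈ F u := by
      induction hxp with
      | refl => exact ⟨Relation.ReflTransGen.refl, hXF u hx⟩
      | tail _ hyz ih =>
        have hz := hstep u _ _ ih.2 hyz.1 hyz.2.2
        exact ⟨ih.1.tail ⟨hyz.1, ih.2, hz⟩, hz⟩
    exact hboth.1
  have hFconn : ∀ u p q, p ∈ F u → q ∈ F u → GridConn (F u) p q := by
    intro u p q hp hq
    obtain ⟨x, hx, hxp⟩ := hFX u p hp
    obtain ⟨y, hy, hyq⟩ := hFX u q hq
    exact (hxp.symm.trans ((hX u x y hx hy).mono (hXF u))).trans hyq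
  have hlink : ∀ e ∈ P.edgeSet, ∀ v, e = s(t e, v) →
      ∃ a b, (gridGraph n).Adj a b ∧ a ∈ F (t e) ∧ b ∈ X v := by
    intro e he v hev
    have hpix : ∀ w ∈ e, ∃ p, p ∈ C e ∧ p ∈ X w := by
      intro w hw
      obtain ⟨k, hk, hk'⟩ := hmeet e he w hw
      obtain ⟨p, k', rfl, hp⟩ := exists_mem_pixels hh0 hn le_rfl (hΓM e he hk)
      exact ⟨p, ⟨_, hk, hp⟩, ⟨_, hk', by linarith⟩⟩
    obtain ⟨p, hpC, hpX⟩ := hpix (t e) (ht e)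
    obtain ⟨q, hqC, hqX⟩ := hpix v (hev ▸ Sym2.mem_mk_right _ _)
    have hne : t e ≠ v := by
      rintro h'
      rw [← h'] at hev
      rw [hev] at he
      exact P.ne_of_adj he rfl
    have key : ∀ x, GridConn (C e) p x →
        (∃ a b, (gridGraph n).Adj a b ∧ a ∈ F (t e) ∧ b ∈ X v) ∨ x ∈ F (t e) := by
      intro x hx
      induction hx with
      | refl => exact Or.inr (hXF _ hpX)
      | @tail x y _ hxy ih =>
        refine ih.elim Or.inl fun hxF => ?_
        by_cases hyv : y ∈ X v
        · exact Or.inl ⟨x, y, hxy.1, hxF, hyv⟩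
        refine Or.inr (hstep _ x y hxF hxy.1 ?_)
        by_cases hyt : y ∈ X (t e)
        · exact Or.inl hyt
        · refine Or.inr ⟨fun w hw => ?_, e, he, rfl, hxy.2.2⟩
          have hwe := hCX e he w y hxy.2.2 hw
          rw [hev, Sym2.mem_iff] at hwe
          rcases hwe with rfl | rfl
          · exact hyt hw
          · exact hyv hw
    refine (key q (hC e he p q hpC hqC)).resolve_right fun hq => ?_
    exact hne (hΛ _ _ q (hFΛ _ hq) (Or.inl hqX))
  let f : Fin (n + 1) × Fin (n + 1) → Option W := fun p =>
    if hp : ∃ u, p ∈ F u then some hp.choose else none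
  have hf : ∀ p u, f p = some u ↔ p ∈ F u := by
    intro p u
    by_cases hp : ∃ u, p ∈ F u
    · have h1 : f p = some hp.choose := dif_pos hp
      rw [h1, Option.some_inj]
      constructor
      · rintro rfl
        exact hp.choose_spec
      · exact fun hu => hΛ _ _ p (hFΛ _ hp.choose_spec) (hFΛ _ hu)
    · have h1 : f p = none := dif_neg hp
      rw [h1]
      simp only [reduceCtorEq, false_iff]
      exact fun hu => hp ⟨u, hu⟩
  refine HasTwoBasis.of_minor (gridGraph n) P f ?_ ?_ (hasTwoBasis_gridGraph n)
  · intro w a b ha hb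
    simp only [hf] at ha hb ⊢
    exact hFconn w a b ha hb
  · intro u v huv
    simp only [hf]
    have he : s(u, v) ∈ P.edgeSet := huv
    rcases Sym2.mem_iff.1 (ht s(u, v)) with h1 | h1
    · obtain ⟨a, b, hab, ha, hb⟩ := hlink _ he v (by rw [h1])
      exact ⟨a, b, hab, h1 ▸ ha, hXF _ hb⟩
    · obtain ⟨a, b, hab, ha, hb⟩ := hlink _ he u (by rw [h1, Sym2.eq_swap])
      exact ⟨b, a, hab.symm, hXF _ hb, h1 ▸ ha⟩

end PlanarSets

namespace PlaneDrawing

variable {V : Type*} {G : SimpleGraph V} (D : PlaneDrawing G)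

open Classical in
/-- The arc of an edge, given as an unordered pair, in an arbitrary orientation. -/
noncomputable def curve (e : Sym2 V) : I → ℝ × ℝ :=
  if h : G.Adj e.out.1 e.out.2 then D.arc h else fun _ => D.pos e.out.1

lemma mk_out (e : Sym2 V) : s(e.out.1, e.out.2) = e := Quot.out_eq e

lemma mem_iff_out {e : Sym2 V} {v : V} : v ∈ e ↔ v = e.out.1 ∨ v = e.out.2 := by
  conv_lhs => rw [← mk_out e]
  exact Sym2.mem_iff

lemma adj_out {e : Sym2 V} (he : e ∈ G.edgeSet) : G.Adj e.out.1 e.out.2 := by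
  rw [← SimpleGraph.mem_edgeSet, mk_out]
  exact he

lemma arc_congr {u v x y : V} (h : G.Adj u v) (h' : G.Adj x y) (hu : u = x) (hv : v = y) (t : I) :
    D.arc h t = D.arc h' t := by
  subst hu hv
  rfl

lemma curve_eq {e : Sym2 V} (he : e ∈ G.edgeSet) : D.curve e = D.arc (adj_out he) := by
  simp [curve, adj_out he]

lemma continuous_curve (e : Sym2 V) : Continuous (D.curve e) := by
  unfold curve
  split_ifs with h
  · exact (D.arc h).continuous
  · exact continuous_const

lemma curve_injective {e : Sym2 V} (he : e ∈ G.edgeSet) : Function.Injective (D.curve e) := by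
  rw [D.curve_eq he]
  exact D.arc_inj _

lemma curve_zero {e : Sym2 V} (he : e ∈ G.edgeSet) : D.curve e 0 = D.pos e.out.1 := by
  rw [D.curve_eq he]
  exact (D.arc _).source

lemma curve_one {e : Sym2 V} (he : e ∈ G.edgeSet) : D.curve e 1 = D.pos e.out.2 := by
  rw [D.curve_eq he]
  exact (D.arc _).target

lemma eq_of_curve_eq_pos {e : Sym2 V} (he : e ∈ G.edgeSet) {t : I} {w : V}
    (h : D.curve e t = D.pos w) : t = 0 ∧ w = e.out.1 ∨ t = 1 ∧ w = e.out.2 := by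
  have h' := h
  rw [D.curve_eq he] at h'
  rcases D.no_vertex_mem _ w t h' with rfl | rfl
  · exact .inl ⟨D.curve_injective he (h.trans (D.curve_zero he).symm), rfl⟩
  · exact .inr ⟨D.curve_injective he (h.trans (D.curve_one he).symm), rfl⟩

/-- The interior points of the arc of an edge. -/
def inner (e : Sym2 V) : Set (ℝ × ℝ) := {p | ∃ t : I, t ≠ 0 ∧ t ≠ 1 ∧ D.curve e t = p}

lemma inner_eq {e : Sym2 V} (he : e ∈ G.edgeSet) :
    D.inner e = {p | D.IsInteriorPoint (adj_out he) p} := by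
  unfold inner IsInteriorPoint
  rw [D.curve_eq he]

lemma pos_notMem_inner {e : Sym2 V} (he : e ∈ G.edgeSet) (w : V) : D.pos w ∉ D.inner e := by
  rintro ⟨t, h0, h1, h⟩
  rcases D.eq_of_curve_eq_pos he h with h | h
  · exact h0 h.1
  · exact h1 h.1

lemma curve_cases {e : Sym2 V} (he : e ∈ G.edgeSet) (t : I) :
    (∃ w ∈ e, D.curve e t = D.pos w) ∨ D.curve e t ∈ D.inner e := by
  by_cases h0 : t = 0
  · exact .inl ⟨_, mem_iff_out.2 (.inl rfl), by rw [h0, D.curve_zero he]⟩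
  by_cases h1 : t = 1
  · exact .inl ⟨_, mem_iff_out.2 (.inr rfl), by rw [h1, D.curve_one he]⟩
  exact .inr ⟨t, h0, h1, rfl⟩

lemma finite_inner_inter {e f : Sym2 V} (he : e ∈ G.edgeSet) (hf : f ∈ G.edgeSet) (hne : e ≠ f) :
    (D.inner e ∩ D.inner f).Finite := by
  refine (D.finite_inter (adj_out he) (adj_out hf) (by rwa [mk_out, mk_out])).subset ?_
  rw [inner_eq _ he, inner_eq _ hf]
  rintro p ⟨⟨t, -, -, rfl⟩, s, -, -, h⟩
  exact ⟨⟨t, rfl⟩, s, h⟩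

lemma inner_triple {e f g : Sym2 V} (he : e ∈ G.edgeSet) (hf : f ∈ G.edgeSet) (hg : g ∈ G.edgeSet)
    (hef : e ≠ f) (heg : e ≠ g) (hfg : f ≠ g) {p : ℝ × ℝ} (hpe : p ∈ D.inner e)
    (hpf : p ∈ D.inner f) (hpg : p ∈ D.inner g) : False := by
  rw [inner_eq _ he] at hpe
  rw [inner_eq _ hf] at hpf
  rw [inner_eq _ hg] at hpg
  obtain ⟨t₁, h₁, h₁', rfl⟩ := hpe
  obtain ⟨t₂, h₂, h₂', h2⟩ := hpf
  obtain ⟨t₃, h₃, h₃', h3⟩ := hpg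
  exact D.no_triple_point (adj_out he) (adj_out hf) (adj_out hg) (by rwa [mk_out, mk_out])
    (by rwa [mk_out, mk_out]) (by rwa [mk_out, mk_out]) t₁ t₂ t₃ h₁ h₁' h₂ h₂' h₃ h₃' h2.symm
    (h2.trans h3.symm)

/-- The number of crossings between two edges. -/
noncomputable def crossingWeight (e f : Sym2 V) : ℕ := (D.inner e ∩ D.inner f).ncard

lemma crossingWeight_comm (e f : Sym2 V) : D.crossingWeight e f = D.crossingWeight f e := by
  rw [crossingWeight, crossingWeight, Set.inter_comm]

lemma crossingWeight_ne_zero {e f : Sym2 V} (he : e ∈ G.edgeSet) (hf : f ∈ G.edgeSet)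
    (hne : e ≠ f) : D.crossingWeight e f ≠ 0 ↔ (D.inner e ∩ D.inner f).Nonempty := by
  rw [crossingWeight, Ne, Set.ncard_eq_zero (D.finite_inner_inter he hf hne),
    Set.nonempty_iff_ne_empty]

lemma sum_crossingWeight_le [Finite V] {k : ℕ} (hD : D.IsKPlane k) {e : Sym2 V}
    (he : e ∈ G.edgeSet) (F : Finset (Sym2 V)) (hF : ∀ f ∈ F, f ∈ G.edgeSet ∧ f ≠ e) :
    ∑ f ∈ F, D.crossingWeight e f ≤ k := by
  classical
  refine le_trans ?_ (hD (adj_out he))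
  have hfin : (D.edgeCrossings (adj_out he)).Finite := by
    refine Set.Finite.subset (s := ⋃ f ∈ {f : Sym2 V | f ∈ G.edgeSet ∧ f ≠ e},
      D.inner e ∩ D.inner f) ?_ ?_
    · exact Set.Finite.biUnion (Set.toFinite _)
        fun f hf => D.finite_inner_inter he hf.1 hf.2.symm
    · rintro p ⟨hp, x, y, h, hne, hp'⟩
      have hf : s(x, y) ∈ G.edgeSet := h
      rw [mk_out] at hne
      simp only [Set.mem_iUnion]
      refine ⟨s(x, y), ⟨hf, hne.symm⟩, ?_, ?_⟩
      · rw [inner_eq _ he]; exact hp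
      · rw [inner_eq _ hf]
        obtain ⟨t, h0, h1, rfl⟩ := hp'
        have hxy := mk_out s(x, y)
        rcases Sym2.eq_iff.1 hxy with ⟨h2, h3⟩ | ⟨h2, h3⟩
        · refine ⟨t, h0, h1, ?_⟩
          exact D.arc_congr _ _ h2 h3 t
        · refine ⟨σ t, by simpa using h1, by simpa using h0, ?_⟩
          have := D.arc_symm h
          have h4 : D.arc h t = D.arc h.symm (σ t) := by rw [this]; simp
          rw [h4]
          exact D.arc_congr _ _ h2 h3 _
  have hU : (⋃ f ∈ (F : Set (Sym2 V)), D.inner e ∩ D.inner f) ⊆ D.edgeCrossings (adj_out he) := by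
    simp only [Set.iUnion_subset_iff]
    rintro f hf p ⟨hp, hp'⟩
    rw [inner_eq _ he] at hp
    rw [inner_eq _ (hF f hf).1] at hp'
    refine ⟨hp, _, _, adj_out (hF f hf).1, ?_, hp'⟩
    rw [mk_out, mk_out]
    exact (hF f hf).2.symm
  refine le_trans (le_of_eq ?_) (Set.ncard_le_ncard hU hfin)
  have hF' : ∀ f ∈ F, (D.inner e ∩ D.inner f).Finite := fun f hf =>
    D.finite_inner_inter he (hF f hf).1 (hF f hf).2.symm
  clear hU hfin
  induction F using Finset.induction_on with
  | empty => simp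
  | insert f F hf ih =>
    rw [Finset.sum_insert hf, ih (fun g hg => hF g (Finset.mem_insert_of_mem hg))
      (fun g hg => hF' g (Finset.mem_insert_of_mem hg)), Finset.coe_insert, Set.biUnion_insert,
      Set.ncard_union_eq _ (hF' f (Finset.mem_insert_self _ _)) (Set.Finite.biUnion
        (Set.toFinite _) fun g hg => hF' g (Finset.mem_insert_of_mem hg)), crossingWeight]
    · rw [Set.disjoint_left]
      rintro p hp hp'
      simp only [Set.mem_iUnion] at hp'
      obtain ⟨g, hg, hp''⟩ := hp'
      have hf' := hF f (Finset.mem_insert_self _ _)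
      have hg' := hF g (Finset.mem_insert_of_mem hg)
      exact D.inner_triple he hf'.1 hg'.1 hf'.2.symm hg'.2.symm
        (fun h => hf (h ▸ hg)) hp.1 hp.2 hp''.2

end PlaneDrawing

section Planarization

variable {V : Type}

/-- The graph obtained from the edges `𝒜` by placing a new vertex (a hub) on each set of edges in
`J` and replacing every edge in such a set by the two edges from the hub to its ends. -/
def planarization (𝒜 : Finset (Sym2 V)) (J : Finset (Finset (Sym2 V))) :
    SimpleGraph (V ⊕ Finset (Sym2 V)) where
  Adj
    | .inl u, .inl v => u ≠ v ∧ s(u, v) ∈ 𝒜 ∧ ∀ j ∈ J, s(u, v) ∉ j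
    | .inl v, .inr j => j ∈ J ∧ ∃ e ∈ j, v ∈ e
    | .inr j, .inl v => j ∈ J ∧ ∃ e ∈ j, v ∈ e
    | .inr _, .inr _ => False
  symm := ⟨by
    rintro (u | i) (v | j) h
    · exact ⟨h.1.symm, by rw [Sym2.eq_swap]; exact h.2.1,
        fun j hj => by rw [Sym2.eq_swap]; exact h.2.2 j hj⟩
    · exact h
    · exact h
    · exact h⟩
  loopless := ⟨by
    rintro (u | i) h
    · exact h.1 rfl
    · exact h⟩

variable {𝒜 : Finset (Sym2 V)} {J : Finset (Finset (Sym2 V))}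

lemma planarization_adj_inl_inl {u v : V} : (planarization 𝒜 J).Adj (.inl u) (.inl v) ↔
    u ≠ v ∧ s(u, v) ∈ 𝒜 ∧ ∀ j ∈ J, s(u, v) ∉ j := Iff.rfl

lemma planarization_adj_inl_inr {v : V} {j : Finset (Sym2 V)} :
    (planarization 𝒜 J).Adj (.inl v) (.inr j) ↔ j ∈ J ∧ ∃ e ∈ j, v ∈ e := Iff.rfl

lemma inr_inr_notMem_edgeSet (i j : Finset (Sym2 V)) :
    s(.inr i, .inr j) ∉ (planarization 𝒜 J).edgeSet := id

lemma planarization_edge_cases {E : Sym2 (V ⊕ Finset (Sym2 V))}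
    (hE : E ∈ (planarization 𝒜 J).edgeSet) :
    (∃ u v, E = s(.inl u, .inl v) ∧ u ≠ v ∧ s(u, v) ∈ 𝒜 ∧ ∀ j ∈ J, s(u, v) ∉ j) ∨
      ∃ v j, E = s(.inl v, .inr j) ∧ j ∈ J ∧ ∃ e ∈ j, v ∈ e := by
  induction E with
  | h x y =>
    rw [SimpleGraph.mem_edgeSet] at hE
    match x, y, hE with
    | .inl u, .inl v, h => exact .inl ⟨u, v, rfl, h⟩
    | .inl v, .inr j, h => exact .inr ⟨v, j, rfl, h⟩
    | .inr j, .inl v, h => exact .inr ⟨v, j, Sym2.eq_swap, h⟩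

end Planarization

namespace PlaneDrawing

variable {V : Type} {G : SimpleGraph V} (D : PlaneDrawing G)

/-- The parameters at which the arc of `e` crosses another edge of `j` -/
def crossingParams (e : Sym2 V) (j : Finset (Sym2 V)) : Set I :=
  {t | t ≠ 0 ∧ t ≠ 1 ∧ ∃ f ∈ j, f ≠ e ∧ D.curve e t ∈ D.inner f}

lemma exists_crossingParams_bounds {e : Sym2 V} {j : Finset (Sym2 V)} (hj : ∀ f ∈ j, f ∈ G.edgeSet)
    (he : e ∈ j) (hx : ∃ f ∈ j, f ≠ e ∧ (D.inner e ∩ D.inner f).Nonempty) :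
    ∃ a ∈ D.crossingParams e j, ∃ b ∈ D.crossingParams e j,
      ∀ t ∈ D.crossingParams e j, a ≤ t ∧ t ≤ b := by
  have hfin : (D.crossingParams e j).Finite := by
    refine Set.Finite.of_finite_image (f := D.curve e) ?_ (D.curve_injective (hj e he)).injOn
    refine Set.Finite.subset (s := ⋃ f ∈ {f : Sym2 V | f ∈ j ∧ f ≠ e},
      D.inner e ∩ D.inner f) ?_ ?_
    · exact Set.Finite.biUnion (j.finite_toSet.subset fun f hf => hf.1)
        fun f hf => D.finite_inner_inter (hj e he) (hj f hf.1) hf.2.symm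
    · rintro _ ⟨t, ⟨h0, h1, f, hf, hne, h⟩, rfl⟩
      simp only [Set.mem_iUnion]
      exact ⟨f, ⟨hf, hne⟩, ⟨t, h0, h1, rfl⟩, h⟩
  have hne : (D.crossingParams e j).Nonempty := by
    obtain ⟨f, hf, hfe, p, ⟨t, h0, h1, rfl⟩, hp⟩ := hx
    exact ⟨t, h0, h1, f, hf, hfe, hp⟩
  obtain ⟨a, ha, ha'⟩ := hfin.exists_minimalFor id _ hne
  obtain ⟨b, hb, hb'⟩ := hfin.exists_maximalFor id _ hne
  refine ⟨a, ha, b, hb, fun t ht => ⟨?_, ?_⟩⟩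
  · rcases le_total a t with h | h
    · exact h
    · exact ha' ht h
  · rcases le_total t b with h | h
    · exact h
    · exact hb' ht h

theorem hasTwoBasis_planarization [Fintype V] (𝒜 : Finset (Sym2 V)) (J : Finset (Finset (Sym2 V)))
    (h𝒜 : ∀ e ∈ 𝒜, e ∈ G.edgeSet) (hJ𝒜 : ∀ j ∈ J, ∀ e ∈ j, e ∈ 𝒜)
    (hJ : ∀ i ∈ J, ∀ j ∈ J, ∀ e ∈ i, e ∈ j → i = j)
    (hJ2 : ∀ j ∈ J, ∀ e ∈ j, ∃ f ∈ j, f ≠ e)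
    (hJx : ∀ j ∈ J, ∀ e ∈ j, ∀ f ∈ j, f ≠ e → (D.inner e ∩ D.inner f).Nonempty)
    (hcross : ∀ e ∈ 𝒜, ∀ f ∈ 𝒜, e ≠ f → (D.inner e ∩ D.inner f).Nonempty →
      ∃ j ∈ J, e ∈ j ∧ f ∈ j) :
    HasTwoBasis (cycleSpace (planarization 𝒜 J)) := by
  classical
  have hbounds : ∀ j ∈ J, ∀ e ∈ j, ∃ a b, a ∈ D.crossingParams e j ∧ b ∈ D.crossingParams e j ∧
      ∀ t ∈ D.crossingParams e j, a ≤ t ∧ t ≤ b := by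
    intro j hj e he
    obtain ⟨a, ha, b, hb, h⟩ := D.exists_crossingParams_bounds
      (fun f hf => h𝒜 f (hJ𝒜 j hj f hf)) he
      (by obtain ⟨f, hf, hfe⟩ := hJ2 j hj e he; exact ⟨f, hf, hfe, hJx j hj e he f hf hfe⟩)
    exact ⟨a, b, ha, hb, h⟩
  choose! lo hi hlo hhi hlohi using hbounds
  have hub : ∀ j ∈ J, ∀ e ∈ j, ∀ f ∈ 𝒜, ∀ p, p ∈ D.inner e → p ∈ D.inner f → f ∈ j := by
    intro j hj e he f hf p hpe hpf
    by_cases hef : e = f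
    · exact hef ▸ he
    obtain ⟨i, hi, hei, hfi⟩ := hcross e (hJ𝒜 j hj e he) f hf hef ⟨p, hpe, hpf⟩
    rwa [hJ j hj i hi e he hei]
  let core (j : Finset (Sym2 V)) (e : Sym2 V) : Set (ℝ × ℝ) := D.curve e '' Set.Icc (lo j e) (hi j e)
  let tail (v : V) (j : Finset (Sym2 V)) (e : Sym2 V) : Set (ℝ × ℝ) :=
    if v = e.out.1 then D.curve e '' Set.Iic (lo j e) else D.curve e '' Set.Ici (hi j e)
  have core_inner : ∀ j ∈ J, ∀ e ∈ j, core j e ⊆ D.inner e := by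
    rintro j hj e he _ ⟨t, ⟨h1, h2⟩, rfl⟩
    refine ⟨t, ?_, ?_, rfl⟩
    · rintro rfl
      exact (hlo j hj e he).1 (le_antisymm h1 (lo j e).2.1)
    · rintro rfl
      exact (hhi j hj e he).2.1 (le_antisymm (hi j e).2.2 h2)
  have tail_curve : ∀ v j e, tail v j e ⊆ Set.range (D.curve e) := by
    intro v j e
    simp only [tail]
    split_ifs <;> exact Set.image_subset_range _ _
  have tail_pos : ∀ v, ∀ j ∈ J, ∀ e ∈ j, v ∈ e → D.pos v ∈ tail v j e := by
    intro v j hj e he hv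
    have hG := h𝒜 e (hJ𝒜 j hj e he)
    simp only [tail]
    split_ifs with h
    · exact ⟨0, (lo j e).2.1, by rw [D.curve_zero hG, h]⟩
    · refine ⟨1, (hi j e).2.2, ?_⟩
      rw [D.curve_one hG, (mem_iff_out.1 hv).resolve_left h]
  have tail_miss : ∀ v w, ∀ j ∈ J, ∀ e ∈ j, v ∈ e → D.pos w ∈ tail v j e → w = v := by
    intro v w j hj e he hv hw
    have hG := h𝒜 e (hJ𝒜 j hj e he)
    simp only [tail] at hw
    split_ifs at hw with h
    · obtain ⟨t, ht, hp⟩ := hw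
      rcases D.eq_of_curve_eq_pos hG hp with ⟨-, hw⟩ | ⟨rfl, -⟩
      · rw [hw, h]
      · exact ((hlo j hj e he).2.1 (le_antisymm (lo j e).2.2 ht)).elim
    · obtain ⟨t, ht, hp⟩ := hw
      rcases D.eq_of_curve_eq_pos hG hp with ⟨rfl, -⟩ | ⟨-, hw⟩
      · exact ((hhi j hj e he).1 (le_antisymm ht (hi j e).2.1)).elim
      · rw [hw, (mem_iff_out.1 hv).resolve_left h]
  have icc : ∀ j ∈ J, ∀ e ∈ j, ∀ f ∈ j, f ≠ e → ∀ p, p ∈ D.inner e → p ∈ D.inner f →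
      p ∈ core j e := by
    rintro j hj e he f hf hfe _ ⟨t, h0, h1, rfl⟩ hp
    exact ⟨t, hlohi j hj e he t ⟨h0, h1, f, hf, hfe, hp⟩, rfl⟩
  let B : V ⊕ Finset (Sym2 V) → Set (ℝ × ℝ)
    | .inl v => {D.pos v}
    | .inr j => {p | j ∈ J ∧ ∃ e ∈ j, p ∈ core j e}
  have hBr : ∀ j ∈ J, B (.inr j) = ⋃ e ∈ (j : Set (Sym2 V)), core j e := by
    intro j hj
    ext p
    simp [B, hj]
  have hBr' : ∀ j, j ∉ J → B (.inr j) = ∅ := by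
    intro j hj
    ext p
    simp [B, hj]
  let Γ (E : Sym2 (V ⊕ Finset (Sym2 V))) : Set (ℝ × ℝ) :=
    {p | (∃ e : Sym2 V, E = e.map .inl ∧ p ∈ Set.range (D.curve e)) ∨
      ∃ v j e, E = s(.inl v, .inr j) ∧ e ∈ j ∧ v ∈ e ∧ p ∈ tail v j e}
  have hΓ1 : ∀ u v, Γ s(.inl u, .inl v) = Set.range (D.curve s(u, v)) := by
    intro u v
    ext p
    constructor
    · rintro (⟨e, he, hp⟩ | ⟨w, j, e, he, -⟩)
      · have : s(u, v) = e := by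
          apply Sym2.map.injective (Sum.inl_injective (β := Finset (Sym2 V)))
          rw [← he]
          rfl
        rwa [this]
      · simp at he
    · intro hp
      exact .inl ⟨s(u, v), rfl, hp⟩
  have hΓ2 : ∀ v j, Γ s(.inl v, .inr j) = ⋃ e ∈ {e : Sym2 V | e ∈ j ∧ v ∈ e}, tail v j e := by
    intro v j
    ext p
    simp only [Set.mem_iUnion]
    constructor
    · rintro (⟨e, he, hp⟩ | ⟨w, i, e, he, h⟩)
      · have : Sum.inr j ∈ e.map (Sum.inl (β := Finset (Sym2 V))) := by
          rw [← he]
          exact Sym2.mem_mk_right _ _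
        simp [Sym2.mem_map] at this
      · simp at he
        obtain ⟨rfl, rfl⟩ := he
        exact ⟨e, ⟨h.1, h.2.1⟩, h.2.2⟩
    · rintro ⟨e, ⟨h1, h2⟩, h3⟩
      exact .inr ⟨v, j, e, rfl, h1, h2, h3⟩
  have common : ∀ e ∈ 𝒜, ∀ f ∈ 𝒜, ∀ p, p ∈ Set.range (D.curve e) → p ∈ Set.range (D.curve f) →
      (p ∈ ⋃ w, B w) ∨ p ∈ D.inner e ∧ p ∈ D.inner f := by
    rintro e he f hf _ ⟨t, rfl⟩ ⟨s, hs⟩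
    rcases D.curve_cases (h𝒜 e he) t with ⟨w, -, hw⟩ | h
    · exact .inl (Set.mem_iUnion.2 ⟨.inl w, hw⟩)
    rcases D.curve_cases (h𝒜 f hf) s with ⟨w, -, hw⟩ | h'
    · exact .inl (Set.mem_iUnion.2 ⟨.inl w, hs.symm.trans hw⟩)
    exact .inr ⟨h, hs ▸ h'⟩
  have inner_hub : ∀ e ∈ 𝒜, ∀ j p, p ∈ Set.range (D.curve e) → p ∈ B (.inr j) → j ∈ J ∧ e ∈ j := by
    rintro e he j _ ⟨t, rfl⟩ ⟨hj, f, hf, hp⟩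
    have hpf := core_inner j hj f hf hp
    refine ⟨hj, hub j hj f hf e he _ hpf ?_⟩
    rcases D.curve_cases (h𝒜 e he) t with ⟨w, -, hw⟩ | h
    · rw [hw] at hpf
      exact (D.pos_notMem_inner (h𝒜 f (hJ𝒜 j hj f hf)) w hpf).elim
    · exact h
  have inner_range : ∀ e, D.inner e ⊆ Set.range (D.curve e) := by
    rintro e _ ⟨t, -, -, rfl⟩
    exact ⟨t, rfl⟩
  apply hasTwoBasis_of_planar_sets (planarization 𝒜 J) B Γ
  · rintro (v | j)
    · exact isCompact_singleton
    · by_cases hj : j ∈ J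
      · rw [hBr j hj]
        exact j.finite_toSet.isCompact_biUnion fun e _ =>
          isCompact_Icc.image (D.continuous_curve e)
      · rw [hBr' j hj]
        exact isCompact_empty
  · rintro (v | j)
    · exact isPreconnected_singleton
    · by_cases hj : j ∈ J
      · rw [hBr j hj]
        refine IsPreconnected.biUnion_of_reflTransGen
          (fun e _ => isPreconnected_Icc.image _ (D.continuous_curve e).continuousOn) ?_
        intro e he f hf
        by_cases hef : e = f
        · rw [hef]
        · obtain ⟨p, hp, hp'⟩ := hJx j hj e he f hf (Ne.symm hef)
          exact .single ⟨⟨p, icc j hj e he f hf (Ne.symm hef) p hp hp',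
            icc j hj f hf e he hef p hp' hp⟩, he⟩
      · rw [hBr' j hj]
        exact isPreconnected_empty
  · have hlr : ∀ v j, Disjoint (B (.inl v)) (B (.inr j)) := by
      intro v j
      rw [Set.disjoint_left]
      rintro _ rfl ⟨hj, e, he, hp⟩
      exact D.pos_notMem_inner (h𝒜 e (hJ𝒜 j hj e he)) v (core_inner j hj e he hp)
    rintro (u | i) (v | j) hne
    · simp only [B, Set.disjoint_singleton]
      exact fun h => hne (congrArg _ (D.pos_inj h))
    · exact hlr u j
    · exact (hlr v i).symm
    · rw [Set.disjoint_left]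
      rintro p ⟨hi, e, he, hp⟩ ⟨hj, f, hf, hp'⟩
      refine hne (congrArg _ (hJ i hi j hj f ?_ hf))
      exact hub i hi e he f (hJ𝒜 j hj f hf) p (core_inner i hi e he hp) (core_inner j hj f hf hp')
  · intro E hE
    rcases planarization_edge_cases hE with ⟨u, v, rfl, -⟩ | ⟨v, j, rfl, hj, -⟩
    · rw [hΓ1]
      exact isCompact_range (D.continuous_curve _)
    · rw [hΓ2]
      refine (j.finite_toSet.subset fun e he => he.1).isCompact_biUnion fun e he => ?_
      simp only [tail]
      split_ifs
      · exact isClosed_Iic.isCompact.image (D.continuous_curve e)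
      · exact isClosed_Ici.isCompact.image (D.continuous_curve e)
  · intro E hE
    rcases planarization_edge_cases hE with ⟨u, v, rfl, -⟩ | ⟨v, j, rfl, hj, -⟩
    · rw [hΓ1]
      exact isPreconnected_range (D.continuous_curve _)
    · rw [hΓ2]
      refine IsPreconnected.biUnion_of_reflTransGen ?_ ?_
      · intro e he
        simp only [tail]
        split_ifs
        · exact isPreconnected_Iic.image _ (D.continuous_curve e).continuousOn
        · exact isPreconnected_Ici.image _ (D.continuous_curve e).continuousOn
      · intro e he f hf
        exact .single ⟨⟨D.pos v, tail_pos v j hj e he.1 he.2, tail_pos v j hj f hf.1 hf.2⟩, he⟩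
  · intro E hE
    rcases planarization_edge_cases hE with ⟨u, v, rfl, -, he, -⟩ | ⟨v, j, rfl, hj, e, he, hve⟩
    · have hG := h𝒜 _ he
      have h1 : ∀ w ∈ s(u, v), (Γ s(.inl u, .inl v) ∩ B (.inl w)).Nonempty := by
        intro w hw
        rw [hΓ1]
        rcases mem_iff_out.1 hw with h | h
        · exact ⟨_, ⟨0, D.curve_zero hG⟩, by rw [h]; rfl⟩
        · exact ⟨_, ⟨1, D.curve_one hG⟩, by rw [h]; rfl⟩
      intro w hw
      rcases Sym2.mem_iff.1 hw with rfl | rfl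
      · exact h1 u (Sym2.mem_mk_left _ _)
      · exact h1 v (Sym2.mem_mk_right _ _)
    · intro w hw
      rw [hΓ2]
      rcases Sym2.mem_iff.1 hw with rfl | rfl
      · exact ⟨D.pos v, Set.mem_biUnion (x := e) ⟨he, hve⟩ (tail_pos v j hj e he hve), rfl⟩
      · have hle : lo j e ≤ hi j e := (hlohi j hj e he _ (hlo j hj e he)).2
        by_cases h : v = e.out.1
        · refine ⟨D.curve e (lo j e), Set.mem_biUnion (x := e) ⟨he, hve⟩ ?_, hj, e, he,
            lo j e, ⟨le_rfl, hle⟩, rfl⟩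
          simp only [tail, if_pos h]
          exact ⟨_, Set.mem_Iic.2 le_rfl, rfl⟩
        · refine ⟨D.curve e (hi j e), Set.mem_biUnion (x := e) ⟨he, hve⟩ ?_, hj, e, he,
            hi j e, ⟨hle, le_rfl⟩, rfl⟩
          simp only [tail, if_neg h]
          exact ⟨_, Set.mem_Ici.2 le_rfl, rfl⟩
  · intro E hE
    rcases planarization_edge_cases hE with ⟨u, v, rfl, -, he, hejs⟩ | ⟨v, j, rfl, hj, -⟩
    · intro w hw
      rw [hΓ1, Set.disjoint_left]
      intro p hp hp'
      match w with
      | .inl w =>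
        obtain ⟨t, rfl⟩ := hp
        have hwe : w ∈ s(u, v) := by
          rcases D.eq_of_curve_eq_pos (h𝒜 _ he) hp' with h | h
          · exact mem_iff_out.2 (.inl h.2)
          · exact mem_iff_out.2 (.inr h.2)
        rcases Sym2.mem_iff.1 hwe with rfl | rfl
        · exact hw (Sym2.mem_mk_left _ _)
        · exact hw (Sym2.mem_mk_right _ _)
      | .inr j =>
        obtain ⟨hj, hej⟩ := inner_hub _ he j p hp hp'
        exact hejs j hj hej
    · intro w hw
      rw [hΓ2, Set.disjoint_left]
      intro p hp hp'
      simp only [Set.mem_iUnion] at hp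
      obtain ⟨e, ⟨hej, hve⟩, hp⟩ := hp
      match w with
      | .inl w =>
        obtain rfl : p = D.pos w := hp'
        exact hw (by rw [tail_miss v w j hj e hej hve hp]; exact Sym2.mem_mk_left _ _)
      | .inr i =>
        obtain ⟨hi', hei⟩ := inner_hub e (hJ𝒜 j hj e hej) i p (tail_curve _ _ _ hp) hp'
        exact hw (by rw [hJ i hi' j hj e hei hej]; exact Sym2.mem_mk_right _ _)
  · have mixed : ∀ u v w j, s(u, v) ∈ 𝒜 → (∀ j ∈ J, s(u, v) ∉ j) → j ∈ J →
        Γ s(.inl u, .inl v) ∩ Γ s(.inl w, .inr j) ⊆ ⋃ w, B w := by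
      rintro u v w j he hejs hj p ⟨hp, hp'⟩
      rw [hΓ1] at hp
      rw [hΓ2] at hp'
      simp only [Set.mem_iUnion] at hp'
      obtain ⟨f, ⟨hfj, hwf⟩, hp'⟩ := hp'
      rcases common _ he f (hJ𝒜 j hj f hfj) p hp (tail_curve _ _ _ hp') with h | ⟨h1, h2⟩
      · exact h
      · exact (hejs j hj (hub j hj f hfj _ he p h2 h1)).elim
    intro E hE E' hE' hne
    rcases planarization_edge_cases hE with ⟨u, v, rfl, -, he, hejs⟩ | ⟨v, j, rfl, hj, -⟩ <;>
    rcases planarization_edge_cases hE' with ⟨u', v', rfl, -, he', hejs'⟩ | ⟨v', j', rfl, hj', -⟩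
    · rintro p ⟨hp, hp'⟩
      rw [hΓ1] at hp hp'
      rcases common _ he _ he' p hp hp' with h | ⟨h1, h2⟩
      · exact h
      · have hne' : s(u, v) ≠ s(u', v') := by
          intro h
          apply hne
          exact congrArg (Sym2.map (Sum.inl (β := Finset (Sym2 V)))) h
        obtain ⟨j, hj, hej, -⟩ := hcross _ he _ he' hne' ⟨p, h1, h2⟩
        exact (hejs j hj hej).elim
    · exact mixed u v v' j' he hejs hj'
    · rw [Set.inter_comm]
      exact mixed u' v' v j he' hejs' hj
    · rintro p ⟨hp, hp'⟩
      rw [hΓ2] at hp hp'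
      simp only [Set.mem_iUnion] at hp hp'
      obtain ⟨e, ⟨hej, hve⟩, hp⟩ := hp
      obtain ⟨f, ⟨hfj, hvf⟩, hp'⟩ := hp'
      rcases common e (hJ𝒜 j hj e hej) f (hJ𝒜 j' hj' f hfj) p (tail_curve _ _ _ hp)
        (tail_curve _ _ _ hp') with h | ⟨h1, h2⟩
      · exact h
      have hjj := hJ j hj j' hj' f (hub j hj e hej f (hJ𝒜 j' hj' f hfj) p h1 h2) hfj
      subst hjj
      by_cases hef : e = f
      · subst hef
        have hG := h𝒜 e (hJ𝒜 j hj e hej)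
        have hvv : v ≠ v' := fun h => hne (by rw [h])
        have key : ∀ v v', v ∈ e → v' ∈ e → v ≠ v' → v = e.out.1 → p ∈ tail v j e → p ∈ tail v' j e →
            p ∈ core j e := by
          intro v v' _ _ hvv h hp hp'
          simp only [tail, if_pos h, if_neg (show ¬ v' = e.out.1 from fun h' => hvv (h.trans h'.symm))] at hp hp'
          obtain ⟨t, ht, rfl⟩ := hp
          obtain ⟨t', ht', hh⟩ := hp'
          rw [D.curve_injective hG hh] at ht'
          have hle : lo j e ≤ hi j e := (hlohi j hj e hej _ (hlo j hj e hej)).2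
          exact ⟨t, ⟨hle.trans ht', ht.trans hle⟩, rfl⟩
        refine Set.mem_iUnion.2 ⟨.inr j, hj, e, hej, ?_⟩
        rcases mem_iff_out.1 hve with h | h
        · exact key v v' hve hvf hvv h hp hp'
        · refine key v' v hvf hve hvv.symm ?_ hp' hp
          exact (mem_iff_out.1 hvf).resolve_right fun h' => hvv (h.trans h'.symm)
      · exact Set.mem_iUnion.2 ⟨.inr j, hj, e, hej, icc j hj e hej f hfj (Ne.symm hef) p h1 h2⟩

end PlaneDrawing

section HubReduction

open Finset

variable {V : Type}

lemma exists_pairBoundary_of_reflTransGen {W : Type*} [Fintype W] [DecidableEq W]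
    {r : W → W → Prop} (hr : ∀ x y, r x y → x ≠ y) {a b : W} (h : Relation.ReflTransGen r a b) :
    ∃ t : Sym2 W → ZMod 2, pairBoundary W t = Pi.single a 1 + Pi.single b 1 ∧
      ∀ e, t e ≠ 0 → ∃ u v, r u v ∧ e = s(u, v) := by
  induction h with
  | refl =>
    refine ⟨0, ?_, fun e he => (he rfl).elim⟩
    rw [map_zero]
    ext w
    exact (CharTwo.add_self_eq_zero _).symm
  | @tail b c _ hbc ih =>
    obtain ⟨t, ht, hte⟩ := ih
    refine ⟨t + Pi.single s(b, c) 1, ?_, ?_⟩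
    · rw [map_add, ht, pairBoundary_single (hr _ _ hbc)]
      ext w
      simp only [Pi.add_apply]
      have key : ∀ x y z : ZMod 2, x + y + (y + z) = x + z := by decide
      exact key _ _ _
    · intro e he
      by_cases hec : e = s(b, c)
      · exact ⟨b, c, hbc, hec⟩
      · exact hte e (by simpa [hec] using he)

section

variable [DecidableEq V]

/-- The indicator of the triangle formed by two vertices and a hub -/
def hubTriangle (x : Finset (Sym2 V)) (p q : V) : Sym2 (V ⊕ Finset (Sym2 V)) → ZMod 2 :=
  Pi.single s(.inl p, .inr x) 1 + Pi.single s(.inl q, .inr x) 1 + Pi.single s(.inl p, .inl q) 1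

lemma hubTriangle_inl_inl (x : Finset (Sym2 V)) (p q u v : V) :
    hubTriangle x p q s(.inl u, .inl v) = if s(u, v) = s(p, q) then 1 else 0 := by
  simp [hubTriangle, Pi.single_apply]

lemma hubTriangle_inl_inr (x j : Finset (Sym2 V)) (p q v : V) :
    hubTriangle x p q s(.inl v, .inr j) =
      (if v = p ∧ j = x then 1 else 0) + (if v = q ∧ j = x then 1 else 0) := by
  simp [hubTriangle, Pi.single_apply]

lemma hubTriangle_inr_inr (x i j : Finset (Sym2 V)) (p q : V) :
    hubTriangle x p q s(.inr i, .inr j) = 0 := by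
  simp [hubTriangle]

lemma pairBoundary_hubTriangle [Fintype V] (x : Finset (Sym2 V)) {p q : V} (hpq : p ≠ q) :
    pairBoundary _ (hubTriangle x p q) = 0 := by
  rw [hubTriangle, map_add, map_add, pairBoundary_single (by simp), pairBoundary_single (by simp),
    pairBoundary_single (by simpa using hpq)]
  ext w
  simp only [Pi.add_apply, Pi.zero_apply]
  have key : ∀ x y z : ZMod 2, x + z + (y + z) + (x + y) = 0 := by decide
  exact key _ _ _

end

variable {𝒜 : Finset (Sym2 V)} {J : Finset (Finset (Sym2 V))} {x : Finset (Sym2 V)} {a b c d : V}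

/-- `x` is a hub of `J` made of the two vertex-disjoint edges `ab` and `cd`. -/
structure IsDisjointHub (𝒜 : Finset (Sym2 V)) (J : Finset (Finset (Sym2 V)))
    (x : Finset (Sym2 V)) (a b c d : V) : Prop where
  mem : x ∈ J
  mem_iff : ∀ e, e ∈ x ↔ e = s(a, b) ∨ e = s(c, d)
  unique : ∀ j ∈ J, ∀ e ∈ x, e ∈ j → j = x
  left_mem : s(a, b) ∈ 𝒜
  right_mem : s(c, d) ∈ 𝒜
  hab : a ≠ b
  hac : a ≠ c
  had : a ≠ d
  hbc : b ≠ c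
  hbd : b ≠ d
  hcd : c ≠ d

lemma IsDisjointHub.swap (h : IsDisjointHub 𝒜 J x a b c d) : IsDisjointHub 𝒜 J x a b d c where
  mem := h.mem
  mem_iff e := by rw [h.mem_iff, Sym2.eq_swap (a := c)]
  unique := h.unique
  left_mem := h.left_mem
  right_mem := by rw [Sym2.eq_swap]; exact h.right_mem
  hab := h.hab
  hac := h.had
  had := h.hac
  hbc := h.hbd
  hbd := h.hbc
  hcd := h.hcd.symm

lemma IsDisjointHub.symm (h : IsDisjointHub 𝒜 J x a b c d) : IsDisjointHub 𝒜 J x c d a b where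
  mem := h.mem
  mem_iff e := by rw [h.mem_iff, or_comm]
  unique := h.unique
  left_mem := h.right_mem
  right_mem := h.left_mem
  hab := h.hcd
  hac := h.hac.symm
  had := h.hbc.symm
  hbc := h.had.symm
  hbd := h.hbd.symm
  hcd := h.hab

lemma IsDisjointHub.adj_iff (h : IsDisjointHub 𝒜 J x a b c d) (v : V) :
    (planarization 𝒜 J).Adj (.inl v) (.inr x) ↔ v = a ∨ v = b ∨ v = c ∨ v = d := by
  rw [planarization_adj_inl_inr]
  constructor
  · rintro ⟨-, e, he, hv⟩
    rcases (h.mem_iff e).1 he with rfl | rfl <;> rcases Sym2.mem_iff.1 hv with rfl | rfl <;> simp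
  · rintro (rfl | rfl | rfl | rfl)
    · exact ⟨h.mem, s(v, b), (h.mem_iff _).2 (.inl rfl), Sym2.mem_mk_left _ _⟩
    · exact ⟨h.mem, s(a, v), (h.mem_iff _).2 (.inl rfl), Sym2.mem_mk_right _ _⟩
    · exact ⟨h.mem, s(v, d), (h.mem_iff _).2 (.inr rfl), Sym2.mem_mk_left _ _⟩
    · exact ⟨h.mem, s(c, v), (h.mem_iff _).2 (.inr rfl), Sym2.mem_mk_right _ _⟩

lemma IsDisjointHub.erase_adj_inl_inl [DecidableEq V] (h : IsDisjointHub 𝒜 J x a b c d) (u v : V) :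
    (planarization 𝒜 (J.erase x)).Adj (.inl u) (.inl v) ↔
      (planarization 𝒜 J).Adj (.inl u) (.inl v) ∨ s(u, v) = s(a, b) ∨ s(u, v) = s(c, d) := by
  rw [planarization_adj_inl_inl, planarization_adj_inl_inl, ← h.mem_iff]
  constructor
  · rintro ⟨h1, h2, h3⟩
    by_cases hx : s(u, v) ∈ x
    · exact .inr hx
    · refine .inl ⟨h1, h2, fun j hj hej => ?_⟩
      by_cases hjx : j = x
      · exact hx (hjx ▸ hej)
      · exact h3 j (mem_erase.2 ⟨hjx, hj⟩) hej
  · rintro (⟨h1, h2, h3⟩ | hx)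
    · exact ⟨h1, h2, fun j hj => h3 j (mem_erase.1 hj).2⟩
    · refine ⟨?_, ?_, fun j hj hej => (mem_erase.1 hj).1 (h.unique j (mem_erase.1 hj).2 _ hx hej)⟩
      · rintro rfl
        rcases (h.mem_iff _).1 hx with h' | h' <;> rcases Sym2.eq_iff.1 h' with ⟨h1, h2⟩ | ⟨h1, h2⟩
        · exact h.hab (h1.symm.trans h2)
        · exact h.hab (h2.symm.trans h1)
        · exact h.hcd (h1.symm.trans h2)
        · exact h.hcd (h2.symm.trans h1)
      · rcases (h.mem_iff _).1 hx with h' | h' <;> rw [h']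
        · exact h.left_mem
        · exact h.right_mem

lemma erase_adj_inl_inr [DecidableEq V] (v : V) (j : Finset (Sym2 V)) :
    (planarization 𝒜 (J.erase x)).Adj (.inl v) (.inr j) ↔
      j ≠ x ∧ (planarization 𝒜 J).Adj (.inl v) (.inr j) := by
  rw [planarization_adj_inl_inr, planarization_adj_inl_inr, mem_erase, and_assoc]

lemma sym2_sum_cases {α β : Type*} {p : Sym2 (α ⊕ β) → Prop} (hll : ∀ u v, p s(.inl u, .inl v))
    (hlr : ∀ v j, p s(.inl v, .inr j)) (hrr : ∀ i j, p s(.inr i, .inr j)) (e : Sym2 (α ⊕ β)) :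
    p e := by
  induction e with
  | h x y =>
    match x, y with
    | .inl u, .inl v => exact hll u v
    | .inl v, .inr j => exact hlr v j
    | .inr j, .inl v => rw [Sym2.eq_swap]; exact hlr v j
    | .inr i, .inr j => exact hrr i j

variable [Fintype V]

lemma IsDisjointHub.sum_spokes (h : IsDisjointHub 𝒜 J x a b c d) (f : V → ZMod 2)
    (hf : ∀ v, f v ≠ 0 → v = a ∨ v = b ∨ v = c ∨ v = d) :
    ∑ v, f v = f a + f b + f c + f d := by
  classical
  rw [← Finset.sum_subset (Finset.subset_univ {a, b, c, d})]
  · rw [sum_insert (by simp [h.hab, h.hac, h.had]), sum_insert (by simp [h.hbc, h.hbd]),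
      sum_pair h.hcd]
    ring
  · intro v _ hv
    by_contra hcon
    exact hv (by simpa using hf v hcon)

lemma IsDisjointHub.spokes (h : IsDisjointHub 𝒜 J x a b c d)
    {z : Sym2 (V ⊕ Finset (Sym2 V)) → ZMod 2} (hz : z ∈ cycleSpace (planarization 𝒜 J)) :
    z s(.inl a, .inr x) + z s(.inl b, .inr x) + z s(.inl c, .inr x) + z s(.inl d, .inr x) = 0 := by
  rw [mem_cycleSpace] at hz
  have h1 := hz.2 (.inr x)
  rw [Fintype.sum_sum_type, sum_eq_zero (s := (univ : Finset (Finset (Sym2 V)))), add_zero] at h1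
  · rw [← h.sum_spokes fun v => z s(.inl v, .inr x)]
    · rw [← h1]
      exact sum_congr rfl fun v _ => by rw [Sym2.eq_swap]
    · intro v hv
      rw [← h.adj_iff]
      by_contra hcon
      exact hv (hz.1 _ hcon)
  · intro j _
    exact hz.1 _ (inr_inr_notMem_edgeSet x j)

lemma IsDisjointHub.hasTwoBasis_erase [DecidableEq V] (h : IsDisjointHub 𝒜 J x a b c d)
    (hZ : HasTwoBasis (cycleSpace (planarization 𝒜 J) ⊓ LinearMap.ker
      ((LinearMap.proj s(.inl a, .inr x) : (Sym2 (V ⊕ Finset (Sym2 V)) → ZMod 2) →ₗ[ZMod 2] ZMod 2)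
        + LinearMap.proj s(.inl b, .inr x)))) :
    HasTwoBasis (cycleSpace (planarization 𝒜 (J.erase x))) := by
  set A : Sym2 (V ⊕ Finset (Sym2 V)) := s(.inl a, .inr x) with hA
  set B : Sym2 (V ⊕ Finset (Sym2 V)) := s(.inl b, .inr x) with hB
  set C : Sym2 (V ⊕ Finset (Sym2 V)) := s(.inl c, .inr x) with hC
  set D : Sym2 (V ⊕ Finset (Sym2 V)) := s(.inl d, .inr x) with hD
  let L : (Sym2 (V ⊕ Finset (Sym2 V)) → ZMod 2) →ₗ[ZMod 2] (Sym2 (V ⊕ Finset (Sym2 V)) → ZMod 2) :=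
    LinearMap.id + (LinearMap.proj A).smulRight (hubTriangle x a b) +
      (LinearMap.proj C).smulRight (hubTriangle x c d)
  have hL : ∀ z e, L z e = z e + z A * hubTriangle x a b e + z C * hubTriangle x c d e :=
    fun z e => rfl
  have hne : s(a, b) ≠ s(c, d) := by
    simp [h.hac, h.had]
  have hLA : ∀ z, L z A = 0 := by
    intro z
    rw [hL, hA, hubTriangle_inl_inr, hubTriangle_inl_inr]
    simp [h.hab, h.hac, h.had, CharTwo.add_self_eq_zero]
  have hLB : ∀ z, L z B = z A + z B := by
    intro z
    rw [hL, hB, hubTriangle_inl_inr, hubTriangle_inl_inr]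
    simp [h.hab.symm, h.hbc, h.hbd, add_comm]
  have hLC : ∀ z, L z C = 0 := by
    intro z
    rw [hL, hC, hubTriangle_inl_inr, hubTriangle_inl_inr]
    simp [h.hac.symm, h.hbc.symm, h.hcd, CharTwo.add_self_eq_zero]
  have hLD : ∀ z, L z D = z C + z D := by
    intro z
    rw [hL, hD, hubTriangle_inl_inr, hubTriangle_inl_inr]
    simp [h.had.symm, h.hbd.symm, h.hcd.symm, add_comm]
  have hker : ∀ z, z ∈ cycleSpace (planarization 𝒜 J) ⊓ LinearMap.ker
      ((LinearMap.proj A : (Sym2 (V ⊕ Finset (Sym2 V)) → ZMod 2) →ₗ[ZMod 2] ZMod 2)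
        + LinearMap.proj B) ↔ z ∈ cycleSpace (planarization 𝒜 J) ∧ z A = z B ∧ z C = z D := by
    intro z
    have key : ∀ a b c d : ZMod 2, a + b + c + d = 0 → (a + b = 0 ↔ a = b ∧ c = d) := by decide
    rw [Submodule.mem_inf]
    refine and_congr_right fun hz => ?_
    exact key _ _ _ _ (h.spokes hz)
  have hmap : (cycleSpace (planarization 𝒜 J) ⊓ LinearMap.ker
      ((LinearMap.proj A : (Sym2 (V ⊕ Finset (Sym2 V)) → ZMod 2) →ₗ[ZMod 2] ZMod 2)
        + LinearMap.proj B)).map L = cycleSpace (planarization 𝒜 (J.erase x)) := by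
    ext y
    rw [Submodule.mem_map]
    constructor
    · rintro ⟨z, hz, rfl⟩
      obtain ⟨hz, hAB, hCD⟩ := (hker z).1 hz
      have hz1 := (mem_cycleSpace.1 hz).1
      refine ⟨?_, ?_⟩
      · refine sym2_sum_cases ?_ ?_ ?_
        · intro u v huv
          rw [SimpleGraph.mem_edgeSet, h.erase_adj_inl_inl] at huv
          push Not at huv
          rw [hL, hubTriangle_inl_inl, hubTriangle_inl_inl, if_neg huv.2.1, if_neg huv.2.2,
            hz1 _ huv.1]
          simp
        · intro v j hvj
          rw [SimpleGraph.mem_edgeSet, erase_adj_inl_inr] at hvj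
          by_cases hjx : j = x
          · subst hjx
            by_cases hv : v = a ∨ v = b ∨ v = c ∨ v = d
            · rcases hv with rfl | rfl | rfl | rfl
              · exact hLA z
              · rw [hLB, ← hAB]
                exact CharTwo.add_self_eq_zero _
              · exact hLC z
              · rw [hLD, ← hCD]
                exact CharTwo.add_self_eq_zero _
            · have := hz1 s(.inl v, .inr j) fun hadj => hv ((h.adj_iff v).1 hadj)
              push Not at hv
              rw [hL, hubTriangle_inl_inr, hubTriangle_inl_inr, this]
              simp [hv.1, hv.2.1, hv.2.2.1, hv.2.2.2]
          · rw [hL, hubTriangle_inl_inr, hubTriangle_inl_inr,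
              hz1 s(.inl v, .inr j) fun hadj => hvj ⟨hjx, hadj⟩]
            simp [hjx]
        · intro i j _
          rw [hL, hubTriangle_inr_inr, hubTriangle_inr_inr,
            hz1 _ (inr_inr_notMem_edgeSet i j)]
          simp
      · have : L z = z + z A • hubTriangle x a b + z C • hubTriangle x c d := rfl
        rw [this, map_add, map_add, map_smul, map_smul, pairBoundary_hubTriangle x h.hab,
          pairBoundary_hubTriangle x h.hcd, hz.2]
        simp
    · intro hy
      have hy1 := (mem_cycleSpace.1 hy).1
      have hyx : ∀ v, y s(.inl v, .inr x) = 0 := fun v => hy1 _ fun hadj =>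
        ((erase_adj_inl_inr (𝒜 := 𝒜) v x).1 hadj).1 rfl
      set z := y + y s(.inl a, .inl b) • hubTriangle x a b +
        y s(.inl c, .inl d) • hubTriangle x c d with hz
      have hze : ∀ e, z e = y e + y s(.inl a, .inl b) * hubTriangle x a b e +
        y s(.inl c, .inl d) * hubTriangle x c d e := fun e => rfl
      have hzA : z A = y s(.inl a, .inl b) := by
        rw [hze, hA, hubTriangle_inl_inr, hubTriangle_inl_inr, hyx]
        simp [h.hab, h.hac, h.had]
      have hzB : z B = y s(.inl a, .inl b) := by
        rw [hze, hB, hubTriangle_inl_inr, hubTriangle_inl_inr, hyx]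
        simp [h.hab.symm, h.hbc, h.hbd]
      have hzC : z C = y s(.inl c, .inl d) := by
        rw [hze, hC, hubTriangle_inl_inr, hubTriangle_inl_inr, hyx]
        simp [h.hac.symm, h.hbc.symm, h.hcd]
      have hzD : z D = y s(.inl c, .inl d) := by
        rw [hze, hD, hubTriangle_inl_inr, hubTriangle_inl_inr, hyx]
        simp [h.had.symm, h.hbd.symm, h.hcd.symm]
      refine ⟨z, (hker z).2 ⟨⟨?_, ?_⟩, by rw [hzA, hzB], by rw [hzC, hzD]⟩, ?_⟩
      · refine sym2_sum_cases ?_ ?_ ?_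
        · intro u v huv
          rw [SimpleGraph.mem_edgeSet] at huv
          have hmap : ∀ p q, s(u, v) = s(p, q) →
              s((.inl u : V ⊕ Finset (Sym2 V)), .inl v) = s(.inl p, .inl q) := fun p q hh =>
            congrArg (Sym2.map (Sum.inl (β := Finset (Sym2 V)))) hh
          rw [hze, hubTriangle_inl_inl, hubTriangle_inl_inl]
          by_cases h1 : s(u, v) = s(a, b)
          · rw [if_pos h1, if_neg (h1 ▸ hne), hmap _ _ h1, mul_one, mul_zero, add_zero]
            exact CharTwo.add_self_eq_zero _
          by_cases h2 : s(u, v) = s(c, d)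
          · rw [if_neg h1, if_pos h2, hmap _ _ h2, mul_one, mul_zero, add_zero]
            exact CharTwo.add_self_eq_zero _
          rw [if_neg h1, if_neg h2, hy1]
          · simp
          · rw [SimpleGraph.mem_edgeSet, h.erase_adj_inl_inl]
            tauto
        · intro v j hvj
          rw [SimpleGraph.mem_edgeSet] at hvj
          rw [hze, hubTriangle_inl_inr, hubTriangle_inl_inr, hy1]
          · by_cases hjx : j = x
            · subst hjx
              rw [h.adj_iff] at hvj
              push Not at hvj
              simp [hvj.1, hvj.2.1, hvj.2.2.1, hvj.2.2.2]
            · simp [hjx]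
          · rw [SimpleGraph.mem_edgeSet, erase_adj_inl_inr]
            exact fun hh => hvj hh.2
        · intro i j _
          rw [hze, hubTriangle_inr_inr, hubTriangle_inr_inr,
            hy1 _ (inr_inr_notMem_edgeSet i j)]
          simp
      · rw [hz, map_add, map_add, map_smul, map_smul, pairBoundary_hubTriangle x h.hab,
          pairBoundary_hubTriangle x h.hcd, hy.2]
        simp
      · ext e
        rw [hL, hzA, hzC, hze]
        have key : ∀ x y z : ZMod 2, x + y + z + y + z = x := by decide
        exact key _ _ _
  rw [← hmap]
  refine hZ.map L (sym2_sum_cases ?_ ?_ ?_)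
  · intro u v
    by_cases h1 : s(u, v) = s(a, b)
    · refine .inr ⟨A, fun z hz => ?_⟩
      have h0 : z s(.inl u, .inl v) = 0 := ((hker z).1 hz).1.1 _ fun hadj =>
        hadj.2.2 x h.mem ((h.mem_iff _).2 (.inl h1))
      rw [hL, hubTriangle_inl_inl, hubTriangle_inl_inl, if_pos h1, if_neg (h1 ▸ hne), h0]
      simp
    by_cases h2 : s(u, v) = s(c, d)
    · refine .inr ⟨C, fun z hz => ?_⟩
      have h0 : z s(.inl u, .inl v) = 0 := ((hker z).1 hz).1.1 _ fun hadj =>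
        hadj.2.2 x h.mem ((h.mem_iff _).2 (.inr h2))
      rw [hL, hubTriangle_inl_inl, hubTriangle_inl_inl, if_neg h1, if_pos h2, h0]
      simp
    exact .inr ⟨s(.inl u, .inl v), fun z _ => by
      rw [hL, hubTriangle_inl_inl, hubTriangle_inl_inl, if_neg h1, if_neg h2]; simp⟩
  · intro v j
    by_cases hv : j = x ∧ (v = a ∨ v = b ∨ v = c ∨ v = d)
    · obtain ⟨rfl, rfl | rfl | rfl | rfl⟩ := hv
      · exact .inl fun z _ => hLA z
      · refine .inl fun z hz => ?_
        rw [hLB, ← ((hker z).1 hz).2.1]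
        exact CharTwo.add_self_eq_zero _
      · exact .inl fun z _ => hLC z
      · refine .inl fun z hz => ?_
        rw [hLD, ← ((hker z).1 hz).2.2]
        exact CharTwo.add_self_eq_zero _
    · refine .inr ⟨s(.inl v, .inr j), fun z _ => ?_⟩
      rw [hL, hubTriangle_inl_inr, hubTriangle_inl_inr, if_neg, if_neg, if_neg, if_neg]
      · simp
      all_goals tauto
  · intro i j
    exact .inr ⟨s(.inr i, .inr j), fun z _ => by
      rw [hL, hubTriangle_inr_inr, hubTriangle_inr_inr]; simp⟩

lemma sum_pairBoundary_eq_zero {W : Type*} [Fintype W] (y : Sym2 W → ZMod 2)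
    (hy : ∀ w, y s(w, w) = 0) : ∑ w, pairBoundary W y w = 0 := by
  simp only [pairBoundary_apply]
  rw [← Fintype.sum_prod_type' fun w u => y s(w, u)]
  refine sum_involution (fun p _ => p.swap) ?_ ?_ ?_ ?_
  · intro p _
    rw [Prod.fst_swap, Prod.snd_swap, Sym2.eq_swap]
    exact CharTwo.add_self_eq_zero _
  · rintro ⟨u, v⟩ _ hne heq
    obtain rfl : v = u := congrArg Prod.fst heq
    exact hne (hy v)
  · simp
  · simp

/-- If two spokes on different edges of a hub lie in the same cycles, the hub can be removed. -/
lemma IsDisjointHub.hasTwoBasis_erase_of_eq [DecidableEq V] (h : IsDisjointHub 𝒜 J x a b c d)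
    (hZ : HasTwoBasis (cycleSpace (planarization 𝒜 J)))
    (heq : ∀ z ∈ cycleSpace (planarization 𝒜 J), z s(.inl a, .inr x) = z s(.inl c, .inr x)) :
    HasTwoBasis (cycleSpace (planarization 𝒜 (J.erase x))) := by
  classical
  set P := planarization 𝒜 J with hP
  let r : V ⊕ Finset (Sym2 V) → V ⊕ Finset (Sym2 V) → Prop :=
    fun u v => P.Adj u v ∧ u ≠ .inr x ∧ v ≠ .inr x
  let R : Set (V ⊕ Finset (Sym2 V)) := {w | Relation.ReflTransGen r (.inl a) w}
  have haR : .inl a ∈ R := Relation.ReflTransGen.refl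
  have hxR : .inr x ∉ R := by
    intro hx
    rcases Relation.ReflTransGen.cases_tail hx with heq | ⟨_, _, _, _, hne⟩
    · exact Sum.inr_ne_inl heq
    · exact hne rfl
  have hbR : .inl b ∉ R := by
    intro hb
    obtain ⟨t, ht, hte⟩ := exists_pairBoundary_of_reflTransGen (fun _ _ h => h.1.ne) hb
    have htx : ∀ v, t s(.inl v, .inr x) = 0 := by
      intro v
      by_contra hcon
      obtain ⟨u, w, hr, he⟩ := hte _ hcon
      rcases Sym2.eq_iff.1 he with ⟨-, h2⟩ | ⟨-, h2⟩
      · exact hr.2.2 h2.symm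
      · exact hr.2.1 h2.symm
    have hz : t + (Pi.single s(.inl a, .inr x) 1 + Pi.single s(.inl b, .inr x) 1) ∈
        cycleSpace P := by
      refine ⟨fun e he => ?_, ?_⟩
      · have h1 : t e = 0 := by
          by_contra hcon
          obtain ⟨u, w, hr, rfl⟩ := hte _ hcon
          exact he hr.1
        have h2 : e ≠ s(.inl a, .inr x) := fun hea => he (hea ▸ (h.adj_iff a).2 (.inl rfl))
        have h3 : e ≠ s(.inl b, .inr x) := fun hea =>
          he (hea ▸ (h.adj_iff b).2 (.inr (.inl rfl)))
        simp [h1, h2, h3]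
      · rw [map_add, map_add, ht, pairBoundary_single (by simp), pairBoundary_single (by simp)]
        ext w
        simp only [Pi.add_apply, Pi.zero_apply]
        have key : ∀ x y z : ZMod 2, x + y + (x + z + (y + z)) = 0 := by decide
        exact key _ _ _
    have := heq _ hz
    simp [htx, h.hab, h.hac.symm, h.hbc.symm] at this
  let S : Set (Sym2 (V ⊕ Finset (Sym2 V))) := {e | e ∈ P.edgeSet ∧ ∃ w ∈ e, w ∈ R}
  have hS : ∀ z ∈ cycleSpace P, S.indicator z ∈ cycleSpace P := by
    intro z hz
    have hoff : ∀ e ∉ P.edgeSet, S.indicator z e = 0 := fun e he =>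
      Set.indicator_of_notMem (fun hS => he hS.1) _
    have hne : ∀ w, w ≠ .inr x → pairBoundary _ (S.indicator z) w = 0 := by
      intro w hw
      rw [pairBoundary_apply]
      by_cases hwR : w ∈ R
      · rw [← (mem_cycleSpace.1 hz).2 w]
        refine sum_congr rfl fun u _ => ?_
        by_cases hwu : s(w, u) ∈ P.edgeSet
        · exact Set.indicator_of_mem (show _ ∈ S from ⟨hwu, w, by simp, hwR⟩) _
        · rw [hoff _ hwu, (mem_cycleSpace.1 hz).1 _ hwu]
      · refine sum_eq_zero fun u _ => Set.indicator_of_notMem ?_ _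
        rintro ⟨hwu, v, hv, hvR⟩
        rcases Sym2.mem_iff.1 hv with rfl | rfl
        · exact hwR hvR
        · exact hwR (Relation.ReflTransGen.tail hvR
            ⟨(P.mem_edgeSet.1 hwu).symm, fun hvx => hxR (hvx ▸ hvR), hw⟩)
    refine ⟨hoff, ?_⟩
    ext w
    by_cases hw : w = .inr x
    · subst hw
      have := sum_pairBoundary_eq_zero (S.indicator z) fun w => hoff _ (by simp)
      rwa [sum_eq_single (.inr x) (fun w _ hw => hne w hw) (by simp)] at this
    · exact hne w hw
  obtain ⟨ι, _, φ, hφ⟩ := hZ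
  refine h.hasTwoBasis_erase (hφ.inf_ker_of_split S hS
    ⟨(h.adj_iff a).2 (.inl rfl), _, Sym2.mem_mk_left _ _, haR⟩ ?_)
  rintro ⟨-, w, hw, hwR⟩
  rcases Sym2.mem_iff.1 hw with rfl | rfl
  · exact hbR hwR
  · exact hxR hwR

/-- A hub whose edges share a vertex can be contracted onto that vertex. -/
lemma hasTwoBasis_erase_of_common_vertex [DecidableEq V]
    (hZ : HasTwoBasis (cycleSpace (planarization 𝒜 J))) (hx : x ∈ J) (hne : x.Nonempty)
    (ha : ∀ e ∈ x, a ∈ e) : HasTwoBasis (cycleSpace (planarization 𝒜 (J.erase x))) := by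
  have hax : (planarization 𝒜 J).Adj (.inl a) (.inr x) := ⟨hx, hne.choose, hne.choose_spec,
    ha _ hne.choose_spec⟩
  refine HasTwoBasis.of_minor (planarization 𝒜 J) _
    (fun w => some (if w = .inr x then .inl a else w)) ?_ ?_ hZ
  · intro w p q hp hq
    have key : ∀ p, some (if p = .inr x then .inl a else p) = some w →
        p = w ∨ p = .inr x ∧ w = .inl a := by
      intro p hp
      split_ifs at hp with h
      · exact .inr ⟨h, (Option.some.inj hp).symm⟩
      · exact .inl (Option.some.inj hp)
    rcases key p hp with hp' | ⟨hp', hw⟩ <;> rcases key q hq with hq' | ⟨hq', hw'⟩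
    · rw [hp', hq']
    · exact .single ⟨by rw [hp', hq', hw']; exact hax, hp, hq⟩
    · exact .single ⟨by rw [hp', hq', hw]; exact hax.symm, hp, hq⟩
    · rw [hp', hq']
  · rintro (u | i) (v | j) huv
    · by_cases hx' : s(u, v) ∈ x
      · rcases Sym2.mem_iff.1 (ha _ hx') with rfl | rfl
        · exact ⟨.inr x, .inl v, ⟨hx, _, hx', by simp⟩, by simp, by simp⟩
        · exact ⟨.inl u, .inr x, ⟨hx, _, hx', by simp⟩, by simp, by simp⟩
      · refine ⟨.inl u, .inl v, ⟨huv.1, huv.2.1, fun j hj hej => ?_⟩, by simp, by simp⟩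
        by_cases hjx : j = x
        · exact hx' (hjx ▸ hej)
        · exact huv.2.2 j (mem_erase.2 ⟨hjx, hj⟩) hej
    · obtain ⟨hjx, hadj⟩ := (erase_adj_inl_inr u j).1 huv
      exact ⟨.inl u, .inr j, hadj, by simp, by simp [hjx]⟩
    · obtain ⟨hjx, hadj⟩ := (erase_adj_inl_inr v i).1 huv.symm
      exact ⟨.inr i, .inl v, hadj.symm, by simp [hjx], by simp⟩
    · exact huv.elim

variable {ι : Type} [Fintype ι] {φ : ι → Sym2 (V ⊕ Finset (Sym2 V)) → ZMod 2}

/-- No face of an irreducible hub goes straight along an edge through the hub. -/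
lemma IsDisjointHub.eq_zero_or_eq_zero [DecidableEq V] (h : IsDisjointHub 𝒜 J x a b c d)
    (hφ : IsTwoBasis φ (cycleSpace (planarization 𝒜 J)))
    (hirr : ¬ HasTwoBasis (cycleSpace (planarization 𝒜 (J.erase x)))) (i : ι) :
    φ i s(.inl a, .inr x) = 0 ∨ φ i s(.inl b, .inr x) = 0 := by
  classical
  by_contra! hcon
  refine hirr (h.hasTwoBasis_erase (hφ.inf_ker _ ?_))
  have hA := hφ.card_le s(.inl a, .inr x)
  have hB := hφ.card_le s(.inl b, .inr x)
  have hA' := card_erase_add_one (s := {k | φ k s(.inl a, .inr x) ≠ 0}) (a := i) (by simp [hcon.1])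
  have hB' := card_erase_add_one (s := {k | φ k s(.inl b, .inr x) ≠ 0}) (a := i) (by simp [hcon.2])
  refine (card_le_card (t := ({k | φ k s(.inl a, .inr x) ≠ 0} : Finset ι).erase i ∪
    ({k | φ k s(.inl b, .inr x) ≠ 0} : Finset ι).erase i) ?_).trans
    ((card_union_le _ _).trans (by omega))
  intro k hk
  have hk : φ k s(.inl a, .inr x) + φ k s(.inl b, .inr x) ≠ 0 := (mem_filter.1 hk).2
  have hki : k ≠ i := by
    rintro rfl
    rw [zmod_two_ne_zero.1 hcon.1, zmod_two_ne_zero.1 hcon.2] at hk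
    exact hk (by decide)
  simp only [mem_union, mem_erase, mem_filter, mem_univ, true_and, hki, ne_eq, not_false_eq_true]
  by_contra! h0
  exact hk (by rw [h0.1, h0.2, add_zero])

/-- A corner of an irreducible hub lies in at most one face. -/
lemma IsDisjointHub.corner_unique [DecidableEq V] (h : IsDisjointHub 𝒜 J x a b c d)
    (hφ : IsTwoBasis φ (cycleSpace (planarization 𝒜 J)))
    (hirr : ¬ HasTwoBasis (cycleSpace (planarization 𝒜 (J.erase x)))) {i i' : ι}
    (hia : φ i s(.inl a, .inr x) ≠ 0) (hic : φ i s(.inl c, .inr x) ≠ 0)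
    (hia' : φ i' s(.inl a, .inr x) ≠ 0) (hic' : φ i' s(.inl c, .inr x) ≠ 0) : i = i' := by
  classical
  by_contra hne
  have hsub : ∀ e, φ i e ≠ 0 → φ i' e ≠ 0 → ∀ k, φ k e ≠ 0 → k = i ∨ k = i' := by
    intro e h1 h2 k h3
    by_contra! hk
    have := (card_le_card (s := {i, i', k}) fun l hl => ?_).trans (hφ.card_le e)
    · rw [card_eq_three.2 ⟨i, i', k, hne, hk.1.symm, hk.2.symm, rfl⟩] at this
      omega
    · simp only [mem_insert, mem_singleton] at hl
      rcases hl with rfl | rfl | rfl <;> simpa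
  refine hirr (h.hasTwoBasis_erase_of_eq ⟨ι, inferInstance, φ, hφ⟩ fun z hz => ?_)
  obtain ⟨t, rfl⟩ := hφ.exists_coeff hz
  simp only [Finset.sum_apply, Pi.smul_apply]
  refine sum_congr rfl fun k _ => ?_
  congr 1
  have key : ∀ p q : ZMod 2, (p ≠ 0 → q ≠ 0) → (q ≠ 0 → p ≠ 0) → p = q := by decide
  refine key _ _ (fun hk => ?_) fun hk => ?_
  · rcases hsub _ hia hia' k hk with rfl | rfl <;> assumption
  · rcases hsub _ hic hic' k hk with rfl | rfl <;> assumption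

end HubReduction

section Faces

open Finset

variable {W : Type*}

/-- A nonempty set of edges without loops and without vertices of degree one. -/
structure IsLeafless (F : Finset (Sym2 W)) : Prop where
  nonempty : F.Nonempty
  ne : ∀ a b, s(a, b) ∈ F → a ≠ b
  exists_ne : ∀ a b, s(a, b) ∈ F → ∃ c, c ≠ a ∧ s(b, c) ∈ F

variable {F : Finset (Sym2 W)} {a b c : W}

lemma IsLeafless.three_le_card (hF : IsLeafless F) : 3 ≤ #F := by
  classical
  obtain ⟨e, he⟩ := hF.nonempty
  induction e with
  | h a b =>
    obtain ⟨c, hca, hbc⟩ := hF.exists_ne a b he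
    obtain ⟨d, hdb, hcd⟩ := hF.exists_ne b c hbc
    have hab := hF.ne _ _ he
    have hbc' := hF.ne _ _ hbc
    refine le_of_eq_of_le (card_eq_three.2 ⟨s(a, b), s(b, c), s(c, d), ?_, ?_, ?_, rfl⟩).symm
      (card_le_card (s := {s(a, b), s(b, c), s(c, d)}) ?_)
    · simp [hab, hca.symm]
    · simp [hca.symm, hbc']
    · simp [hbc', hdb.symm]
    · simp only [insert_subset_iff, singleton_subset_iff]
      exact ⟨he, hbc, hcd⟩

lemma eq_of_subset_triple {e₁ e₂ e₃ : Sym2 W} [DecidableEq W] (h : #F = 3) (h₁ : e₁ ∈ F)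
    (h₂ : e₂ ∈ F) (h₃ : e₃ ∈ F) (h₁₂ : e₁ ≠ e₂) (h₁₃ : e₁ ≠ e₃) (h₂₃ : e₂ ≠ e₃) :
    F = {e₁, e₂, e₃} := by
  refine (eq_of_subset_of_card_le ?_ ?_).symm
  · simp only [insert_subset_iff, singleton_subset_iff]
    exact ⟨h₁, h₂, h₃⟩
  · rw [h, card_eq_three.2 ⟨e₁, e₂, e₃, h₁₂, h₁₃, h₂₃, rfl⟩]

lemma IsLeafless.eq_triangle [DecidableEq W] (hF : IsLeafless F) (h3 : #F = 3)
    (hab : s(a, b) ∈ F) (hbc : s(b, c) ∈ F) (hac : a ≠ c) : F = {s(a, b), s(b, c), s(a, c)} := by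
  have h1 := hF.ne _ _ hab
  have h2 := hF.ne _ _ hbc
  obtain ⟨y, hyb, hay⟩ := hF.exists_ne b a (Sym2.eq_swap ▸ hab)
  obtain ⟨z, hzb, hcz⟩ := hF.exists_ne b c hbc
  have hFe := eq_of_subset_triple h3 hab hbc hay (by simp [h1, hac]) (by simp [hyb.symm, h1.symm])
    (by simp [h1.symm, hac.symm])
  have := hcz
  rw [hFe] at this
  simp only [mem_insert, mem_singleton, Sym2.eq_iff] at this
  have hyc : y = c := by
    rcases this with (⟨h, -⟩ | ⟨h, -⟩) | (⟨h, -⟩ | ⟨-, h⟩) | (⟨h, -⟩ | ⟨h, -⟩)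
    · exact (hac h.symm).elim
    · exact (h2 h.symm).elim
    · exact (h2 h.symm).elim
    · exact (hzb h).elim
    · exact (hac h.symm).elim
    · exact h.symm
  rw [hFe, hyc]

lemma IsLeafless.not_triangle (hF : IsLeafless F) (h4 : #F = 4)
    (hab : s(a, b) ∈ F) (hbc : s(b, c) ∈ F) (hac : s(a, c) ∈ F) : False := by
  classical
  have h1 := hF.ne _ _ hab
  have h2 := hF.ne _ _ hbc
  have h3 := hF.ne _ _ hac
  have hcard : #({s(a, b), s(b, c), s(a, c)} : Finset (Sym2 W)) = 3 :=
    card_eq_three.2 ⟨_, _, _, by simp [h1, h3], by simp [h2, h1.symm], by simp [h3.symm, h1.symm], rfl⟩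
  have hsub : ({s(a, b), s(b, c), s(a, c)} : Finset (Sym2 W)) ⊆ F := by
    simp only [insert_subset_iff, singleton_subset_iff]
    exact ⟨hab, hbc, hac⟩
  have hsd : #(F \ {s(a, b), s(b, c), s(a, c)}) = 1 := by
    rw [card_sdiff_of_subset hsub, h4, hcard]
  obtain ⟨e, he⟩ := card_eq_one.1 hsd
  have hmem : ∀ f, f ∈ F → f = e ∨ f = s(a, b) ∨ f = s(b, c) ∨ f = s(a, c) := by
    intro f hf
    by_cases hfe : f ∈ F \ {s(a, b), s(b, c), s(a, c)}
    · rw [he] at hfe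
      exact .inl (mem_singleton.1 hfe)
    · simp only [mem_sdiff, hf, true_and, not_not, mem_insert, mem_singleton] at hfe
      exact .inr hfe
  have heF : e ∈ F \ {s(a, b), s(b, c), s(a, c)} := he ▸ mem_singleton_self e
  rw [mem_sdiff] at heF
  induction e with
  | h u v =>
    have huv := hF.ne _ _ heF.1
    have key : ∀ u v, s(u, v) ∈ F → (∀ f, f ∈ F → f = s(u, v) ∨ f = s(a, b) ∨ f = s(b, c) ∨
        f = s(a, c)) → v = a ∨ v = b ∨ v = c := by
      intro u v huvF hmem
      obtain ⟨w, hwu, hvw⟩ := hF.exists_ne u v huvF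
      rcases hmem _ hvw with h | h | h | h <;> rcases Sym2.eq_iff.1 h with ⟨h, h'⟩ | ⟨h, h'⟩
      · exact ((hF.ne _ _ huvF) h.symm).elim
      · exact (hwu h').elim
      all_goals simp [h]
    have hv := key u v heF.1 hmem
    have hu := key v u (Sym2.eq_swap ▸ heF.1) fun f hf => by
      rw [Sym2.eq_swap (a := v)]; exact hmem f hf
    refine heF.2 ?_
    simp only [mem_insert, mem_singleton, Sym2.eq_iff]
    rcases hu with rfl | rfl | rfl <;> rcases hv with rfl | rfl | rfl <;> simp_all

lemma IsLeafless.exists_fourth (hF : IsLeafless F) (h4 : #F = 4)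
    (hab : s(a, b) ∈ F) (hbc : s(b, c) ∈ F) (hac : a ≠ c) :
    ∃ d, d ≠ b ∧ s(a, d) ∈ F ∧ s(c, d) ∈ F := by
  classical
  have h1 := hF.ne _ _ hab
  have h2 := hF.ne _ _ hbc
  obtain ⟨y, hyb, hay⟩ := hF.exists_ne b a (Sym2.eq_swap ▸ hab)
  obtain ⟨z, hzb, hcz⟩ := hF.exists_ne b c hbc
  have h3 := hF.ne _ _ hay
  by_cases hyc : y = c
  · exact (hF.not_triangle h4 hab hbc (hyc ▸ hay)).elim
  by_cases hza : z = a
  · exact (hF.not_triangle h4 hab hbc (Sym2.eq_swap ▸ hza ▸ hcz)).elim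
  obtain ⟨w, hwa, hyw⟩ := hF.exists_ne a y hay
  have hFe : F = {s(a, b), s(b, c), s(a, y), s(c, z)} := by
    refine (eq_of_subset_of_card_le ?_ ?_).symm
    · simp only [insert_subset_iff, singleton_subset_iff]
      exact ⟨hab, hbc, hay, hcz⟩
    · rw [h4, card_insert_of_notMem, card_eq_three.2 ⟨_, _, _, ?_, ?_, ?_, rfl⟩]
      · simp [h1.symm, hac.symm]
      · simp [hzb.symm, h2]
      · simp [hac, Ne.symm hza]
      · simp [h1, h1.symm, hac, hyb.symm, Ne.symm hza]
  have := hyw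
  rw [hFe] at this
  simp only [mem_insert, mem_singleton, Sym2.eq_iff] at this
  have hyz : y = z := by
    rcases this with (⟨h, -⟩ | ⟨h, -⟩) | (⟨h, -⟩ | ⟨h, -⟩) | (⟨h, -⟩ | ⟨-, h⟩) | (⟨h, -⟩ | ⟨h, -⟩)
    · exact (h3 h.symm).elim
    · exact (hyb h).elim
    · exact (hyb h).elim
    · exact (hyc h).elim
    · exact (h3 h.symm).elim
    · exact (hwa h).elim
    · exact (hyc h).elim
    · exact h
  exact ⟨y, hyb, hay, hyz ▸ hcz⟩

lemma exists_faces [Fintype W] {ι : Type} [Fintype ι] {P : SimpleGraph W}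
    {φ : ι → Sym2 W → ZMod 2} (hφ : IsTwoBasis φ (cycleSpace P)) :
    ∃ 𝓕 : Finset (Finset (Sym2 W)), (∀ F ∈ 𝓕, ∃ i, ∀ e, e ∈ F ↔ φ i e ≠ 0) ∧
      (∀ F ∈ 𝓕, IsLeafless F) ∧ (∀ S : Finset (Finset (Sym2 W)), ∀ e, S ⊆ 𝓕 → (∀ F ∈ S, e ∈ F) →
        #S ≤ 2) ∧ Module.finrank (ZMod 2) (cycleSpace P) ≤ #𝓕 := by
  classical
  set supp : ι → Finset (Sym2 W) := fun i => univ.filter fun e => φ i e ≠ 0 with hsupp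
  have hmem : ∀ i e, e ∈ supp i ↔ φ i e ≠ 0 := fun i e => by simp [hsupp]
  set 𝓕 := (univ.image supp).erase ∅ with h𝓕
  have hex : ∀ F ∈ 𝓕, ∃ i, ∀ e, e ∈ F ↔ φ i e ≠ 0 := by
    intro F hF
    obtain ⟨i, -, rfl⟩ := mem_image.1 (mem_erase.1 hF).2
    exact ⟨i, hmem i⟩
  refine ⟨𝓕, hex, ?_, ?_, ?_⟩
  · intro F hF
    obtain ⟨i, hi⟩ := hex F hF
    have hz := mem_cycleSpace.1 (hφ.mem i)
    have hadj : ∀ a b, s(a, b) ∈ F → P.Adj a b := by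
      intro a b hab
      by_contra hcon
      exact (hi _).1 hab (hz.1 _ hcon)
    refine ⟨nonempty_iff_ne_empty.2 (mem_erase.1 hF).1, fun a b hab => (hadj a b hab).ne,
      fun a b hab => ?_⟩
    by_contra! hcon
    have h1 := hz.2 b
    rw [sum_eq_single a] at h1
    · rw [Sym2.eq_swap] at h1
      exact (hi _).1 hab h1
    · intro c _ hca
      by_contra h
      exact hcon c hca ((hi _).2 h)
    · simp
  · intro S e hS heS
    refine le_trans ?_ (hφ.card_le e)
    refine (card_le_card (t := ({i | φ i e ≠ 0} : Finset ι).image supp) fun F hF => ?_).trans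
      card_image_le
    obtain ⟨i, -, rfl⟩ := mem_image.1 (mem_erase.1 (hS hF)).2
    exact mem_image_of_mem _ (by simpa [hmem] using heS _ hF)
  · let ψ : 𝓕 → Sym2 W → ZMod 2 := fun F e => if e ∈ F.1 then 1 else 0
    have hspan : cycleSpace P ≤ Submodule.span (ZMod 2) (Set.range ψ) := by
      rw [← hφ.span_eq, Submodule.span_le]
      rintro _ ⟨i, rfl⟩
      by_cases h0 : supp i = ∅
      · have : φ i = 0 := by
          ext e
          by_contra hcon
          exact notMem_empty e (h0 ▸ (hmem i e).2 hcon)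
        rw [this]
        exact Submodule.zero_mem _
      · refine Submodule.subset_span ⟨⟨supp i, mem_erase.2 ⟨h0, mem_image_of_mem _ (mem_univ _)⟩⟩, ?_⟩
        ext e
        change (if e ∈ supp i then (1 : ZMod 2) else 0) = φ i e
        split_ifs with h
        · exact (zmod_two_ne_zero.1 ((hmem i e).1 h)).symm
        · exact (not_not.1 fun h' => h ((hmem i e).2 h')).symm
    refine (Submodule.finrank_mono hspan).trans ?_
    have := finrank_range_le_card (R := ZMod 2) ψ
    simpa [Set.finrank] using this

end Faces

section HubBound

open Finset

variable {V : Type}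

open Classical in
/-- The edges that belong to no hub. -/
noncomputable def freeEdges (𝒜 : Finset (Sym2 V)) (J : Finset (Finset (Sym2 V))) :
    Finset (Sym2 V) :=
  𝒜.filter fun e => ∀ j ∈ J, e ∉ j

lemma mem_freeEdges {𝒜 : Finset (Sym2 V)} {J : Finset (Finset (Sym2 V))} {e : Sym2 V} :
    e ∈ freeEdges 𝒜 J ↔ e ∈ 𝒜 ∧ ∀ j ∈ J, e ∉ j := by
  classical
  rw [freeEdges, mem_filter]

/-- `p` and `q` have a common neighbour joined to one of them by a free edge and to the other by an
edge of the hub `x`. -/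
def IsLinked (𝒜 : Finset (Sym2 V)) (J : Finset (Finset (Sym2 V)))
    (x : Finset (Sym2 V)) (p q : V) : Prop :=
  ∃ z, (s(p, z) ∈ x ∧ s(z, q) ∈ freeEdges 𝒜 J) ∨ (s(p, z) ∈ freeEdges 𝒜 J ∧ s(z, q) ∈ x)

open Classical in
/-- The free edges forming a triangle with an edge of the hub `x` and another free edge. -/
noncomputable def triangleEdges (𝒜 : Finset (Sym2 V)) (J : Finset (Finset (Sym2 V)))
    (x : Finset (Sym2 V)) : Finset (Sym2 V) :=
  (freeEdges 𝒜 J).filter fun e => ∃ p q r, e = s(p, q) ∧ s(q, r) ∈ x ∧ s(p, r) ∈ freeEdges 𝒜 J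

lemma mem_triangleEdges {𝒜 : Finset (Sym2 V)} {J : Finset (Finset (Sym2 V))} {x : Finset (Sym2 V)}
    {e : Sym2 V} : e ∈ triangleEdges 𝒜 J x ↔ e ∈ freeEdges 𝒜 J ∧
      ∃ p q r, e = s(p, q) ∧ s(q, r) ∈ x ∧ s(p, r) ∈ freeEdges 𝒜 J := by
  classical
  rw [triangleEdges, mem_filter]

variable {G : SimpleGraph V} {𝒜 : Finset (Sym2 V)} {J : Finset (Finset (Sym2 V))}
  {𝓕 : Finset (Finset (Sym2 (V ⊕ Finset (Sym2 V))))} {x : Finset (Sym2 V)} {a b c d : V}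
  {F : Finset (Sym2 (V ⊕ Finset (Sym2 V)))}

lemma IsDisjointHub.isLinked_left (hx : IsDisjointHub 𝒜 J x a b c d)
    (hac : s(a, c) ∈ freeEdges 𝒜 J) : IsLinked 𝒜 J x b c :=
  ⟨a, .inl ⟨(hx.mem_iff _).2 (.inl Sym2.eq_swap), hac⟩⟩

lemma IsDisjointHub.isLinked_right (hx : IsDisjointHub 𝒜 J x a b c d)
    (hac : s(a, c) ∈ freeEdges 𝒜 J) : IsLinked 𝒜 J x a d :=
  ⟨c, .inr ⟨hac, (hx.mem_iff _).2 (.inr rfl)⟩⟩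

lemma IsLinked.symm {p q : V} (h : IsLinked 𝒜 J x p q) : IsLinked 𝒜 J x q p := by
  obtain ⟨z, ⟨h1, h2⟩ | ⟨h1, h2⟩⟩ := h
  · exact ⟨z, .inr ⟨Sym2.eq_swap ▸ h2, Sym2.eq_swap ▸ h1⟩⟩
  · exact ⟨z, .inl ⟨Sym2.eq_swap ▸ h2, Sym2.eq_swap ▸ h1⟩⟩

lemma IsDisjointHub.two_le_card_triangleEdges (hx : IsDisjointHub 𝒜 J x a b c d)
    (hac : s(a, c) ∈ freeEdges 𝒜 J) (had : s(a, d) ∈ freeEdges 𝒜 J) :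
    2 ≤ #(triangleEdges 𝒜 J x) := by
  classical
  have hne : s(a, c) ≠ s(a, d) := by simp [hx.hcd, hx.had]
  rw [← card_pair hne]
  refine card_le_card ?_
  simp only [insert_subset_iff, singleton_subset_iff]
  exact ⟨mem_triangleEdges.2 ⟨hac, a, c, d, rfl, (hx.mem_iff _).2 (.inr rfl), had⟩,
    mem_triangleEdges.2 ⟨had, a, d, c, rfl, (hx.mem_iff _).2 (.inr Sym2.eq_swap), hac⟩⟩

lemma IsDisjointHub.swapLeft (h : IsDisjointHub 𝒜 J x a b c d) : IsDisjointHub 𝒜 J x b a c d :=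
  h.symm.swap.symm

open Classical in
/-- The triangular faces at a corner of a hub. -/
noncomputable def triFaces (𝓕 : Finset (Finset (Sym2 (V ⊕ Finset (Sym2 V))))) (x : Finset (Sym2 V))
    (p q : V) : Finset (Finset (Sym2 (V ⊕ Finset (Sym2 V)))) :=
  {F ∈ 𝓕 | #F = 3 ∧ s(.inl p, .inr x) ∈ F ∧ s(.inl q, .inr x) ∈ F}

lemma mem_triFaces {p q : V} : F ∈ triFaces 𝓕 x p q ↔
    F ∈ 𝓕 ∧ #F = 3 ∧ s(.inl p, .inr x) ∈ F ∧ s(.inl q, .inr x) ∈ F := by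
  classical
  rw [triFaces, mem_filter]

open Classical in
/-- The quadrangular faces at an unlinked corner of a hub. -/
noncomputable def quadFaces (𝒜 : Finset (Sym2 V)) (J : Finset (Finset (Sym2 V)))
    (𝓕 : Finset (Finset (Sym2 (V ⊕ Finset (Sym2 V))))) (x : Finset (Sym2 V)) (p q : V) :
    Finset (Finset (Sym2 (V ⊕ Finset (Sym2 V)))) :=
  {F ∈ 𝓕 | #F = 4 ∧ s(.inl p, .inr x) ∈ F ∧ s(.inl q, .inr x) ∈ F ∧ ¬ IsLinked 𝒜 J x p q}

lemma mem_quadFaces {p q : V} : F ∈ quadFaces 𝒜 J 𝓕 x p q ↔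
    F ∈ 𝓕 ∧ #F = 4 ∧ s(.inl p, .inr x) ∈ F ∧ s(.inl q, .inr x) ∈ F ∧ ¬ IsLinked 𝒜 J x p q := by
  classical
  rw [quadFaces, mem_filter]

lemma quadFaces_eq_empty (hl : IsLinked 𝒜 J x a c) : #(quadFaces 𝒜 J 𝓕 x a c) = 0 :=
  card_eq_zero.2 (eq_empty_of_forall_notMem fun _ h => (mem_quadFaces.1 h).2.2.2.2 hl)

open Classical in
/-- The triangular faces through a hub. -/
noncomputable def hubTriangles (𝓕 : Finset (Finset (Sym2 (V ⊕ Finset (Sym2 V)))))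
    (x : Finset (Sym2 V)) : Finset (Finset (Sym2 (V ⊕ Finset (Sym2 V)))) :=
  {F ∈ 𝓕 | #F = 3 ∧ ∃ p, s(.inl p, .inr x) ∈ F}

lemma mem_hubTriangles : F ∈ hubTriangles 𝓕 x ↔ F ∈ 𝓕 ∧ #F = 3 ∧ ∃ p, s(.inl p, .inr x) ∈ F := by
  classical
  rw [hubTriangles, mem_filter]

open Classical in
/-- The quadrangular faces through a hub with an unlinked corner at this hub. -/
noncomputable def hubQuads (𝒜 : Finset (Sym2 V)) (J : Finset (Finset (Sym2 V)))
    (𝓕 : Finset (Finset (Sym2 (V ⊕ Finset (Sym2 V))))) (x : Finset (Sym2 V)) :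
    Finset (Finset (Sym2 (V ⊕ Finset (Sym2 V)))) :=
  {F ∈ 𝓕 | #F = 4 ∧ ∃ p q, p ≠ q ∧ s(.inl p, .inr x) ∈ F ∧ s(.inl q, .inr x) ∈ F ∧
    ¬ IsLinked 𝒜 J x p q}

lemma mem_hubQuads : F ∈ hubQuads 𝒜 J 𝓕 x ↔ F ∈ 𝓕 ∧ #F = 4 ∧ ∃ p q, p ≠ q ∧
    s(.inl p, .inr x) ∈ F ∧ s(.inl q, .inr x) ∈ F ∧ ¬ IsLinked 𝒜 J x p q := by
  classical
  rw [hubQuads, mem_filter]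

/-- Properties of the supports of a 2-basis of the cycle space of a planarization all of whose hubs
consisting of two edges are irreducible. -/
structure IsFaceSystem [Fintype V] (𝒜 : Finset (Sym2 V)) (J : Finset (Finset (Sym2 V)))
    (𝓕 : Finset (Finset (Sym2 (V ⊕ Finset (Sym2 V))))) : Prop where
  leafless : ∀ F ∈ 𝓕, IsLeafless F
  mem_edgeSet : ∀ F ∈ 𝓕, ∀ e ∈ F, e ∈ (planarization 𝒜 J).edgeSet
  card_le : ∀ S ⊆ 𝓕, ∀ e, (∀ F ∈ S, e ∈ F) → #S ≤ 2
  finrank_le : Module.finrank (ZMod 2) (cycleSpace (planarization 𝒜 J)) ≤ #𝓕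
  not_both : ∀ x a b c d, IsDisjointHub 𝒜 J x a b c d → ∀ F ∈ 𝓕, s(.inl a, .inr x) ∈ F →
    s(.inl b, .inr x) ∉ F
  corner : ∀ x a b c d, IsDisjointHub 𝒜 J x a b c d → ∀ F ∈ 𝓕, ∀ F' ∈ 𝓕,
    s(.inl a, .inr x) ∈ F → s(.inl c, .inr x) ∈ F → s(.inl a, .inr x) ∈ F' →
    s(.inl c, .inr x) ∈ F' → F = F'

lemma IsDisjointHub.card_eq {𝒜 : Finset (Sym2 V)} {J : Finset (Finset (Sym2 V))}
    {x : Finset (Sym2 V)} {a b c d : V} (h : IsDisjointHub 𝒜 J x a b c d) : #x = 2 := by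
  classical
  refine card_eq_two.2 ⟨s(a, b), s(c, d), by simp [h.hac, h.had], ?_⟩
  ext e
  simp [h.mem_iff]

lemma exists_isFaceSystem [Fintype V] [DecidableEq V] {𝒜 : Finset (Sym2 V)}
    {J : Finset (Finset (Sym2 V))} (hZ : HasTwoBasis (cycleSpace (planarization 𝒜 J)))
    (hirr : ∀ j ∈ J, #j = 2 → ¬ HasTwoBasis (cycleSpace (planarization 𝒜 (J.erase j)))) :
    ∃ 𝓕, IsFaceSystem 𝒜 J 𝓕 := by
  obtain ⟨ι, _, φ, hφ⟩ := hZ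
  obtain ⟨𝓕, h1, h2, h3, h4⟩ := exists_faces hφ
  refine ⟨𝓕, h2, ?_, fun S hS e he => h3 S e hS he, h4, ?_, ?_⟩
  · intro F hF e he
    obtain ⟨i, hi⟩ := h1 F hF
    by_contra hcon
    exact (hi e).1 he ((mem_cycleSpace.1 (hφ.mem i)).1 e hcon)
  · intro x a b c d h F hF ha hb
    obtain ⟨i, hi⟩ := h1 F hF
    rcases h.eq_zero_or_eq_zero hφ (hirr x h.mem h.card_eq) i with h0 | h0
    · exact (hi _).1 ha h0
    · exact (hi _).1 hb h0
  · intro x a b c d h F hF F' hF' ha hc ha' hc'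
    obtain ⟨i, hi⟩ := h1 F hF
    obtain ⟨i', hi'⟩ := h1 F' hF'
    have := h.corner_unique hφ (hirr x h.mem h.card_eq) ((hi _).1 ha) ((hi _).1 hc)
      ((hi' _).1 ha') ((hi' _).1 hc')
    ext e
    rw [hi, hi', this]

variable [Fintype V]

lemma IsFaceSystem.isFree (h : IsFaceSystem 𝒜 J 𝓕) (hF : F ∈ 𝓕) {p q : V}
    (hpq : s(.inl p, .inl q) ∈ F) : s(p, q) ∈ freeEdges 𝒜 J :=
  mem_freeEdges.2 (h.mem_edgeSet F hF _ hpq).2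

lemma IsFaceSystem.hub_mem (h : IsFaceSystem 𝒜 J 𝓕) (hF : F ∈ 𝓕) {p : V}
    (hp : s(.inl p, .inr x) ∈ F) : x ∈ J :=
  (h.mem_edgeSet F hF _ hp).1

lemma IsFaceSystem.end_mem (h : IsFaceSystem 𝒜 J 𝓕) (hF : F ∈ 𝓕) {p : V}
    (hp : s(.inl p, .inr x) ∈ F) : ∃ e ∈ x, p ∈ e :=
  (h.mem_edgeSet F hF _ hp).2

lemma IsFaceSystem.exists_spoke_ne (h : IsFaceSystem 𝒜 J 𝓕) (hF : F ∈ 𝓕) {p : V}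
    (hp : s(.inl p, .inr x) ∈ F) : ∃ q, q ≠ p ∧ s(.inl q, .inr x) ∈ F := by
  obtain ⟨w, hwp, hw⟩ := (h.leafless F hF).exists_ne _ _ hp
  match w, hwp, hw with
  | .inl q, hq, hw => exact ⟨q, fun hqp => hq (congrArg _ hqp), Sym2.eq_swap ▸ hw⟩
  | .inr j, _, hw => exact (h.mem_edgeSet F hF _ hw).elim

/-- A face through a hub uses a spoke on each of its two edges. -/
lemma IsFaceSystem.exists_corner (h : IsFaceSystem 𝒜 J 𝓕) (hx : IsDisjointHub 𝒜 J x a b c d)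
    (hF : F ∈ 𝓕) {p : V} (hp : s(.inl p, .inr x) ∈ F) :
    (s(.inl a, .inr x) ∈ F ∨ s(.inl b, .inr x) ∈ F) ∧
      (s(.inl c, .inr x) ∈ F ∨ s(.inl d, .inr x) ∈ F) := by
  obtain ⟨q, hqp, hq⟩ := h.exists_spoke_ne hF hp
  have h1 := h.not_both x a b c d hx F hF
  have h2 := h.not_both x c d a b hx.symm F hF
  have hp' := (hx.adj_iff p).1 (h.mem_edgeSet F hF _ hp)
  have hq' := (hx.adj_iff q).1 (h.mem_edgeSet F hF _ hq)
  rcases hp' with rfl | rfl | rfl | rfl <;> rcases hq' with rfl | rfl | rfl | rfl <;> tauto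

lemma IsFaceSystem.card_triFaces_add_le (h : IsFaceSystem 𝒜 J 𝓕)
    (hx : IsDisjointHub 𝒜 J x a b c d) :
    #(triFaces 𝓕 x a c) + #(quadFaces 𝒜 J 𝓕 x a c) ≤ 1 := by
  classical
  rw [← card_union_of_disjoint]
  · rw [card_le_one]
    have key : ∀ F, F ∈ triFaces 𝓕 x a c ∪ quadFaces 𝒜 J 𝓕 x a c →
        F ∈ 𝓕 ∧ s(.inl a, .inr x) ∈ F ∧ s(.inl c, .inr x) ∈ F := by
      intro F hF
      rw [mem_union, mem_triFaces, mem_quadFaces] at hF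
      tauto
    intro F hF F' hF'
    have h1 := key F hF
    have h2 := key F' hF'
    exact h.corner x a b c d hx F h1.1 F' h2.1 h1.2.1 h1.2.2 h2.2.1 h2.2.2
  · rw [disjoint_left]
    intro F h1 h2
    have h1 := (mem_triFaces.1 h1).2.1
    have h2 := (mem_quadFaces.1 h2).2.1
    omega

lemma IsFaceSystem.free_of_triFaces (h : IsFaceSystem 𝒜 J 𝓕) (hac : a ≠ c)
    (ht : #(triFaces 𝓕 x a c) ≠ 0) : s(a, c) ∈ freeEdges 𝒜 J := by
  classical
  obtain ⟨F, hF⟩ := card_ne_zero.1 ht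
  obtain ⟨hF, h3, ha, hc⟩ := mem_triFaces.1 hF
  refine h.isFree hF ?_
  have := (h.leafless F hF).eq_triangle h3 ha (Sym2.eq_swap ▸ hc) (by simpa using hac)
  rw [this]
  simp

lemma IsFaceSystem.card_hubTriangles_le (h : IsFaceSystem 𝒜 J 𝓕)
    (hx : IsDisjointHub 𝒜 J x a b c d) : #(hubTriangles 𝓕 x) ≤ #(triFaces 𝓕 x a c) +
      #(triFaces 𝓕 x a d) + #(triFaces 𝓕 x b c) + #(triFaces 𝓕 x b d) := by
  classical
  refine (card_le_card fun F hF => ?_).trans ((card_union_le _ _).trans (Nat.add_le_add_right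
    ((card_union_le _ _).trans (Nat.add_le_add_right (card_union_le _ _) _)) _))
  obtain ⟨hF, h3, p, hp⟩ := mem_hubTriangles.1 hF
  have := h.exists_corner hx hF hp
  simp only [mem_union, mem_triFaces]
  tauto

lemma IsFaceSystem.card_hubQuads_le (h : IsFaceSystem 𝒜 J 𝓕)
    (hx : IsDisjointHub 𝒜 J x a b c d) : #(hubQuads 𝒜 J 𝓕 x) ≤ #(quadFaces 𝒜 J 𝓕 x a c) +
      #(quadFaces 𝒜 J 𝓕 x a d) + #(quadFaces 𝒜 J 𝓕 x b c) + #(quadFaces 𝒜 J 𝓕 x b d) := by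
  classical
  refine (card_le_card fun F hF => ?_).trans ((card_union_le _ _).trans (Nat.add_le_add_right
    ((card_union_le _ _).trans (Nat.add_le_add_right (card_union_le _ _) _)) _))
  obtain ⟨hF, h4, p, q, hpq, hp, hq, hl⟩ := mem_hubQuads.1 hF
  have h1 := h.not_both x a b c d hx F hF
  have h2 := h.not_both x c d a b hx.symm F hF
  have hl' : ¬ IsLinked 𝒜 J x q p := fun h => hl h.symm
  simp only [mem_union, mem_quadFaces]
  rcases (hx.adj_iff p).1 (h.mem_edgeSet F hF _ hp) with rfl | rfl | rfl | rfl <;>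
    rcases (hx.adj_iff q).1 (h.mem_edgeSet F hF _ hq) with rfl | rfl | rfl | rfl <;>
    first
    | exact (hpq rfl).elim
    | exact (h1 hp hq).elim
    | exact (h1 hq hp).elim
    | exact (h2 hp hq).elim
    | exact (h2 hq hp).elim
    | exact .inl (.inl (.inl ⟨hF, h4, hp, hq, hl⟩))
    | exact .inl (.inl (.inr ⟨hF, h4, hp, hq, hl⟩))
    | exact .inl (.inr ⟨hF, h4, hp, hq, hl⟩)
    | exact .inr ⟨hF, h4, hp, hq, hl⟩
    | exact .inl (.inl (.inl ⟨hF, h4, hq, hp, hl'⟩))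
    | exact .inl (.inl (.inr ⟨hF, h4, hq, hp, hl'⟩))
    | exact .inl (.inr ⟨hF, h4, hq, hp, hl'⟩)
    | exact .inr ⟨hF, h4, hq, hp, hl'⟩

/-- The weighted number of small faces around a hub. -/
lemma IsFaceSystem.hub_bound (h : IsFaceSystem 𝒜 J 𝓕) (hx : IsDisjointHub 𝒜 J x a b c d)
    (h𝒜 : ∀ e ∈ 𝒜, e ∈ G.edgeSet)
    (hC : ∀ ⦃p q r r'⦄, p ≠ q → G.Adj p r → G.Adj q r → G.Adj p r' → G.Adj q r' → r = r') :
    3 * #(hubTriangles 𝓕 x) + #(hubQuads 𝒜 J 𝓕 x) ≤ 4 + #(triangleEdges 𝒜 J x) := by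
  have hadj : ∀ {p q}, s(p, q) ∈ freeEdges 𝒜 J → G.Adj p q := fun hpq =>
    h𝒜 _ (mem_freeEdges.1 hpq).1
  have hab : G.Adj a b := h𝒜 _ hx.left_mem
  have hcd : G.Adj c d := h𝒜 _ hx.right_mem
  have hopp : ∀ {a b c d}, IsDisjointHub 𝒜 J x a b c d → G.Adj a b → G.Adj c d →
      s(a, c) ∈ freeEdges 𝒜 J → s(b, d) ∉ freeEdges 𝒜 J := by
    intro a b c d hx hab hcd hac hbd
    exact hx.hbc (hC hx.had hab (hadj hbd).symm (hadj hac) hcd.symm)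
  have ht := h.card_hubTriangles_le hx
  have hq := h.card_hubQuads_le hx
  have hac := h.card_triFaces_add_le hx
  have had := h.card_triFaces_add_le hx.swap
  have hbc := h.card_triFaces_add_le hx.swapLeft
  have hbd := h.card_triFaces_add_le hx.swapLeft.swap
  by_cases tac : s(a, c) ∈ freeEdges 𝒜 J
  · have q1 := quadFaces_eq_empty (𝓕 := 𝓕) (hx.isLinked_left tac)
    have q2 := quadFaces_eq_empty (𝓕 := 𝓕) (hx.isLinked_right tac)
    have t1 : #(triFaces 𝓕 x b d) = 0 := by
      by_contra hcon
      exact hopp hx hab hcd tac (h.free_of_triFaces hx.hbd hcon)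
    by_cases tad : s(a, d) ∈ freeEdges 𝒜 J
    · have q3 := quadFaces_eq_empty (𝓕 := 𝓕) (hx.swap.isLinked_left tad)
      have t2 : #(triFaces 𝓕 x b c) = 0 := by
        by_contra hcon
        exact hopp hx.swap hab hcd.symm tad (h.free_of_triFaces hx.hbc hcon)
      have := hx.two_le_card_triangleEdges tac tad
      omega
    have t2 : #(triFaces 𝓕 x a d) = 0 := by
      by_contra hcon
      exact tad (h.free_of_triFaces hx.had hcon)
    by_cases tbc : s(b, c) ∈ freeEdges 𝒜 J
    · have q3 := quadFaces_eq_empty (𝓕 := 𝓕) (hx.swapLeft.isLinked_right tbc)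
      have := hx.symm.two_le_card_triangleEdges (Sym2.eq_swap ▸ tac) (Sym2.eq_swap ▸ tbc)
      omega
    have t3 : #(triFaces 𝓕 x b c) = 0 := by
      by_contra hcon
      exact tbc (h.free_of_triFaces hx.hbc hcon)
    omega
  have t1 : #(triFaces 𝓕 x a c) = 0 := by
    by_contra hcon
    exact tac (h.free_of_triFaces hx.hac hcon)
  by_cases tbd : s(b, d) ∈ freeEdges 𝒜 J
  · have q1 := quadFaces_eq_empty (𝓕 := 𝓕) (hx.swapLeft.swap.isLinked_left tbd)
    have q2 := quadFaces_eq_empty (𝓕 := 𝓕) (hx.swapLeft.swap.isLinked_right tbd)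
    by_cases tad : s(a, d) ∈ freeEdges 𝒜 J
    · have q3 := quadFaces_eq_empty (𝓕 := 𝓕) (hx.swap.isLinked_right tad)
      have t2 : #(triFaces 𝓕 x b c) = 0 := by
        by_contra hcon
        exact hopp hx.swap hab hcd.symm tad (h.free_of_triFaces hx.hbc hcon)
      have := hx.swap.symm.two_le_card_triangleEdges (Sym2.eq_swap ▸ tad) (Sym2.eq_swap ▸ tbd)
      omega
    have t2 : #(triFaces 𝓕 x a d) = 0 := by
      by_contra hcon
      exact tad (h.free_of_triFaces hx.had hcon)
    by_cases tbc : s(b, c) ∈ freeEdges 𝒜 J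
    · have q3 := quadFaces_eq_empty (𝓕 := 𝓕) (hx.swapLeft.isLinked_left tbc)
      have := hx.swapLeft.two_le_card_triangleEdges tbc tbd
      omega
    have t3 : #(triFaces 𝓕 x b c) = 0 := by
      by_contra hcon
      exact tbc (h.free_of_triFaces hx.hbc hcon)
    omega
  have t2 : #(triFaces 𝓕 x b d) = 0 := by
    by_contra hcon
    exact tbd (h.free_of_triFaces hx.hbd hcon)
  by_cases tad : s(a, d) ∈ freeEdges 𝒜 J
  · have q1 := quadFaces_eq_empty (𝓕 := 𝓕) (hx.swap.isLinked_left tad)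
    have q2 := quadFaces_eq_empty (𝓕 := 𝓕) (hx.swap.isLinked_right tad)
    have t3 : #(triFaces 𝓕 x b c) = 0 := by
      by_contra hcon
      exact hopp hx.swap hab hcd.symm tad (h.free_of_triFaces hx.hbc hcon)
    omega
  have t3 : #(triFaces 𝓕 x a d) = 0 := by
    by_contra hcon
    exact tad (h.free_of_triFaces hx.had hcon)
  by_cases tbc : s(b, c) ∈ freeEdges 𝒜 J
  · have q1 := quadFaces_eq_empty (𝓕 := 𝓕) (hx.swapLeft.isLinked_left tbc)
    have q2 := quadFaces_eq_empty (𝓕 := 𝓕) (hx.swapLeft.isLinked_right tbc)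
    omega
  have t4 : #(triFaces 𝓕 x b c) = 0 := by
    by_contra hcon
    exact tbc (h.free_of_triFaces hx.hbc hcon)
  omega

end HubBound

section HubSystem

open Finset

variable {V : Type}

/-- Distinct edges of `j` share no vertex. -/
def IsVertexDisjoint (j : Finset (Sym2 V)) : Prop :=
  ∀ e ∈ j, ∀ f ∈ j, ∀ v ∈ e, v ∈ f → e = f

open Classical in
/-- The ends of the edges of a hub. -/
noncomputable def hubEnds (j : Finset (Sym2 V)) : Finset V := j.biUnion Sym2.toFinset

lemma mem_hubEnds {j : Finset (Sym2 V)} {v : V} : v ∈ hubEnds j ↔ ∃ e ∈ j, v ∈ e := by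
  classical
  simp [hubEnds]

lemma card_hubEnds_le (j : Finset (Sym2 V)) : #(hubEnds j) ≤ #j * 2 := by
  classical
  refine card_biUnion_le_card_mul _ _ _ fun e _ => ?_
  induction e with
  | h a b =>
    rw [Sym2.toFinset_mk_eq]
    exact card_le_two

lemma card_hubEnds {j : Finset (Sym2 V)} (hj : IsVertexDisjoint j) (hd : ∀ e ∈ j, ¬ e.IsDiag) :
    #(hubEnds j) = #j * 2 := by
  classical
  rw [hubEnds, card_biUnion]
  · exact sum_const_nat fun e he => Sym2.card_toFinset_of_not_isDiag e (hd e he)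
  · intro e he f hf hne
    rw [Function.onFun, disjoint_left]
    intro v hv hv'
    exact hne (hj e he f hf v (Sym2.mem_toFinset.1 hv) (Sym2.mem_toFinset.1 hv'))

/-- A set of edges of `G` together with disjoint hubs consisting of two edges or of four
vertex-disjoint edges. -/
structure IsHubSystem (G : SimpleGraph V) (𝒜 : Finset (Sym2 V)) (J : Finset (Finset (Sym2 V))) :
    Prop where
  mem_edgeSet : ∀ e ∈ 𝒜, e ∈ G.edgeSet
  subset : ∀ j ∈ J, j ⊆ 𝒜
  unique : ∀ i ∈ J, ∀ j ∈ J, ∀ e ∈ i, e ∈ j → i = j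
  card_eq : ∀ j ∈ J, #j = 2 ∨ #j = 4
  disjoint : ∀ j ∈ J, #j = 4 → IsVertexDisjoint j

open Classical in
/-- The edges outside the four-edge hubs that join two ends of the hub `k`. -/
noncomputable def capturedEdges (𝒜 : Finset (Sym2 V)) (J : Finset (Finset (Sym2 V)))
    (k : Finset (Sym2 V)) : Finset (Sym2 V) :=
  {e ∈ 𝒜 | (∀ j ∈ J, #j = 4 → e ∉ j) ∧ ∀ v ∈ e, v ∈ hubEnds k}

lemma mem_capturedEdges {𝒜 : Finset (Sym2 V)} {J : Finset (Finset (Sym2 V))} {k : Finset (Sym2 V)}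
    {e : Sym2 V} : e ∈ capturedEdges 𝒜 J k ↔
      e ∈ 𝒜 ∧ (∀ j ∈ J, #j = 4 → e ∉ j) ∧ ∀ v ∈ e, v ∈ hubEnds k := by
  classical
  rw [capturedEdges, mem_filter]

variable {G : SimpleGraph V} {𝒜 : Finset (Sym2 V)} {J : Finset (Finset (Sym2 V))}
  {𝓕 : Finset (Finset (Sym2 (V ⊕ Finset (Sym2 V))))} {x : Finset (Sym2 V)}
  {F : Finset (Sym2 (V ⊕ Finset (Sym2 V)))}

lemma IsHubSystem.isDisjointHub (h : IsHubSystem G 𝒜 J) (hx : x ∈ J) (h2 : #x = 2)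
    (hd : IsVertexDisjoint x) : ∃ a b c d, IsDisjointHub 𝒜 J x a b c d := by
  classical
  obtain ⟨e, f, hef, rfl⟩ := card_eq_two.1 h2
  have he : e ∈ ({e, f} : Finset (Sym2 V)) := by simp
  have hf : f ∈ ({e, f} : Finset (Sym2 V)) := by simp
  have he𝒜 := h.subset _ hx he
  have hf𝒜 := h.subset _ hx hf
  have hne : ∀ v ∈ e, v ∉ f := fun v hv hv' => hef (hd e he f hf v hv hv')
  have heG := h.mem_edgeSet _ he𝒜
  have hfG := h.mem_edgeSet _ hf𝒜
  induction e with
  | h a b =>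
    induction f with
    | h c d =>
      have hac := hne a (Sym2.mem_mk_left _ _)
      have hbc := hne b (Sym2.mem_mk_right _ _)
      simp only [Sym2.mem_iff, not_or] at hac hbc
      exact ⟨a, b, c, d, hx, fun e => by simp, fun j hj g hg hgj => (h.unique _ hx _ hj g hg hgj).symm,
        he𝒜, hf𝒜, (G.mem_edgeSet.1 heG).ne, hac.1, hac.2, hbc.1, hbc.2, (G.mem_edgeSet.1 hfG).ne⟩

lemma exists_common_vertex_of_not_isVertexDisjoint (h2 : #x = 2) (hd : ¬ IsVertexDisjoint x) :
    ∃ a, ∀ e ∈ x, a ∈ e := by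
  classical
  unfold IsVertexDisjoint at hd
  push Not at hd
  obtain ⟨e, he, f, hf, v, hve, hvf, hne⟩ := hd
  refine ⟨v, fun g hg => ?_⟩
  have := eq_of_subset_of_card_le (s := {e, f}) (t := x)
    (by simp only [insert_subset_iff, singleton_subset_iff]; exact ⟨he, hf⟩)
    (by rw [h2, card_pair hne])
  rw [← this] at hg
  rcases mem_insert.1 hg with rfl | hg
  · exact hve
  · rwa [mem_singleton.1 hg]

variable [Fintype V]

lemma IsFaceSystem.exists_inl_triangle (h : IsFaceSystem 𝒜 J 𝓕) (hF : F ∈ 𝓕) (h3 : #F = 3)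
    (h0 : ∀ p x, s(.inl p, .inr x) ∉ F) {p q : V} (hpq : s(.inl p, .inl q) ∈ F) :
    ∃ r, s(p, r) ∈ freeEdges 𝒜 J ∧ s(q, r) ∈ freeEdges 𝒜 J ∧
      ∀ e, e ∈ F ↔ e = s(.inl p, .inl q) ∨ e = s(.inl q, .inl r) ∨ e = s(.inl p, .inl r) := by
  classical
  obtain ⟨w, hwp, hw⟩ := (h.leafless F hF).exists_ne _ _ hpq
  match w, hwp, hw with
  | .inr j, _, hw => exact (h0 q j hw).elim
  | .inl r, hr, hw =>
    have := (h.leafless F hF).eq_triangle h3 hpq hw hr.symm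
    refine ⟨r, h.isFree hF ?_, h.isFree hF hw, fun e => by rw [this]; simp⟩
    rw [this]
    simp

open Classical in
/-- In a graph without 4-cycles, every free edge lies in at most one triangle. -/
lemma IsFaceSystem.triangle_bound (h : IsFaceSystem 𝒜 J 𝓕)
    (hJ : ∀ i ∈ J, ∀ j ∈ J, ∀ e ∈ i, e ∈ j → i = j) (h𝒜 : ∀ e ∈ 𝒜, e ∈ G.edgeSet)
    (hC : ∀ ⦃p q r r'⦄, p ≠ q → G.Adj p r → G.Adj q r → G.Adj p r' → G.Adj q r' → r = r')
    (T : Finset (Finset (Sym2 (V ⊕ Finset (Sym2 V)))))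
    (hT : ∀ F ∈ T, F ∈ 𝓕 ∧ #F = 3 ∧ ∀ p x, s(.inl p, .inr x) ∉ F)
    (J' : Finset (Finset (Sym2 V))) (hJ' : J' ⊆ J) (hJ𝒜 : ∀ j ∈ J, j ⊆ 𝒜) :
    3 * #T + ∑ x ∈ J', #(triangleEdges 𝒜 J x) ≤ #(freeEdges 𝒜 J) := by
  have hadj : ∀ {p q}, s(p, q) ∈ freeEdges 𝒜 J → G.Adj p q := fun hpq =>
    h𝒜 _ (mem_freeEdges.1 hpq).1
  have h1 : 3 * #T ≤ ∑ F ∈ T, #{e ∈ freeEdges 𝒜 J | e.map Sum.inl ∈ F} := by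
    rw [mul_comm, ← smul_eq_mul, ← sum_const]
    refine sum_le_sum fun F hF => ?_
    obtain ⟨hF, h3, h0⟩ := hT F hF
    rw [← h3]
    refine (card_le_card (t := ({e ∈ freeEdges 𝒜 J | e.map Sum.inl ∈ F}).image
      (Sym2.map Sum.inl)) fun E hE => ?_).trans card_image_le
    rcases planarization_edge_cases (h.mem_edgeSet F hF E hE) with ⟨u, v, rfl, -⟩ | ⟨v, j, rfl, -⟩
    · exact mem_image.2 ⟨s(u, v), mem_filter.2 ⟨h.isFree hF hE, hE⟩, rfl⟩
    · exact (h0 v j hE).elim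
  have h2 : ∑ F ∈ T, #{e ∈ freeEdges 𝒜 J | e.map Sum.inl ∈ F} =
      ∑ e ∈ freeEdges 𝒜 J, #{F ∈ T | e.map Sum.inl ∈ F} :=
    sum_card_bipartiteAbove_eq_sum_card_bipartiteBelow (fun F e => Sym2.map Sum.inl e ∈ F)
  have h3 : ∑ x ∈ J', #(triangleEdges 𝒜 J x) =
      ∑ e ∈ freeEdges 𝒜 J, #{x ∈ J' | e ∈ triangleEdges 𝒜 J x} := by
    refine Eq.trans ?_ (sum_card_bipartiteAbove_eq_sum_card_bipartiteBelow (s := J')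
      (t := freeEdges 𝒜 J) (fun x e => e ∈ triangleEdges 𝒜 J x))
    refine sum_congr rfl fun x _ => ?_
    congr 1
    ext e
    rw [mem_bipartiteAbove, mem_triangleEdges]
    tauto
  rw [h3]
  refine (Nat.add_le_add_right (h1.trans_eq h2) _).trans ?_
  rw [← sum_add_distrib, card_eq_sum_ones]
  refine sum_le_sum fun e he => ?_
  induction e with
  | h p q =>
    have hpq : p ≠ q := (hadj he).ne
    have hF : ∀ F ∈ ({F ∈ T | Sym2.map Sum.inl s(p, q) ∈ F} : Finset _), ∃ r,
        s(p, r) ∈ freeEdges 𝒜 J ∧ s(q, r) ∈ freeEdges 𝒜 J ∧ ∀ e, e ∈ F ↔ e = s(.inl p, .inl q) ∨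
          e = s(.inl q, .inl r) ∨ e = s(.inl p, .inl r) := by
      intro F hF
      obtain ⟨hF, hpF⟩ := mem_filter.1 hF
      obtain ⟨hF, hF3, h0⟩ := hT F hF
      exact h.exists_inl_triangle hF hF3 h0 hpF
    have hx : ∀ x ∈ ({x ∈ J' | s(p, q) ∈ triangleEdges 𝒜 J x} : Finset _), x ∈ J ∧ ∃ r,
        (s(p, r) ∈ freeEdges 𝒜 J ∧ s(q, r) ∈ x) ∨ (s(p, r) ∈ x ∧ s(q, r) ∈ freeEdges 𝒜 J) := by
      intro x hx
      obtain ⟨hx, hpx⟩ := mem_filter.1 hx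
      refine ⟨hJ' hx, ?_⟩
      obtain ⟨-, p', q', r, heq, hq', hp'⟩ := mem_triangleEdges.1 hpx
      rcases Sym2.eq_iff.1 heq with ⟨rfl, rfl⟩ | ⟨rfl, rfl⟩
      · exact ⟨r, .inl ⟨hp', hq'⟩⟩
      · exact ⟨r, .inr ⟨hq', hp'⟩⟩
    have hx' : ∀ x ∈ J, ∀ r, (s(p, r) ∈ freeEdges 𝒜 J ∧ s(q, r) ∈ x) ∨
        (s(p, r) ∈ x ∧ s(q, r) ∈ freeEdges 𝒜 J) → G.Adj p r ∧ G.Adj q r := by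
      rintro x hx r (⟨h1, h2⟩ | ⟨h1, h2⟩)
      · exact ⟨hadj h1, h𝒜 _ (hJ𝒜 x hx h2)⟩
      · exact ⟨h𝒜 _ (hJ𝒜 x hx h1), hadj h2⟩
    have c1 : #{F ∈ T | Sym2.map Sum.inl s(p, q) ∈ F} ≤ 1 := by
      rw [card_le_one]
      intro F hF1 F' hF2
      obtain ⟨r, hp, hq, hr⟩ := hF F hF1
      obtain ⟨r', hp', hq', hr'⟩ := hF F' hF2
      obtain rfl := hC hpq (hadj hp) (hadj hq) (hadj hp') (hadj hq')
      ext e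
      rw [hr, hr']
    have c2 : #{x ∈ J' | s(p, q) ∈ triangleEdges 𝒜 J x} ≤ 1 := by
      rw [card_le_one]
      intro x hx1 y hy1
      obtain ⟨hxJ, r, hr⟩ := hx x hx1
      obtain ⟨hyJ, r', hr'⟩ := hx y hy1
      have e1 := hx' x hxJ r hr
      have e2 := hx' y hyJ r' hr'
      obtain rfl := hC hpq e1.1 e1.2 e2.1 e2.2
      rcases hr with ⟨hr1, hr2⟩ | ⟨hr1, hr2⟩ <;> rcases hr' with ⟨hs1, hs2⟩ | ⟨hs1, hs2⟩
      · exact hJ _ hxJ _ hyJ _ hr2 hs2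
      · exact ((mem_freeEdges.1 hr1).2 _ hyJ hs1).elim
      · exact ((mem_freeEdges.1 hs1).2 _ hxJ hr1).elim
      · exact hJ _ hxJ _ hyJ _ hr1 hs1
    by_contra! hcon
    obtain ⟨F, hF1⟩ := card_pos.1 (show 0 < #{F ∈ T | Sym2.map Sum.inl s(p, q) ∈ F} by omega)
    obtain ⟨x, hx1⟩ := card_pos.1 (show 0 < #{x ∈ J' | s(p, q) ∈ triangleEdges 𝒜 J x} by omega)
    obtain ⟨r, hp, hq, -⟩ := hF F hF1
    obtain ⟨hxJ, r', hr'⟩ := hx x hx1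
    have e1 := hx' x hxJ r' hr'
    obtain rfl := hC hpq (hadj hp) (hadj hq) e1.1 e1.2
    rcases hr' with ⟨-, hr2⟩ | ⟨hr1, -⟩
    · exact (mem_freeEdges.1 hq).2 _ hxJ hr2
    · exact (mem_freeEdges.1 hp).2 _ hxJ hr1

/-- The number of faces through four-edge hubs. -/
lemma IsFaceSystem.card_fourHub_le (h : IsFaceSystem 𝒜 J 𝓕) (J' : Finset (Finset (Sym2 V)))
    (hJ' : ∀ j ∈ J', #j = 4) (R : Finset (Finset (Sym2 (V ⊕ Finset (Sym2 V))))) (hR : R ⊆ 𝓕)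
    (hRJ : ∀ F ∈ R, ∃ j ∈ J', ∃ p, s(.inl p, .inr j) ∈ F) : #R ≤ 8 * #J' := by
  classical
  set Sp : Finset (Sym2 (V ⊕ Finset (Sym2 V))) :=
    J'.biUnion fun j => (hubEnds j).image fun p => s(.inl p, .inr j) with hSp
  have hSpc : #Sp ≤ #J' * 8 := by
    refine card_biUnion_le_card_mul _ _ _ fun j hj => card_image_le.trans ?_
    have := card_hubEnds_le j
    rw [hJ' j hj] at this
    exact this
  have h1 : #R * 2 ≤ ∑ F ∈ R, #{e ∈ Sp | e ∈ F} := by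
    rw [← smul_eq_mul, ← sum_const]
    refine sum_le_sum fun F hF => ?_
    obtain ⟨j, hj, p, hp⟩ := hRJ F hF
    obtain ⟨q, hqp, hq⟩ := h.exists_spoke_ne (hR hF) hp
    have hmem : ∀ v, s(.inl v, .inr j) ∈ F →
        s(.inl v, .inr j) ∈ ({e ∈ Sp | e ∈ F} : Finset _) := fun v hv =>
      mem_filter.2 ⟨mem_biUnion.2 ⟨j, hj, mem_image.2 ⟨v, mem_hubEnds.2 (h.end_mem (hR hF) hv), rfl⟩⟩,
        hv⟩
    rw [← card_pair (show s(.inl q, .inr j) ≠ s(Sum.inl p, Sum.inr j) by simpa using hqp)]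
    refine card_le_card ?_
    simp only [insert_subset_iff, singleton_subset_iff]
    exact ⟨hmem q hq, hmem p hp⟩
  have h2 : ∑ F ∈ R, #{e ∈ Sp | e ∈ F} = ∑ e ∈ Sp, #{F ∈ R | e ∈ F} :=
    sum_card_bipartiteAbove_eq_sum_card_bipartiteBelow (fun F e => e ∈ F)
  have h3 : ∑ e ∈ Sp, #{F ∈ R | e ∈ F} ≤ #Sp * 2 := by
    refine sum_le_card_nsmul _ _ _ fun e _ => ?_
    exact h.card_le _ ((filter_subset _ _).trans hR) e fun F hF => (mem_filter.1 hF).2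
  omega

/-- The number of triangular faces through four-edge hubs. -/
lemma IsFaceSystem.card_fourHub_triangle_le (h : IsFaceSystem 𝒜 J 𝓕)
    (J' : Finset (Finset (Sym2 V))) (R : Finset (Finset (Sym2 (V ⊕ Finset (Sym2 V)))))
    (hR : R ⊆ 𝓕) (h3 : ∀ F ∈ R, #F = 3)
    (hRJ : ∀ F ∈ R, ∃ j ∈ J', ∃ p, s(.inl p, .inr j) ∈ F) :
    #R ≤ ∑ k ∈ J', #(capturedEdges 𝒜 J k) := by
  classical
  refine (card_le_card (t := J'.biUnion fun k => (capturedEdges 𝒜 J k).image fun e =>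
    insert (Sym2.map Sum.inl e) (e.toFinset.image fun p => s(.inl p, .inr k))) ?_).trans
    (card_biUnion_le.trans (sum_le_sum fun k _ => card_image_le))
  intro F hF
  obtain ⟨j, hj, p, hp⟩ := hRJ F hF
  obtain ⟨q, hqp, hq⟩ := h.exists_spoke_ne (hR hF) hp
  have hFe := (h.leafless F (hR hF)).eq_triangle (h3 F hF) hp (Sym2.eq_swap ▸ hq)
    (by simpa using hqp.symm)
  have hpq : s(.inl p, .inl q) ∈ F := by
    rw [hFe]
    simp
  have hfree := mem_freeEdges.1 (h.isFree (hR hF) hpq)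
  refine mem_biUnion.2 ⟨j, hj, mem_image.2 ⟨s(p, q), mem_capturedEdges.2 ⟨hfree.1,
    fun i hi _ => hfree.2 i hi, ?_⟩, ?_⟩⟩
  · intro v hv
    rcases Sym2.mem_iff.1 hv with rfl | rfl
    · exact mem_hubEnds.2 (h.end_mem (hR hF) hp)
    · exact mem_hubEnds.2 (h.end_mem (hR hF) hq)
  · rw [hFe, Sym2.toFinset_mk_eq, image_insert, image_singleton, Sym2.map_mk,
      Sym2.eq_swap (a := Sum.inr j)]
    ext e
    simp only [mem_insert, mem_singleton]
    tauto

end HubSystem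

section HubCount

open Finset

variable {V : Type} {G : SimpleGraph V} {𝒜 : Finset (Sym2 V)}
  {J : Finset (Finset (Sym2 V))} {𝓕 : Finset (Finset (Sym2 (V ⊕ Finset (Sym2 V))))}
  {F : Finset (Sym2 (V ⊕ Finset (Sym2 V)))}

variable [Fintype V] in
/-- Every quadrangular face has a four-edge hub or an unlinked corner. -/
lemma IsFaceSystem.quad_cases (h : IsFaceSystem 𝒜 J 𝓕) (hS : IsHubSystem G 𝒜 J)
    (hC : ∀ ⦃p q r r'⦄, p ≠ q → G.Adj p r → G.Adj q r → G.Adj p r' → G.Adj q r' → r = r')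
    (hF : F ∈ 𝓕) (h4 : #F = 4) :
    (∃ j ∈ J, #j = 2 ∧ F ∈ hubQuads 𝒜 J 𝓕 j) ∨ ∃ j ∈ J, #j = 4 ∧ ∃ p, s(.inl p, .inr j) ∈ F := by
  classical
  have hadj : ∀ {p q}, s(p, q) ∈ freeEdges 𝒜 J → G.Adj p q := fun hpq =>
    hS.mem_edgeSet _ (mem_freeEdges.1 hpq).1
  have hlink : ∀ {x p q}, x ∈ J → IsLinked 𝒜 J x p q → ∃ z, G.Adj p z ∧ G.Adj q z ∧
      ((s(p, z) ∈ x ∧ s(q, z) ∈ freeEdges 𝒜 J) ∨ (s(p, z) ∈ freeEdges 𝒜 J ∧ s(q, z) ∈ x)) := by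
    rintro x p q hx ⟨z, hz⟩
    rw [Sym2.eq_swap (a := z)] at hz
    refine ⟨z, ?_, ?_, hz⟩
    · rcases hz with ⟨h1, -⟩ | ⟨h1, -⟩
      · exact hS.mem_edgeSet _ (hS.subset _ hx h1)
      · exact hadj h1
    · rcases hz with ⟨-, h1⟩ | ⟨-, h1⟩
      · exact hadj h1
      · exact hS.mem_edgeSet _ (hS.subset _ hx h1)
  by_cases hsp : ∃ p x, s(.inl p, .inr x) ∈ F
  · obtain ⟨p, x, hp⟩ := hsp
    have hx := h.hub_mem hF hp
    obtain ⟨q, hqp, hq⟩ := h.exists_spoke_ne hF hp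
    rcases hS.card_eq x hx with hx2 | hx4
    swap
    · exact .inr ⟨x, hx, hx4, p, hp⟩
    by_cases hl : IsLinked 𝒜 J x p q
    swap
    · exact .inl ⟨x, hx, hx2, mem_hubQuads.2 ⟨hF, h4, p, q, hqp.symm, hp, hq, hl⟩⟩
    obtain ⟨z, hpz, hqz, hz⟩ := hlink hx hl
    obtain ⟨w, hwx, hpw, hqw⟩ := (h.leafless F hF).exists_fourth h4 hp (Sym2.eq_swap ▸ hq)
      (show Sum.inl p ≠ Sum.inl q by simpa using hqp.symm)
    match w, hwx, hpw, hqw with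
    | .inl z', _, hpw, hqw =>
      have hpw := h.isFree hF hpw
      have hqw := h.isFree hF hqw
      obtain rfl := hC hqp.symm hpz hqz (hadj hpw) (hadj hqw)
      rcases hz with ⟨hz, -⟩ | ⟨-, hz⟩
      · exact ((mem_freeEdges.1 hpw).2 x hx hz).elim
      · exact ((mem_freeEdges.1 hqw).2 x hx hz).elim
    | .inr y, hyx, hpw, hqw =>
      have hy := h.hub_mem hF hpw
      rcases hS.card_eq y hy with hy2 | hy4
      swap
      · exact .inr ⟨y, hy, hy4, p, hpw⟩
      by_cases hl : IsLinked 𝒜 J y p q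
      swap
      · exact .inl ⟨y, hy, hy2, mem_hubQuads.2 ⟨hF, h4, p, q, hqp.symm, hpw, hqw, hl⟩⟩
      obtain ⟨z', hpz', hqz', hz'⟩ := hlink hy hl
      obtain rfl := hC hqp.symm hpz hqz hpz' hqz'
      have hyx : y ≠ x := fun hyx' => hyx (congrArg _ hyx')
      rcases hz with ⟨h1, h2⟩ | ⟨h1, h2⟩ <;> rcases hz' with ⟨h3, h4⟩ | ⟨h3, h4⟩
      · exact (hyx (hS.unique _ hy _ hx _ h3 h1)).elim
      · exact ((mem_freeEdges.1 h2).2 y hy h4).elim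
      · exact ((mem_freeEdges.1 h1).2 y hy h3).elim
      · exact (hyx (hS.unique _ hy _ hx _ h4 h2)).elim
  · push Not at hsp
    exfalso
    obtain ⟨E, hE⟩ := (h.leafless F hF).nonempty
    rcases planarization_edge_cases (h.mem_edgeSet F hF E hE) with ⟨p, q, rfl, -⟩ | ⟨v, j, rfl, -⟩
    swap
    · exact hsp v j hE
    obtain ⟨w, hwp, hw⟩ := (h.leafless F hF).exists_ne _ _ hE
    match w, hwp, hw with
    | .inr j, _, hw => exact hsp q j hw
    | .inl r, hr, hw =>
      obtain ⟨w', hwq, hpw, hrw⟩ := (h.leafless F hF).exists_fourth h4 hE hw hr.symm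
      match w', hwq, hpw, hrw with
      | .inr j, _, hpw, _ => exact hsp p j hpw
      | .inl t, ht, hpw, hrw =>
        have hpr : p ≠ r := fun hpr => hr (congrArg _ hpr.symm)
        exact ht (congrArg _ (hC hpr (hadj (h.isFree hF hE)) (hadj (h.isFree hF hw)).symm
          (hadj (h.isFree hF hpw)) (hadj (h.isFree hF hrw))).symm)

lemma IsHubSystem.card_eq_add (hS : IsHubSystem G 𝒜 J) :
    #𝒜 = #(freeEdges 𝒜 J) + 2 * #{j ∈ J | #j = 2} + 4 * #{j ∈ J | #j = 4} := by
  classical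
  have h1 : 𝒜 = freeEdges 𝒜 J ∪ J.biUnion id := by
    ext e
    rw [mem_union, mem_freeEdges, mem_biUnion]
    constructor
    · intro he
      by_cases hj : ∃ j ∈ J, e ∈ j
      · exact .inr hj
      · push Not at hj
        exact .inl ⟨he, hj⟩
    · rintro (he | ⟨j, hj, he⟩)
      · exact he.1
      · exact hS.subset j hj he
  have h2 : #𝒜 = #(freeEdges 𝒜 J) + ∑ j ∈ J, #j := by
    conv_lhs => rw [h1]
    rw [card_union_of_disjoint, card_biUnion]
    · rfl
    · intro i hi j hj hij
      exact disjoint_left.2 fun e hei hej => hij (hS.unique i hi j hj e hei hej)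
    · rw [disjoint_left]
      intro e he he'
      obtain ⟨j, hj, hej⟩ := mem_biUnion.1 he'
      exact (mem_freeEdges.1 he).2 j hj hej
  have h3 : ∑ j ∈ J, #j = ∑ j ∈ J, ((if #j = 2 then 2 else 0) + if #j = 4 then 4 else 0) :=
    sum_congr rfl fun j hj => by rcases hS.card_eq j hj with h | h <;> simp [h]
  rw [h2, h3, sum_add_distrib, ← sum_filter, ← sum_filter, sum_const, sum_const, smul_eq_mul,
    smul_eq_mul]
  ring

lemma IsHubSystem.card_freeEdges_le (hS : IsHubSystem G 𝒜 J)
    (hd : ∀ j ∈ J, IsVertexDisjoint j) (S : Finset (Sym2 (V ⊕ Finset (Sym2 V))))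
    (hSe : (S : Set (Sym2 (V ⊕ Finset (Sym2 V)))) = (planarization 𝒜 J).edgeSet) :
    #(freeEdges 𝒜 J) + 4 * #{j ∈ J | #j = 2} + 8 * #{j ∈ J | #j = 4} ≤ #S := by
  classical
  have hmem : ∀ E, E ∈ S ↔ E ∈ (planarization 𝒜 J).edgeSet := fun E => by rw [← hSe, mem_coe]
  have hinj : Function.Injective (Sum.inl : V → V ⊕ Finset (Sym2 V)) := Sum.inl_injective
  have hsub : (freeEdges 𝒜 J).image (Sym2.map Sum.inl) ∪ J.biUnion (fun j =>
      (hubEnds j).image fun p => (s(.inl p, .inr j) : Sym2 (V ⊕ Finset (Sym2 V)))) ⊆ S := by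
    refine union_subset (fun E hE => ?_) fun E hE => ?_
    · obtain ⟨e, he, rfl⟩ := mem_image.1 hE
      rw [hmem]
      have he' := mem_freeEdges.1 he
      induction e with
      | h p q => exact ⟨(G.mem_edgeSet.1 (hS.mem_edgeSet _ he'.1)).ne, he'⟩
    · obtain ⟨j, hj, hE⟩ := mem_biUnion.1 hE
      obtain ⟨p, hp, rfl⟩ := mem_image.1 hE
      rw [hmem]
      exact ⟨hj, mem_hubEnds.1 hp⟩
  refine le_trans ?_ (card_le_card hsub)
  rw [card_union_of_disjoint, card_image_of_injective _ (Sym2.map.injective hinj), card_biUnion]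
  · have h3 : ∑ j ∈ J, #((hubEnds j).image fun p =>
        (s(.inl p, .inr j) : Sym2 (V ⊕ Finset (Sym2 V)))) =
        ∑ j ∈ J, ((if #j = 2 then 4 else 0) + if #j = 4 then 8 else 0) := by
      refine sum_congr rfl fun j hj => ?_
      rw [card_image_of_injective _ (fun p q hpq => by simpa using hpq),
        card_hubEnds (hd j hj) fun e he =>
          G.not_isDiag_of_mem_edgeSet (hS.mem_edgeSet _ (hS.subset j hj he))]
      rcases hS.card_eq j hj with h | h <;> simp [h]
    rw [h3, sum_add_distrib, ← sum_filter, ← sum_filter, sum_const, sum_const, smul_eq_mul,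
      smul_eq_mul]
    omega
  · intro i hi j hj hij
    refine disjoint_left.2 fun E h1 h2 => hij ?_
    obtain ⟨p, -, rfl⟩ := mem_image.1 h1
    obtain ⟨q, -, hq⟩ := mem_image.1 h2
    simp at hq
    exact hq.2.symm
  · rw [disjoint_left]
    intro E h1 h2
    obtain ⟨e, -, rfl⟩ := mem_image.1 h1
    obtain ⟨j, -, hj⟩ := mem_biUnion.1 h2
    obtain ⟨p, -, hp⟩ := mem_image.1 hj
    induction e with
    | h a b => simp at hp

lemma capturedEdges_congr {J' : Finset (Finset (Sym2 V))}
    (h : ∀ j, #j = 4 → (j ∈ J ↔ j ∈ J')) (k : Finset (Sym2 V)) :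
    capturedEdges 𝒜 J k = capturedEdges 𝒜 J' k := by
  ext e
  rw [mem_capturedEdges, mem_capturedEdges]
  refine and_congr_right fun _ => and_congr_left fun _ => forall_congr' fun j => ?_
  by_cases h4 : #j = 4
  · rw [h j h4]
  · simp [h4]

variable [Fintype V]

lemma IsFaceSystem.nine_mul_card_le (h : IsFaceSystem 𝒜 J 𝓕)
    (S : Finset (Sym2 (V ⊕ Finset (Sym2 V))))
    (hSe : (S : Set (Sym2 (V ⊕ Finset (Sym2 V)))) = (planarization 𝒜 J).edgeSet) :
    9 * #𝓕 ≤ 4 * #S + 3 * #{F ∈ 𝓕 | #F = 3} + #{F ∈ 𝓕 | #F = 4} := by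
  classical
  have h1 : ∑ F ∈ 𝓕, #F ≤ #S * 2 := by
    have h2 : ∑ F ∈ 𝓕, #F ≤ ∑ F ∈ 𝓕, #{e ∈ S | e ∈ F} := by
      refine sum_le_sum fun F hF => card_le_card fun e he => mem_filter.2 ⟨?_, he⟩
      rw [← mem_coe, hSe]
      exact h.mem_edgeSet F hF e he
    refine (h2.trans_eq (sum_card_bipartiteAbove_eq_sum_card_bipartiteBelow
      (fun F e => e ∈ F))).trans (sum_le_card_nsmul _ _ _ fun e _ => ?_)
    exact h.card_le _ (filter_subset _ _) e fun F hF => (mem_filter.1 hF).2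
  have h3 : ∑ F ∈ 𝓕, 9 ≤ ∑ F ∈ 𝓕, (2 * #F + ((if #F = 3 then 3 else 0) +
      if #F = 4 then 1 else 0)) := by
    refine sum_le_sum fun F hF => ?_
    have := (h.leafless F hF).three_le_card
    split_ifs <;> omega
  rw [sum_add_distrib, sum_add_distrib, ← sum_filter, ← sum_filter, ← mul_sum] at h3
  simp only [sum_const, smul_eq_mul, mul_one] at h3
  omega

open Classical in
/-- The edge bound for a hub system without reducible two-edge hubs. -/
lemma IsHubSystem.bound_of_irreducible (hS : IsHubSystem G 𝒜 J)
    (hZ : HasTwoBasis (cycleSpace (planarization 𝒜 J)))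
    (hirr : ∀ j ∈ J, #j = 2 → ¬ HasTwoBasis (cycleSpace (planarization 𝒜 (J.erase j))))
    (hC : ∀ ⦃p q r r'⦄, p ≠ q → G.Adj p r → G.Adj q r → G.Adj p r' → G.Adj q r' → r = r') :
    4 * #𝒜 + 7 * #{j ∈ J | #j = 4} ≤ 9 * Fintype.card V + #{j ∈ J | #j = 2 ∧ IsVertexDisjoint j} +
      2 * ∑ k ∈ J with #k = 4, #(capturedEdges 𝒜 J k) := by
  obtain ⟨𝓕, h⟩ := exists_isFaceSystem hZ hirr
  have hd : ∀ j ∈ J, IsVertexDisjoint j := by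
    intro j hj
    rcases hS.card_eq j hj with h2 | h4
    · by_contra hcon
      obtain ⟨a, ha⟩ := exists_common_vertex_of_not_isVertexDisjoint h2 hcon
      exact hirr j hj h2 (hasTwoBasis_erase_of_common_vertex hZ hj
        (card_pos.1 (by omega)) ha)
    · exact hS.disjoint j hj h4
  have hX : ({j ∈ J | #j = 2 ∧ IsVertexDisjoint j} : Finset _) = {j ∈ J | #j = 2} :=
    filter_congr fun j hj => by simp [hd j hj]
  obtain ⟨S, hSe⟩ := (planarization 𝒜 J).edgeSet.toFinite.exists_finset_coe
  set J2 := ({j ∈ J | #j = 2} : Finset _) with hJ2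
  set J4 := ({j ∈ J | #j = 4} : Finset _) with hJ4
  have e1 := hS.card_freeEdges_le hd S hSe
  have e2 := h.nine_mul_card_le S hSe
  have e3 : #S ≤ #𝓕 + (Fintype.card V + (#J2 + #J4)) := by
    have := card_le_finrank_cycleSpace_add (planarization 𝒜 J) S hSe
      (univ.image Sum.inl ∪ J.image Sum.inr) (by
        intro E hE w hw
        rw [← mem_coe, hSe] at hE
        rcases planarization_edge_cases hE with ⟨p, q, rfl, -⟩ | ⟨v, j, rfl, hj, -⟩ <;>
          rcases Sym2.mem_iff.1 hw with rfl | rfl <;> simp_all)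
    refine this.trans (Nat.add_le_add h.finrank_le ((card_union_le _ _).trans
      (Nat.add_le_add card_image_le (card_image_le.trans ?_))))
    rw [hJ2, hJ4, ← card_union_of_disjoint]
    · refine card_le_card fun j hj => ?_
      rw [mem_union, mem_filter, mem_filter]
      have := hS.card_eq j hj
      tauto
    · rw [disjoint_left]
      intro j h2 h4
      have := (mem_filter.1 h2).2
      have := (mem_filter.1 h4).2
      omega
  set R := ({F ∈ 𝓕 | ∃ j ∈ J4, ∃ p, s(.inl p, .inr j) ∈ F} : Finset _) with hR
  set T0 := ({F ∈ 𝓕 | #F = 3 ∧ ∀ p x, s(.inl p, .inr x) ∉ F} : Finset _) with hT0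
  have eT : #{F ∈ 𝓕 | #F = 3} ≤ #T0 + ∑ x ∈ J2, #(hubTriangles 𝓕 x) + #{F ∈ R | #F = 3} := by
    refine (card_le_card (t := T0 ∪ J2.biUnion (hubTriangles 𝓕) ∪ ({F ∈ R | #F = 3} : Finset _))
      fun F hF => ?_).trans ((card_union_le _ _).trans (Nat.add_le_add_right ((card_union_le _ _).trans
        (Nat.add_le_add_left card_biUnion_le _)) _))
    obtain ⟨hF, h3⟩ := mem_filter.1 hF
    by_cases hsp : ∃ p x, s(.inl p, .inr x) ∈ F
    · obtain ⟨p, x, hp⟩ := hsp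
      have hx := h.hub_mem hF hp
      rcases hS.card_eq x hx with h2 | h4
      · exact mem_union_left _ (mem_union_right _ (mem_biUnion.2 ⟨x, mem_filter.2 ⟨hx, h2⟩,
          mem_hubTriangles.2 ⟨hF, h3, p, hp⟩⟩))
      · exact mem_union_right _ (mem_filter.2 ⟨mem_filter.2 ⟨hF, x, mem_filter.2 ⟨hx, h4⟩, p, hp⟩, h3⟩)
    · push Not at hsp
      exact mem_union_left _ (mem_union_left _ (mem_filter.2 ⟨hF, h3, hsp⟩))
  have eQ : #{F ∈ 𝓕 | #F = 4} ≤ ∑ x ∈ J2, #(hubQuads 𝒜 J 𝓕 x) + #{F ∈ R | #F = 4} := by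
    refine (card_le_card (t := J2.biUnion (hubQuads 𝒜 J 𝓕) ∪ ({F ∈ R | #F = 4} : Finset _))
      fun F hF => ?_).trans ((card_union_le _ _).trans (Nat.add_le_add_right card_biUnion_le _))
    obtain ⟨hF, h4⟩ := mem_filter.1 hF
    rcases h.quad_cases hS hC hF h4 with ⟨j, hj, h2, hFj⟩ | ⟨j, hj, hj4, p, hp⟩
    · exact mem_union_left _ (mem_biUnion.2 ⟨j, mem_filter.2 ⟨hj, h2⟩, hFj⟩)
    · exact mem_union_right _ (mem_filter.2 ⟨mem_filter.2 ⟨hF, j, mem_filter.2 ⟨hj, hj4⟩, p, hp⟩, h4⟩)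
  have eR : #{F ∈ R | #F = 3} + #{F ∈ R | #F = 4} ≤ 8 * #J4 := by
    rw [← card_union_of_disjoint]
    · refine (card_le_card (union_subset (filter_subset _ _) (filter_subset _ _))).trans
        (h.card_fourHub_le J4 (fun j hj => (mem_filter.1 hj).2) R (filter_subset _ _)
          fun F hF => (mem_filter.1 hF).2)
    · rw [disjoint_left]
      intro F h3 h4
      have := (mem_filter.1 h3).2
      have := (mem_filter.1 h4).2
      omega
  have eK : #{F ∈ R | #F = 3} ≤ ∑ k ∈ J4, #(capturedEdges 𝒜 J k) :=
    h.card_fourHub_triangle_le J4 _ ((filter_subset _ _).trans (filter_subset _ _))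
      (fun F hF => (mem_filter.1 hF).2) fun F hF => (mem_filter.1 (mem_filter.1 hF).1).2
  have eF := h.triangle_bound hS.unique hS.mem_edgeSet hC T0 (fun F hF => mem_filter.1 hF) J2
    (filter_subset _ _) hS.subset
  have eH : ∑ x ∈ J2, (3 * #(hubTriangles 𝓕 x) + #(hubQuads 𝒜 J 𝓕 x)) ≤
      ∑ x ∈ J2, (4 + #(triangleEdges 𝒜 J x)) := by
    refine sum_le_sum fun x hx => ?_
    obtain ⟨hx, h2⟩ := mem_filter.1 hx
    obtain ⟨a, b, c, d, hab⟩ := hS.isDisjointHub hx h2 (hd x hx)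
    exact h.hub_bound hab hS.mem_edgeSet hC
  rw [sum_add_distrib, sum_add_distrib, ← mul_sum, sum_const, smul_eq_mul] at eH
  have e4 := hS.card_eq_add
  rw [← hJ2, ← hJ4] at e1 e4
  rw [hX]
  omega

open Classical in
/-- The edge bound for a hub system. -/
theorem IsHubSystem.bound (hS : IsHubSystem G 𝒜 J)
    (hZ : HasTwoBasis (cycleSpace (planarization 𝒜 J)))
    (hC : ∀ ⦃p q r r'⦄, p ≠ q → G.Adj p r → G.Adj q r → G.Adj p r' → G.Adj q r' → r = r') :
    4 * #𝒜 + 7 * #{j ∈ J | #j = 4} ≤ 9 * Fintype.card V + #{j ∈ J | #j = 2 ∧ IsVertexDisjoint j} +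
      2 * ∑ k ∈ J with #k = 4, #(capturedEdges 𝒜 J k) := by
  obtain ⟨J', hJ', hmin⟩ := exists_min_image
    ({J' ∈ J.powerset | {j ∈ J | #j = 4} ⊆ J' ∧ HasTwoBasis (cycleSpace (planarization 𝒜 J'))} :
      Finset _) card ⟨J, mem_filter.2 ⟨mem_powerset_self J, filter_subset _ _, hZ⟩⟩
  obtain ⟨hJJ, h4, hZ'⟩ := mem_filter.1 hJ'
  rw [mem_powerset] at hJJ
  have hS' : IsHubSystem G 𝒜 J' :=
    ⟨hS.mem_edgeSet, fun j hj => hS.subset j (hJJ hj), fun i hi j hj => hS.unique i (hJJ hi) j (hJJ hj),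
      fun j hj => hS.card_eq j (hJJ hj), fun j hj => hS.disjoint j (hJJ hj)⟩
  have hiff : ∀ j, #j = 4 → (j ∈ J' ↔ j ∈ J) := fun j hj =>
    ⟨fun h => hJJ h, fun h => h4 (mem_filter.2 ⟨h, hj⟩)⟩
  have hK : ({j ∈ J' | #j = 4} : Finset _) = ({j ∈ J | #j = 4} : Finset _) := by
    ext j
    simp only [mem_filter]
    exact and_congr_left (hiff j)
  have h := hS'.bound_of_irreducible hZ' (fun j hj h2 hE => by
    have := hmin (J'.erase j) (mem_filter.2 ⟨mem_powerset.2 ((erase_subset _ _).trans hJJ),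
      fun i hi => mem_erase.2 ⟨by rintro rfl; have := (mem_filter.1 hi).2; omega, h4 hi⟩, hE⟩)
    have := card_erase_lt_of_mem hj
    omega) hC
  rw [hK, sum_congr rfl fun k _ => congrArg card (capturedEdges_congr hiff k)] at h
  have := card_le_card (filter_subset_filter (fun j => #j = 2 ∧ IsVertexDisjoint j) hJJ)
  omega

end HubCount

section Brooks

open Finset

variable {E : Type*} {H : SimpleGraph E}

/-- The coloring `c` is proper on the vertex set `T`. -/
def IsProperOn (H : SimpleGraph E) (T : Finset E) (c : E → Fin 3) : Prop :=
  ∀ u ∈ T, ∀ v ∈ T, H.Adj u v → c u ≠ c v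

open Classical in
/-- Every vertex of `S` has at most three neighbours in `S`. -/
def IsSubcubicOn (H : SimpleGraph E) (S : Finset E) : Prop :=
  ∀ v ∈ S, #{u ∈ S | H.Adj v u} ≤ 3

lemma IsSubcubicOn.mono {S T : Finset E} (h : IsSubcubicOn H S) (hT : T ⊆ S) :
    IsSubcubicOn H T := by
  classical
  exact fun v hv => (card_le_card (filter_subset_filter _ hT)).trans (h v (hT hv))

open Classical in
lemma IsProperOn.exists_insert {T : Finset E} {c : E → Fin 3} (hc : IsProperOn H T c) {v : E}
    (hv : v ∉ T) (h : #({u ∈ T | H.Adj v u}.image c) ≤ 2) :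
    ∃ c', IsProperOn H (insert v T) c' ∧ ∀ u ∈ T, c' u = c u := by
  obtain ⟨a, ha⟩ : ∃ a, a ∉ ({u ∈ T | H.Adj v u} : Finset E).image c := by
    by_contra! hcon
    have : (univ : Finset (Fin 3)) ⊆ ({u ∈ T | H.Adj v u} : Finset E).image c := fun a _ => hcon a
    have := card_le_card this
    rw [card_univ, Fintype.card_fin] at this
    omega
  have ha' : ∀ u ∈ T, H.Adj v u → c u ≠ a := fun u hu huv hua =>
    ha (mem_image.2 ⟨u, mem_filter.2 ⟨hu, huv⟩, hua⟩)
  have hne : ∀ u ∈ T, u ≠ v := fun u hu huv => hv (huv ▸ hu)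
  refine ⟨Function.update c v a, ?_, fun u hu => Function.update_of_ne (hne u hu) _ _⟩
  intro x hx y hy hxy
  rcases mem_insert.1 hx with rfl | hx' <;> rcases mem_insert.1 hy with rfl | hy'
  · exact (H.loopless.irrefl _ hxy).elim
  · rw [Function.update_self, Function.update_of_ne (hne y hy')]
    exact (ha' y hy' hxy).symm
  · rw [Function.update_self, Function.update_of_ne (hne x hx')]
    exact ha' x hx' hxy.symm
  · rw [Function.update_of_ne (hne x hx'), Function.update_of_ne (hne y hy')]
    exact hc x hx' y hy' hxy

open Classical in
lemma IsProperOn.exists_insert_of_adj {S T : Finset E} (hS : IsSubcubicOn H S) (hT : T ⊆ S)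
    {c : E → Fin 3} (hc : IsProperOn H T c) {v y : E} (hvS : v ∈ S) (hv : v ∉ T) (hyS : y ∈ S)
    (hy : y ∉ T) (hvy : H.Adj v y) :
    ∃ c', IsProperOn H (insert v T) c' ∧ ∀ u ∈ T, c' u = c u := by
  classical
  refine hc.exists_insert hv (card_image_le.trans ?_)
  have h1 : insert y ({u ∈ T | H.Adj v u} : Finset E) ⊆ ({u ∈ S | H.Adj v u} : Finset E) :=
    insert_subset (mem_filter.2 ⟨hyS, hvy⟩) (filter_subset_filter _ hT)
  have h2 := card_le_card h1
  rw [card_insert_of_notMem fun h => hy (mem_filter.1 h).1] at h2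
  have h3 : #{u ∈ S | H.Adj v u} ≤ 3 := by convert hS v hvS
  omega

open Classical in
lemma IsProperOn.exists_insert_of_eq {S T : Finset E} (hS : IsSubcubicOn H S) (hT : T ⊆ S)
    {c : E → Fin 3} (hc : IsProperOn H T c) {v p q : E} (hvS : v ∈ S) (hv : v ∉ T) (hp : p ∈ T)
    (hq : q ∈ T) (hpq : p ≠ q) (hvp : H.Adj v p) (hvq : H.Adj v q) (h : c p = c q) :
    ∃ c', IsProperOn H (insert v T) c' ∧ ∀ u ∈ T, c' u = c u := by
  classical
  refine hc.exists_insert hv ?_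
  have h1 : ({u ∈ T | H.Adj v u} : Finset E).image c ⊆
      (({u ∈ T | H.Adj v u} : Finset E).erase q).image c := by
    intro a ha
    obtain ⟨u, hu, rfl⟩ := mem_image.1 ha
    by_cases huq : u = q
    · exact mem_image.2 ⟨p, mem_erase.2 ⟨hpq, mem_filter.2 ⟨hp, hvp⟩⟩, by rw [huq, h]⟩
    · exact mem_image.2 ⟨u, mem_erase.2 ⟨huq, hu⟩, rfl⟩
  have h2 := (card_le_card h1).trans card_image_le
  have hqN : q ∈ ({u ∈ T | H.Adj v u} : Finset E) := mem_filter.2 ⟨hq, hvq⟩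
  rw [card_erase_of_mem hqN] at h2
  have := card_pos.2 ⟨q, hqN⟩
  have h3 : #{u ∈ S | H.Adj v u} ≤ 3 := by convert hS v hvS
  have h4 : #{u ∈ T | H.Adj v u} ≤ #{u ∈ S | H.Adj v u} :=
    card_le_card (filter_subset_filter _ hT)
  omega

open Classical in
/-- Greedy coloring along a path whose last vertex keeps an uncolored neighbour or sees a repeated
color. -/
lemma IsProperOn.exists_append {S : Finset E} (hS : IsSubcubicOn H S) (l : List E) (x : E) :
    ∀ (T : Finset E) (c : E → Fin 3), T ⊆ S → IsProperOn H T c → (l ++ [x]).IsChain H.Adj →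
    (l ++ [x]).Nodup → (∀ v ∈ l ++ [x], v ∈ S ∧ v ∉ T) →
    ((∃ y ∈ S, y ∉ T ∧ y ∉ l ++ [x] ∧ H.Adj x y) ∨
      ∃ p ∈ T, ∃ q ∈ T, p ≠ q ∧ H.Adj x p ∧ H.Adj x q ∧ c p = c q) →
    ∃ c', IsProperOn H (T ∪ (l ++ [x]).toFinset) c' ∧ ∀ u ∈ T, c' u = c u := by
  induction l with
  | nil =>
    intro T c hT hc _ _ hl hx
    have hxT := hl x (by simp)
    have hTx : T ∪ ([] ++ [x]).toFinset = insert x T := by ext; simp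
    rw [hTx]
    rcases hx with ⟨y, hyS, hyT, -, hxy⟩ | ⟨p, hp, q, hq, hpq, hxp, hxq, heq⟩
    · exact hc.exists_insert_of_adj hS hT hxT.1 hxT.2 hyS hyT hxy
    · exact hc.exists_insert_of_eq hS hT hxT.1 hxT.2 hp hq hpq hxp hxq heq
  | cons a l ih =>
    intro T c hT hc hch hnd hl hx
    have haT := hl a (by simp)
    rw [List.cons_append] at hch hnd
    rw [List.nodup_cons] at hnd
    obtain ⟨b, m, hbm⟩ : ∃ b m, l ++ [x] = b :: m := by
      cases l with
      | nil => exact ⟨x, [], rfl⟩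
      | cons b l => exact ⟨b, l ++ [x], rfl⟩
    have hbmem : b ∈ l ++ [x] := by rw [hbm]; simp
    have hab : H.Adj a b := by
      rw [hbm, List.isChain_cons_cons] at hch
      exact hch.1
    have hbT := hl b (List.mem_cons_of_mem _ hbmem)
    obtain ⟨c1, hc1, hcc1⟩ := hc.exists_insert_of_adj hS hT haT.1 haT.2 hbT.1 hbT.2 hab
    obtain ⟨c2, hc2, hcc2⟩ := ih (insert a T) c1 (insert_subset haT.1 hT) hc1 hch.of_cons hnd.2
      (fun v hv => ⟨(hl v (List.mem_cons_of_mem _ hv)).1, fun hva => by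
        rcases mem_insert.1 hva with rfl | hva
        · exact hnd.1 hv
        · exact (hl v (List.mem_cons_of_mem _ hv)).2 hva⟩)
      (by
        rcases hx with ⟨y, hyS, hyT, hyl, hxy⟩ | ⟨p, hp, q, hq, hpq, hxp, hxq, heq⟩
        · rw [List.cons_append, List.mem_cons, not_or] at hyl
          exact .inl ⟨y, hyS, by rw [mem_insert, not_or]; exact ⟨hyl.1, hyT⟩, hyl.2, hxy⟩
        · exact .inr ⟨p, mem_insert_of_mem hp, q, mem_insert_of_mem hq, hpq, hxp, hxq,
            by rw [hcc1 p hp, hcc1 q hq, heq]⟩)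
    refine ⟨c2, ?_, fun u hu => (hcc2 u (mem_insert_of_mem hu)).trans (hcc1 u hu)⟩
    have : T ∪ (a :: l ++ [x]).toFinset = insert a T ∪ (l ++ [x]).toFinset := by
      ext v
      simp only [mem_union, mem_insert, List.mem_toFinset, List.cons_append, List.mem_cons]
      tauto
    rwa [this]

lemma List.exists_last_of_exists {α : Type*} {p : α → Prop} (L : List α) (h : ∃ x ∈ L, p x) :
    ∃ A x B, L = A ++ x :: B ∧ p x ∧ ∀ y ∈ B, ¬ p y := by
  induction L with
  | nil => simp at h
  | cons a L ih =>
    by_cases hL : ∃ x ∈ L, p x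
    · obtain ⟨A, x, B, rfl, hx, hB⟩ := ih hL
      exact ⟨a :: A, x, B, rfl, hx, hB⟩
    · push Not at hL
      obtain ⟨x, hx, hpx⟩ := h
      rcases List.mem_cons.1 hx with rfl | hx
      · exact ⟨[], x, L, rfl, hpx, hL⟩
      · exact (hL x hx hpx).elim

end Brooks

section Brooks

open Finset

variable {E : Type*} {H : SimpleGraph E}

lemma List.exists_first_of_exists {α : Type*} {p : α → Prop} (L : List α) (h : ∃ x ∈ L, p x) :
    ∃ A x B, L = A ++ x :: B ∧ p x ∧ ∀ y ∈ A, ¬ p y := by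
  induction L with
  | nil => simp at h
  | cons a L ih =>
    by_cases ha : p a
    · exact ⟨[], a, L, rfl, ha, by simp⟩
    · obtain ⟨A, x, B, rfl, hx, hA⟩ := ih (by
        obtain ⟨x, hx, hpx⟩ := h
        rcases List.mem_cons.1 hx with rfl | hx
        · exact (ha hpx).elim
        · exact ⟨x, hx, hpx⟩)
      refine ⟨a :: A, x, B, rfl, hx, fun y hy => ?_⟩
      rcases List.mem_cons.1 hy with rfl | hy
      · exact ha
      · exact hA y hy

open Classical in
/-- A proper coloring of the complement of a cycle extends to the cycle if some but not all of the
vertices of the cycle have neighbours outside the cycle. -/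
lemma IsProperOn.exists_of_cycle {S : Finset E} (hS : IsSubcubicOn H S) {D : List E} {r : E}
    (hD : D.IsChain H.Adj) (hnd : D.Nodup) (hDS : ∀ v ∈ D, v ∈ S) (hr : D.getLast? = some r)
    (hh : ∀ h ∈ D.head?, H.Adj r h) (hrD : ∀ u ∈ S, H.Adj r u → u ∈ D)
    (hx : ∃ x ∈ D, ∃ u ∈ S, u ∉ D ∧ H.Adj x u) {c : E → Fin 3}
    (hc : IsProperOn H (S \ D.toFinset) c) : ∃ c', IsProperOn H S c' := by
  obtain ⟨A, x, B, hAB, ⟨u, huS, huD, hxu⟩, hB⟩ := List.exists_last_of_exists D hx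
  cases B with
  | nil =>
    rw [hAB, List.getLast?_append_cons, List.getLast?_singleton, Option.some_inj] at hr
    exact (huD (hrD u huS (hr ▸ hxu))).elim
  | cons y B =>
    have hyD : y ∈ D := by rw [hAB]; simp
    have hyu : ∀ v ∈ S, v ∉ D → ¬ H.Adj y v := fun v hv hvD hyv =>
      hB y (by simp) ⟨v, hv, hvD, hyv⟩
    have huy : u ≠ y := fun h => huD (h ▸ hyD)
    have hne : ∀ v ∈ S \ D.toFinset, v ≠ y := by
      rintro v hv rfl
      exact (mem_sdiff.1 hv).2 (List.mem_toFinset.2 hyD)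
    have hyT : ∀ v ∈ S \ D.toFinset, ¬ H.Adj y v := fun v hv =>
      hyu v (mem_sdiff.1 hv).1 fun h => (mem_sdiff.1 hv).2 (List.mem_toFinset.2 h)
    have hc1 : IsProperOn H (insert y (S \ D.toFinset)) (Function.update c y (c u)) := by
      intro a ha b hb hab
      rcases mem_insert.1 ha with rfl | ha' <;> rcases mem_insert.1 hb with rfl | hb'
      · exact (H.loopless.irrefl _ hab).elim
      · exact (hyT b hb' hab).elim
      · exact (hyT a ha' hab.symm).elim
      · rw [Function.update_of_ne (hne a ha'), Function.update_of_ne (hne b hb')]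
        exact hc a ha' b hb' hab
    have hD' : D = (A ++ [x]) ++ (y :: B) := by rw [hAB]; simp
    have hch := hD
    rw [hD', List.isChain_append] at hch
    have hnd' := hnd
    rw [hD', List.nodup_append] at hnd'
    obtain ⟨hn1, hn2, hn3⟩ := hnd'
    rw [List.nodup_cons] at hn2
    have hmem : ∀ v, v ∈ D ↔ v = y ∨ v ∈ (B ++ A) ++ [x] := by
      intro v
      rw [hD']
      simp only [List.mem_append, List.mem_cons]
      tauto
    have hxy : H.Adj x y := hch.2.2 x (by simp) y (by simp)
    have huT : u ∈ S \ D.toFinset := mem_sdiff.2 ⟨huS, fun h => huD (List.mem_toFinset.1 h)⟩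
    have hyn : y ∉ (B ++ A) ++ [x] := by
      intro h
      rw [List.append_assoc, List.mem_append] at h
      rcases h with h | h
      · exact hn2.1 h
      · exact hn3 y h y (by simp) rfl
    obtain ⟨c', hc', -⟩ := IsProperOn.exists_append hS (B ++ A) x (insert y (S \ D.toFinset)) _
      (insert_subset (hDS y hyD) sdiff_subset) hc1 (by
        rw [List.append_assoc, List.isChain_append]
        refine ⟨hch.2.1.of_cons, hch.1, fun a ha b hb => ?_⟩
        have har : a = r := by
          rw [hD', List.getLast?_append_cons] at hr
          cases B with
          | nil => simp at ha
          | cons b B =>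
            rw [List.getLast?_cons_cons] at hr
            rw [Option.mem_def, hr] at ha
            exact (Option.some_inj.1 ha).symm
        rw [har]
        refine hh b ?_
        rw [hD']
        cases A with
        | nil => simpa using hb
        | cons a A => simpa using hb) (by
        rw [List.append_assoc, List.nodup_append]
        exact ⟨hn2.2, hn1, fun a ha b hb hab => hn3 b hb a (List.mem_cons_of_mem _ ha) hab.symm⟩)
      (fun v hv => by
        have hvD := (hmem v).2 (.inr hv)
        refine ⟨hDS v hvD, fun h => ?_⟩
        rcases mem_insert.1 h with rfl | h
        · exact hyn hv
        · exact (mem_sdiff.1 h).2 (List.mem_toFinset.2 hvD))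
      (.inr ⟨u, mem_insert_of_mem huT, y, mem_insert_self _ _, huy, hxu, hxy, by
        rw [Function.update_self, Function.update_of_ne huy]⟩)
    refine ⟨c', ?_⟩
    convert hc' using 1
    ext v
    rw [mem_union, mem_insert, mem_sdiff, List.mem_toFinset, List.mem_toFinset, or_right_comm,
      ← hmem]
    by_cases hv : v ∈ D
    · simp [hv, hDS v hv]
    · simp [hv]

open Classical in
lemma IsProperOn.exists_of_path {S : Finset E} (hS : IsSubcubicOn H S) {a b c w : E} {l : List E}
    (hch : (a :: b :: c :: l).IsChain H.Adj) (hnd : (a :: b :: c :: l).Nodup)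
    (hmem : ∀ v, v ∈ a :: b :: c :: l ↔ v ∈ S) (hac : ¬ H.Adj a c) (hw : w ∈ S) (hwa : w ≠ a)
    (hwc : w ≠ c) (hbw : H.Adj b w) : ∃ c', IsProperOn H S c' := by
  rw [List.isChain_cons_cons, List.isChain_cons_cons] at hch
  obtain ⟨hab, hbc, hch⟩ := hch
  have hwl : w ∈ l := by
    have := (hmem w).2 hw
    simp only [List.mem_cons] at this
    rcases this with h | h | h | h
    · exact (hwa h).elim
    · exact (hbw.ne h.symm).elim
    · exact (hwc h).elim
    · exact h
  obtain ⟨A, B, rfl⟩ := List.append_of_mem hwl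
  simp only [List.nodup_cons, List.mem_cons, List.mem_append, not_or, List.nodup_append,
    List.mem_cons] at hnd
  obtain ⟨⟨hab', hac', haA, haw, haB⟩, ⟨hbc', hbA, hbw', hbB⟩, ⟨hcA, hcw, hcB⟩, hA, ⟨hwB, hB⟩, hAB⟩ :=
    hnd
  have hl := hch.of_cons
  rw [List.isChain_append] at hl
  have hSm : ∀ v, v ∈ S ↔ v = a ∨ v = b ∨ v = c ∨ v ∈ A ∨ v = w ∨ v ∈ B := fun v => by
    rw [← hmem]
    simp
  have haS : a ∈ S := (hSm a).2 (by simp)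
  have hbS : b ∈ S := (hSm b).2 (by simp)
  have hcS : c ∈ S := (hSm c).2 (by simp)
  have hwA : w ∉ A := fun h => hAB w h w (.inl rfl) rfl
  have hdAB : ∀ v ∈ A, v ∉ B := fun v h h' => hAB v h v (.inr h') rfl
  have h0 : IsProperOn H {a, c} (fun _ => 0) := by
    intro x hx y hy hxy
    simp only [mem_insert, mem_singleton] at hx hy
    rcases hx with rfl | rfl <;> rcases hy with rfl | rfl
    · exact (H.loopless.irrefl _ hxy).elim
    · exact (hac hxy).elim
    · exact (hac hxy.symm).elim
    · exact (H.loopless.irrefl _ hxy).elim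
  have hT0 : {a, c} ⊆ S := by
    simp only [insert_subset_iff, singleton_subset_iff]
    exact ⟨haS, hcS⟩
  obtain ⟨c1, hc1, hcc1⟩ : ∃ c1, IsProperOn H ({a, c} ∪ A.toFinset) c1 ∧ ∀ u ∈ ({a, c} : Finset E),
      c1 u = (fun _ => 0) u := by
    rcases List.eq_nil_or_concat A with rfl | ⟨A', z, rfl⟩
    · exact ⟨fun _ => 0, by simpa using h0, fun u _ => rfl⟩
    · rw [List.concat_eq_append] at *
      refine IsProperOn.exists_append hS A' z {a, c} _ hT0 h0 hl.1 hA (fun v hv => ?_)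
        (.inl ⟨w, hw, ?_, hwA, hl.2.2 z (by simp) w (by simp)⟩)
      · refine ⟨(hSm v).2 (by simp only [hv, true_or, or_true]), ?_⟩
        simp only [mem_insert, mem_singleton, not_or]
        exact ⟨fun h => haA (h ▸ hv), fun h => hcA (h ▸ hv)⟩
      · simp only [mem_insert, mem_singleton, not_or]
        exact ⟨hwa, hwc⟩
  obtain ⟨c2, hc2, hcc2⟩ := IsProperOn.exists_append hS B.reverse w ({a, c} ∪ A.toFinset) c1
    (union_subset hT0 fun v hv => (hSm v).2 (by simp only [List.mem_toFinset.1 hv, true_or, or_true]))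
    hc1 (by
      have : B.reverse ++ [w] = (w :: B).reverse := by simp
      rw [this, List.isChain_reverse]
      exact hl.2.1.imp fun _ _ h => h.symm) (by
      rw [List.nodup_append]
      refine ⟨List.nodup_reverse.2 hB, by simp, fun x hx y hy hxy => ?_⟩
      rw [List.mem_singleton.1 hy] at hxy
      exact hwB (hxy ▸ List.mem_reverse.1 hx)) (fun v hv => by
      simp only [List.mem_append, List.mem_reverse, List.mem_singleton] at hv
      refine ⟨(hSm v).2 (by tauto), ?_⟩
      simp only [mem_union, mem_insert, mem_singleton, List.mem_toFinset, not_or]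
      rcases hv with hv | rfl
      · exact ⟨⟨fun h => haB (h ▸ hv), fun h => hcB (h ▸ hv)⟩, fun h => hdAB v h hv⟩
      · exact ⟨⟨hwa, hwc⟩, hwA⟩)
    (.inl ⟨b, hbS, by
      simp only [mem_union, mem_insert, mem_singleton, List.mem_toFinset, not_or]
      exact ⟨⟨fun h => hab' h.symm, hbc'⟩, hbA⟩, by
      simp only [List.mem_append, List.mem_reverse, List.mem_singleton, not_or]
      exact ⟨hbB, hbw'⟩, hbw.symm⟩)
  have ha1 : a ∈ ({a, c} : Finset E) := by simp
  have hc1' : c ∈ ({a, c} : Finset E) := by simp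
  have hSub : {a, c} ∪ A.toFinset ∪ (B.reverse ++ [w]).toFinset ⊆ S := by
    intro v hv
    simp only [mem_union, mem_insert, mem_singleton, List.mem_toFinset, List.mem_append,
      List.mem_reverse] at hv
    rw [hSm]
    simp only [List.not_mem_nil, or_false, List.mem_cons] at hv
    tauto
  obtain ⟨c3, hc3, -⟩ := hc2.exists_insert_of_eq hS hSub hbS (by
      simp only [mem_union, mem_insert, mem_singleton, List.mem_toFinset, List.mem_append,
        List.mem_reverse, not_or, List.mem_singleton]
      exact ⟨⟨⟨fun h => hab' h.symm, hbc'⟩, hbA⟩, hbB, hbw'⟩)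
    (mem_union_left _ (mem_union_left _ ha1)) (mem_union_left _ (mem_union_left _ hc1')) hac' hab.symm
    hbc (by rw [hcc2 a (mem_union_left _ ha1), hcc2 c (mem_union_left _ hc1'), hcc1 a ha1,
      hcc1 c hc1'])
  refine ⟨c3, ?_⟩
  convert hc3 using 1
  ext v
  simp only [hSm, mem_union, mem_insert, mem_singleton, List.mem_toFinset, List.mem_append,
    List.mem_reverse, List.mem_cons, List.not_mem_nil, or_false]
  tauto

end Brooks

section Brooks

open Finset

variable {E : Type*} {H : SimpleGraph E}

lemma IsProperOn.exists_union {S T : Finset E} {c d : E → Fin 3} [DecidableEq E]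
    (hc : IsProperOn H S c) (hd : IsProperOn H T d) (hST : ∀ u ∈ S, ∀ v ∈ T, ¬ H.Adj u v) :
    ∃ c', IsProperOn H (S ∪ T) c' := by
  classical
  refine ⟨fun u => if u ∈ S then c u else d u, fun u hu v hv huv => ?_⟩
  by_cases hu' : u ∈ S <;> by_cases hv' : v ∈ S
  · simp only [hu', hv', if_true]
    exact hc u hu' v hv' huv
  · exact (hST u hu' v ((mem_union.1 hv).resolve_left hv') huv).elim
  · exact (hST v hv' u ((mem_union.1 hu).resolve_left hu') huv.symm).elim
  · simp only [hu', hv', if_false]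
    exact hd u ((mem_union.1 hu).resolve_left hu') v ((mem_union.1 hv).resolve_left hv') huv

/-- Brooks' theorem for graphs of maximum degree at most three. -/
theorem IsSubcubicOn.exists_isProperOn {S : Finset E} (hS : IsSubcubicOn H S)
    (hK : ∀ a ∈ S, ∀ b ∈ S, ∀ c ∈ S, ∀ d ∈ S, H.Adj a b → H.Adj a c → H.Adj a d → H.Adj b c →
      H.Adj b d → ¬ H.Adj c d) : ∃ c, IsProperOn H S c := by
  classical
  induction S using Finset.strongInduction with
  | H S ih =>
  have ih' : ∀ T, T ⊂ S → ∃ c, IsProperOn H T c := fun T hT => ih T hT (hS.mono hT.1)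
    fun a ha b hb c hc d hd => hK a (hT.1 ha) b (hT.1 hb) c (hT.1 hc) d (hT.1 hd)
  by_cases hdeg : ∃ v ∈ S, #{u ∈ S | H.Adj v u} ≤ 2
  · obtain ⟨v, hv, hv2⟩ := hdeg
    obtain ⟨c, hc⟩ := ih' _ (erase_ssubset hv)
    obtain ⟨c', hc', -⟩ := hc.exists_insert (notMem_erase v S) (by
      refine card_image_le.trans (le_trans (card_le_card ?_) hv2)
      intro u hu
      simp only [mem_filter] at hu ⊢
      exact ⟨mem_of_mem_erase hu.1, hu.2⟩)
    refine ⟨c', ?_⟩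
    convert hc'
    exact (insert_erase hv).symm
  push Not at hdeg
  rcases S.eq_empty_or_nonempty with rfl | ⟨b, hb⟩
  · exact ⟨fun _ => 0, fun u hu => absurd hu (notMem_empty u)⟩
  -- A vertex `b` with two nonadjacent neighbours `a` and `c` and a third neighbour `w`.
  obtain ⟨a, c, w, ha, hc, hw, hba, hbc, hbw, hac', hwa, hwc, hac⟩ : ∃ a c w, a ∈ S ∧ c ∈ S ∧ w ∈ S ∧
      H.Adj b a ∧ H.Adj b c ∧ H.Adj b w ∧ a ≠ c ∧ w ≠ a ∧ w ≠ c ∧ ¬ H.Adj a c := by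
    obtain ⟨x, y, z, hx, hy, hz, hxy, hxz, hyz⟩ := two_lt_card_iff.1 (hdeg b hb)
    simp only [mem_filter] at hx hy hz
    by_cases h1 : H.Adj x y
    · by_cases h2 : H.Adj x z
      · exact ⟨y, z, x, hy.1, hz.1, hx.1, hy.2, hz.2, hx.2, hyz, hxy, hxz,
          hK b hb x hx.1 y hy.1 z hz.1 hx.2 hy.2 hz.2 h1 h2⟩
      · exact ⟨x, z, y, hx.1, hz.1, hy.1, hx.2, hz.2, hy.2, hxz, hxy.symm, hyz, h2⟩
    · exact ⟨x, y, z, hx.1, hy.1, hz.1, hx.2, hy.2, hz.2, hxy, hxz.symm, hyz.symm, h1⟩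
  -- A longest path starting with `a`, `b`, `c`.
  let P : List E → Prop := fun l => (a :: b :: c :: l).IsChain H.Adj ∧ (a :: b :: c :: l).Nodup ∧
    ∀ v ∈ a :: b :: c :: l, v ∈ S
  have hP0 : P [] := by
    refine ⟨by simp [hba.symm, hbc], by simp [hba.ne', hbc.ne, hac'], by simp [ha, hb, hc]⟩
  have hPlen : ∀ l, P l → l.length ≤ #S := by
    intro l hl
    have h1 := List.toFinset_card_of_nodup hl.2.1
    have h2 : #(a :: b :: c :: l).toFinset ≤ #S := card_le_card fun v hv =>
      hl.2.2 v (List.mem_toFinset.1 hv)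
    simp only [List.length_cons] at h1
    omega
  obtain ⟨l, hl, hmax⟩ : ∃ l, P l ∧ ∀ l', P l' → l'.length ≤ l.length := by
    obtain ⟨l, hl, hlk⟩ := Nat.findGreatest_spec (P := fun k => ∃ l, P l ∧ l.length = k)
      (Nat.zero_le #S) ⟨[], hP0, rfl⟩
    refine ⟨l, hl, fun l' hl' => ?_⟩
    rw [hlk]
    exact Nat.le_findGreatest (hPlen l' hl') ⟨l', hl', rfl⟩
  obtain ⟨hch, hnd, hlS⟩ := hl
  set L := a :: b :: c :: l with hL
  obtain ⟨r, hr⟩ : ∃ r, L.getLast? = some r := by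
    rw [← Option.isSome_iff_exists, hL]
    simp
  have hrS : r ∈ S := hlS r (List.mem_of_getLast? hr)
  have hrL : ∀ u ∈ S, H.Adj r u → u ∈ L := by
    intro u hu hru
    by_contra huL
    have := hmax (l ++ [u]) (by
      have h1 : a :: b :: c :: (l ++ [u]) = L ++ [u] := by rw [hL]; rfl
      simp only [P, h1]
      refine ⟨List.isChain_append.2 ⟨hch, by simp, fun x hx y hy => ?_⟩, ?_, fun v hv => ?_⟩
      · simp only [List.head?_cons, Option.mem_def, Option.some_inj] at hy
        rw [Option.mem_def, hr, Option.some_inj] at hx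
        rwa [← hx, ← hy]
      · rw [List.nodup_append]
        refine ⟨hnd, by simp, fun x hx y hy hxy => ?_⟩
        rw [List.mem_singleton.1 hy] at hxy
        exact huL (hxy ▸ hx)
      · rcases List.mem_append.1 hv with hv | hv
        · exact hlS v hv
        · rwa [List.mem_singleton.1 hv])
    simp at this
  by_cases hcov : ∀ v ∈ S, v ∈ L
  · exact IsProperOn.exists_of_path hS hch hnd (fun v => ⟨hlS v, hcov v⟩) hac hw hwa hwc hbw
  obtain ⟨z, hz⟩ : ∃ z, z ∈ S ∧ H.Adj r z := by
    obtain ⟨z, hz⟩ := card_pos.1 (show 0 < #{u ∈ S | H.Adj r u} by have := hdeg r hrS; omega)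
    exact ⟨z, mem_filter.1 hz⟩
  obtain ⟨A, h, B, hAB, hrh, hA⟩ := List.exists_first_of_exists (p := H.Adj r) L ⟨z, hrL z hz.1 hz.2, hz.2⟩
  set D := h :: B with hD
  have hDL : ∀ v ∈ D, v ∈ L := fun v hv => by rw [hAB]; exact List.mem_append_right _ hv
  have hDS : D.toFinset ⊂ S := by
    push Not at hcov
    obtain ⟨v, hv, hvL⟩ := hcov
    exact (ssubset_iff_of_subset fun u hu => hlS u (hDL u (List.mem_toFinset.1 hu))).2
      ⟨v, hv, fun hvD => hvL (hDL v (List.mem_toFinset.1 hvD))⟩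
  have hSD : S \ D.toFinset ⊂ S := by
    refine (ssubset_iff_of_subset sdiff_subset).2 ⟨h, hDS.1 (by simp [hD]), by simp [hD]⟩
  obtain ⟨c1, hc1⟩ := ih' _ hSD
  obtain ⟨c2, hc2⟩ := ih' _ hDS
  by_cases hx : ∃ x ∈ D, ∃ u ∈ S, u ∉ D ∧ H.Adj x u
  · rw [hAB] at hch hnd hr
    rw [List.isChain_append] at hch
    rw [List.nodup_append] at hnd
    refine hc1.exists_of_cycle hS hch.2.1 hnd.2.1
      (fun v hv => hlS v (hDL v hv)) (r := r) ?_ (fun x hx => ?_) (fun u hu hru => ?_) hx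
    · rw [hD, List.getLast?_append_cons] at hr
      exact hr
    · rw [hD, List.head?_cons, Option.mem_def, Option.some_inj] at hx
      rwa [← hx]
    · have := hrL u hu hru
      rw [hAB, List.mem_append] at this
      exact this.resolve_left fun huA => hA u huA hru
  · push Not at hx
    obtain ⟨c', hc'⟩ := hc2.exists_union hc1 (fun u hu v hv =>
      hx u (List.mem_toFinset.1 hu) v (mem_sdiff.1 hv).1 fun hvD =>
        (mem_sdiff.1 hv).2 (List.mem_toFinset.2 hvD))
    refine ⟨c', ?_⟩
    rwa [union_sdiff_of_subset hDS.1] at hc'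

end Brooks

section Cut

open Finset

variable {E : Type*} {R : Finset E} {w : E → E → ℕ}

open Classical in
/-- The weight of the pairs formed by `e` and another element of `R` in the same class. -/
noncomputable def classWeight (R : Finset E) (w : E → E → ℕ) (c : E → Bool) (e : E) : ℕ :=
  ∑ f ∈ R with f ≠ e ∧ c f = c e, w e f

open Classical in
lemma classWeight_eq (R : Finset E) (w : E → E → ℕ) (c : E → Bool) (e : E) :
    classWeight R w c e = ∑ f ∈ R, if f ≠ e ∧ c f = c e then w e f else 0 := by
  rw [classWeight, sum_filter]

lemma sum_sum_eq_of_symmetric [DecidableEq E] {g : E → E → ℕ} (hg : ∀ e f, g e f = g f e) {v : E}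
    (hv : v ∈ R) (hvv : g v v = 0) :
    ∑ e ∈ R, ∑ f ∈ R, g e f = ∑ e ∈ R.erase v, ∑ f ∈ R.erase v, g e f + 2 * ∑ f ∈ R, g v f := by
  have h1 : ∀ e, ∑ f ∈ R, g e f = ∑ f ∈ R.erase v, g e f + g e v := fun e =>
    (sum_erase_add _ _ hv).symm
  rw [← sum_erase_add _ _ hv, sum_congr rfl fun e _ => h1 e, sum_add_distrib,
    sum_congr rfl fun e _ => hg e v, h1 v, hvv]
  ring

lemma classWeight_update_add [DecidableEq E] (c : E → Bool) (v : E) :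
    classWeight R w (Function.update c v (!c v)) v + classWeight R w c v = ∑ f ∈ R.erase v, w v f := by
  classical
  rw [classWeight_eq, classWeight_eq, ← sum_add_distrib]
  by_cases hv : v ∈ R
  · rw [← sum_erase_add _ _ hv]
    simp only [ne_eq, not_true_eq_false, false_and, if_false, add_zero]
    refine sum_congr rfl fun f hf => ?_
    have hfv : f ≠ v := ne_of_mem_erase hf
    rw [Function.update_of_ne hfv, Function.update_self]
    cases c f <;> cases c v <;> simp [hfv]
  · rw [erase_eq_of_notMem hv]
    refine sum_congr rfl fun f hf => ?_
    have hfv : f ≠ v := fun h => hv (h ▸ hf)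
    rw [Function.update_of_ne hfv, Function.update_self]
    cases c f <;> cases c v <;> simp [hfv]

/-- A minimal cut has class weights at most one. -/
lemma classWeight_le_one (hw : ∀ e f, w e f = w f e)
    (h3 : ∀ e ∈ R, ∀ F ⊆ R, e ∉ F → ∑ f ∈ F, w e f ≤ 3) {c : E → Bool}
    (hc : ∀ c', ∑ e ∈ R, classWeight R w c e ≤ ∑ e ∈ R, classWeight R w c' e) {v : E} (hv : v ∈ R) :
    classWeight R w c v ≤ 1 := by
  classical
  have h1 := classWeight_update_add (R := R) (w := w) c v
  have h2 := h3 v hv (R.erase v) (erase_subset _ _) (notMem_erase v R)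
  have h3 := hc (Function.update c v (!c v))
  have key : ∀ c : E → Bool, ∑ e ∈ R, classWeight R w c e = ∑ e ∈ R.erase v, ∑ f ∈ R.erase v,
      (if f ≠ e ∧ c f = c e then w e f else 0) + 2 * classWeight R w c v := by
    intro c
    rw [sum_congr rfl fun e _ => classWeight_eq R w c e, classWeight_eq R w c v]
    refine sum_sum_eq_of_symmetric (g := fun e f => if f ≠ e ∧ c f = c e then w e f else 0)
      (fun e f => ?_) hv (by simp)
    simp only [hw e f, ne_comm (a := f), eq_comm (a := c f)]
  rw [key, key] at h3
  have h4 : ∑ e ∈ R.erase v, ∑ f ∈ R.erase v, (if f ≠ e ∧ Function.update c v (!c v) f =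
      Function.update c v (!c v) e then w e f else 0) =
      ∑ e ∈ R.erase v, ∑ f ∈ R.erase v, (if f ≠ e ∧ c f = c e then w e f else 0) := by
    refine sum_congr rfl fun e he => sum_congr rfl fun f hf => ?_
    rw [Function.update_of_ne (ne_of_mem_erase he), Function.update_of_ne (ne_of_mem_erase hf)]
  omega

open Classical in
/-- Every weight function on pairs with total weight at most three at each element and no four
elements of pairwise positive weight has a cut into two classes of small weight. -/
theorem exists_cut (hw : ∀ e f, w e f = w f e)
    (h3 : ∀ e ∈ R, ∀ F ⊆ R, e ∉ F → ∑ f ∈ F, w e f ≤ 3)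
    (hK : ∀ a ∈ R, ∀ b ∈ R, ∀ c ∈ R, ∀ d ∈ R, a ≠ b → a ≠ c → a ≠ d → b ≠ c → b ≠ d → c ≠ d →
      w a b ≠ 0 → w a c ≠ 0 → w a d ≠ 0 → w b c ≠ 0 → w b d ≠ 0 → w c d = 0) :
    ∃ c : E → Bool, (∀ e ∈ R, classWeight R w c e ≤ 1) ∧
      3 * ∑ e ∈ R, classWeight R w c e ≤ 2 * #R := by
  obtain ⟨H, hHw⟩ : ∃ H : SimpleGraph E, ∀ e f, H.Adj e f ↔ e ≠ f ∧ w e f ≠ 0 :=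
    ⟨{ Adj := fun e f => e ≠ f ∧ w e f ≠ 0
       symm := ⟨fun e f h => ⟨h.1.symm, hw e f ▸ h.2⟩⟩
       loopless := ⟨fun e h => h.1 rfl⟩ }, fun _ _ => Iff.rfl⟩
  have hH : IsSubcubicOn H R := by
    intro v hv
    have key : ∀ N ⊆ R, (∀ u ∈ N, v ≠ u ∧ w v u ≠ 0) → #N ≤ 3 := by
      intro N hN hvN
      refine le_trans ?_ (h3 v hv N hN fun h => (hvN v h).1 rfl)
      rw [card_eq_sum_ones]
      exact sum_le_sum fun u hu => Nat.one_le_iff_ne_zero.2 (hvN u hu).2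
    exact key _ (filter_subset _ _) fun u hu => (hHw _ _).1 (mem_filter.1 hu).2
  obtain ⟨χ, hχ⟩ := hH.exists_isProperOn (by
    simp only [hHw]
    exact fun a ha b hb c hc d hd hab hac had hbc hbd hcd => hcd.2 (hK a ha b hb c hc d hd hab.1 hac.1
      had.1 hbc.1 hbd.1 hcd.1 hab.2 hac.2 had.2 hbc.2 hbd.2))
  have hχ' : ∀ e ∈ R, ∀ f ∈ R, f ≠ e → χ e = χ f → w e f = 0 := fun e he f hf hne hef => by
    by_contra hcon
    exact hχ e he f hf ((hHw _ _).2 ⟨hne.symm, hcon⟩) hef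
  -- The smallest color class `X`.
  obtain ⟨i, hi⟩ : ∃ i, 3 * #{e ∈ R | χ e = i} ≤ #R := by
    by_contra! hcon
    have h1 := card_eq_sum_card_fiberwise (s := R) (t := univ) (f := χ) fun e _ => mem_univ _
    rw [Fin.sum_univ_three] at h1
    have := hcon 0
    have := hcon 1
    have := hcon 2
    omega
  set X := ({e ∈ R | χ e = i} : Finset E) with hX
  have hXm : ∀ e, e ∈ X ↔ e ∈ R ∧ χ e = i := fun e => mem_filter
  let c0 : E → Bool := fun e => decide (χ e = i + 1)
  let c1 : E → Bool := fun e => if χ e = i then (if classWeight R w (Function.update c0 e true) e ≤ 1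
    then true else false) else c0 e
  -- On `X`, the class weight only depends on the classes of the elements outside `X`.
  have hc1 : ∀ e ∈ X, classWeight R w c1 e ≤ 1 := by
    intro e he
    have heR := ((hXm e).1 he).1
    have hei := ((hXm e).1 he).2
    have h1 : classWeight R w c1 e = classWeight R w (Function.update c0 e (c1 e)) e := by
      rw [classWeight_eq, classWeight_eq]
      refine sum_congr rfl fun f hf => ?_
      by_cases hfe : f = e
      · simp [hfe]
      rw [Function.update_self, Function.update_of_ne hfe]
      by_cases hfi : χ f = i
      · rw [hχ' e heR f hf hfe (hei.trans hfi.symm)]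
        simp
      · simp only [c1, hfi, if_false]
    have h2 : c1 e = if classWeight R w (Function.update c0 e true) e ≤ 1 then true else false := by
      simp only [c1, hei, if_true]
    rw [h1]
    by_cases h4 : classWeight R w (Function.update c0 e true) e ≤ 1
    · rw [h2, if_pos h4]
      exact h4
    · rw [h2, if_neg h4]
      have h5 := classWeight_update_add (R := R) (w := w) (Function.update c0 e true) e
      rw [Function.update_self, Function.update_idem] at h5
      have h6 := h3 e heR (R.erase e) (erase_subset _ _) (notMem_erase e R)
      simp only [Bool.not_true] at h5
      omega
  have hW : ∑ e ∈ R, classWeight R w c1 e ≤ 2 * #X := by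
    set g : E → E → ℕ := fun e f => if f ≠ e ∧ c1 f = c1 e then w e f else 0 with hg
    have hgs : ∀ e f, g e f = g f e := fun e f => by
      simp only [hg, hw e f, ne_comm (a := f), eq_comm (a := c1 f)]
    have hcw : ∀ e, classWeight R w c1 e = ∑ f ∈ R, g e f := fun e => classWeight_eq R w c1 e
    have h1 : ∀ e ∈ R, ∀ f ∈ R, g e f ≤ (if e ∈ X then g e f else 0) + if f ∈ X then g e f else 0 := by
      intro e he f hf
      by_cases heX : e ∈ X
      · simp [heX]
      by_cases hfX : f ∈ X
      · simp [hfX]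
      have hei : χ e ≠ i := fun h => heX ((hXm e).2 ⟨he, h⟩)
      have hfi : χ f ≠ i := fun h => hfX ((hXm f).2 ⟨hf, h⟩)
      have : g e f = 0 := by
        simp only [hg]
        split_ifs with hef
        · refine hχ' e he f hf hef.1 ?_
          have h2 := hef.2
          simp only [c1, hei, hfi, if_false, c0, decide_eq_decide] at h2
          have key : ∀ a b i : Fin 3, a ≠ i → b ≠ i → (b = i + 1 ↔ a = i + 1) → a = b := by decide
          exact key _ _ _ hei hfi h2
        · rfl
      omega
    have h2 : ∑ e ∈ R, ∑ f ∈ R, (if f ∈ X then g e f else 0) =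
        ∑ e ∈ R, ∑ f ∈ R, (if e ∈ X then g e f else 0) := by
      rw [sum_comm]
      refine sum_congr rfl fun f _ => sum_congr rfl fun e _ => ?_
      rw [hgs]
    have h4 : ∑ e ∈ R, ∑ f ∈ R, (if e ∈ X then g e f else 0) ≤ #X := by
      have : ∀ e ∈ R, ∑ f ∈ R, (if e ∈ X then g e f else 0) = if χ e = i then classWeight R w c1 e else 0 := by
        intro e he
        have : e ∈ X ↔ χ e = i := by rw [hXm]; simp [he]
        by_cases h : χ e = i
        · simp [this, h, hcw]
        · simp [this, h]
      rw [sum_congr rfl this, ← sum_filter, card_eq_sum_ones]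
      exact sum_le_sum hc1
    calc ∑ e ∈ R, classWeight R w c1 e = ∑ e ∈ R, ∑ f ∈ R, g e f := sum_congr rfl fun e _ => hcw e
      _ ≤ ∑ e ∈ R, ∑ f ∈ R, ((if e ∈ X then g e f else 0) + if f ∈ X then g e f else 0) :=
        sum_le_sum fun e he => sum_le_sum fun f hf => h1 e he f hf
      _ ≤ 2 * #X := by
        simp only [sum_add_distrib]
        rw [h2]
        omega
  let W : (E → Bool) → ℕ := fun c => ∑ e ∈ R, classWeight R w c e
  have hmin : ∀ c', W (Function.argmin W) ≤ W c' := fun c' => Function.argmin_le W c'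
  refine ⟨Function.argmin W, fun e he => classWeight_le_one hw h3 hmin he, ?_⟩
  have := hmin c1
  simp only [W] at this ⊢
  omega

end Cut

section Split

open Finset

variable {E : Type*} {M : Finset E} {w : E → E → ℕ} {Q : Finset E → Prop}

open Classical in
/-- The four-element subsets of `M` all of whose pairs have positive weight. -/
noncomputable def weightQuads (M : Finset E) (w : E → E → ℕ) : Finset (Finset E) :=
  {k ∈ M.powerset | #k = 4 ∧ ∀ e ∈ k, ∀ f ∈ k, e ≠ f → w e f ≠ 0}

lemma mem_weightQuads {k : Finset E} : k ∈ weightQuads M w ↔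
    k ⊆ M ∧ #k = 4 ∧ ∀ e ∈ k, ∀ f ∈ k, e ≠ f → w e f ≠ 0 := by
  classical
  rw [weightQuads, mem_filter, mem_powerset]

open Classical in
/-- The elements of `M` outside the quadruples with property `Q`. -/
noncomputable def splitPart (M : Finset E) (w : E → E → ℕ) (Q : Finset E → Prop) : Finset E :=
  {e ∈ M | ∀ k ∈ weightQuads M w, Q k → e ∉ k}

lemma mem_splitPart {e : E} :
    e ∈ splitPart M w Q ↔ e ∈ M ∧ ∀ k ∈ weightQuads M w, Q k → e ∉ k := by
  classical
  rw [splitPart, mem_filter]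

open Classical in
/-- The pairs of positive weight in a class of a cut. -/
noncomputable def splitPairs (R : Finset E) (w : E → E → ℕ) (c : E → Bool) (b : Bool) :
    Finset (Finset E) :=
  {j ∈ R.powerset | #j = 2 ∧ (∀ e ∈ j, c e = b) ∧ ∀ e ∈ j, ∀ f ∈ j, e ≠ f → w e f ≠ 0}

lemma mem_splitPairs {R : Finset E} {c : E → Bool} {b : Bool} {j : Finset E} :
    j ∈ splitPairs R w c b ↔
      j ⊆ R ∧ #j = 2 ∧ (∀ e ∈ j, c e = b) ∧ ∀ e ∈ j, ∀ f ∈ j, e ≠ f → w e f ≠ 0 := by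
  classical
  rw [splitPairs, mem_filter, mem_powerset]

/-- Elements with positive weight to an element of a quadruple belong to the quadruple. -/
lemma mem_of_mem_weightQuads (h3 : ∀ e ∈ M, ∀ F ⊆ M, e ∉ F → ∑ f ∈ F, w e f ≤ 3) {k : Finset E}
    (hk : k ∈ weightQuads M w) {e f : E} (he : e ∈ k) (hf : f ∈ M) (hef : e ≠ f) (hw : w e f ≠ 0) :
    f ∈ k := by
  classical
  obtain ⟨hkM, h4, hkw⟩ := mem_weightQuads.1 hk
  by_contra hfk
  have h1 := h3 e (hkM he) (insert f (k.erase e))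
    (insert_subset hf ((erase_subset _ _).trans hkM)) (by simp [hef])
  have h2 : ∑ g ∈ k.erase e, 1 ≤ ∑ g ∈ k.erase e, w e g := sum_le_sum fun g hg =>
    Nat.one_le_iff_ne_zero.2 (hkw e he g (mem_of_mem_erase hg) (ne_of_mem_erase hg).symm)
  rw [sum_insert fun h => hfk (mem_of_mem_erase h)] at h1
  rw [← card_eq_sum_ones, card_erase_of_mem he] at h2
  omega

lemma eq_of_mem_weightQuads (h3 : ∀ e ∈ M, ∀ F ⊆ M, e ∉ F → ∑ f ∈ F, w e f ≤ 3) {k l : Finset E}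
    (hk : k ∈ weightQuads M w) (hl : l ∈ weightQuads M w) {e : E} (hek : e ∈ k) (hel : e ∈ l) :
    k = l := by
  have hl' := mem_weightQuads.1 hl
  refine (eq_of_subset_of_card_le (fun f hf => ?_) ?_).symm
  · by_cases hef : e = f
    · exact hef ▸ hek
    · exact mem_of_mem_weightQuads h3 hk hek (hl'.1 hf) hef (hl'.2.2 e hel f hf hef)
  · rw [hl'.2.1, (mem_weightQuads.1 hk).2.1]

open Classical in
/-- A cut of the elements outside the quadruples with property `Q`: positive weights within the
classes form a matching, and few pairs of this matching have property `Q`. -/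
theorem exists_split (hw : ∀ e f, w e f = w f e)
    (h3 : ∀ e ∈ M, ∀ F ⊆ M, e ∉ F → ∑ f ∈ F, w e f ≤ 3)
    (hQ : ∀ k ∈ weightQuads M w, ¬ Q k → ∃ p ⊆ k, #p = 2 ∧ ¬ Q p) :
    ∃ c : E → Bool, (∀ e ∈ splitPart M w Q, ∀ f ∈ splitPart M w Q, ∀ g ∈ splitPart M w Q, f ≠ e →
      g ≠ e → w e f ≠ 0 → w e g ≠ 0 → c f = c e → c g = c e → f = g) ∧
      3 * (#{j ∈ splitPairs (splitPart M w Q) w c true | Q j} +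
        #{j ∈ splitPairs (splitPart M w Q) w c false | Q j}) ≤ #(splitPart M w Q) := by
  choose! p hpk hp2 hpQ using hQ
  set R := splitPart M w Q with hR
  have hRM : R ⊆ M := fun e he => (mem_splitPart.1 he).1
  let w' : E → E → ℕ := fun e f =>
    if ∃ k ∈ weightQuads M w, ¬ Q k ∧ e ∈ p k ∧ f ∈ p k then 0 else w e f
  have hw'le : ∀ e f, w' e f ≤ w e f := fun e f => by
    simp only [w']
    split_ifs <;> simp
  have hw'0 : ∀ e f, w e f ≠ 0 → w' e f = 0 → ∃ k ∈ weightQuads M w, ¬ Q k ∧ e ∈ p k ∧ f ∈ p k := by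
    intro e f h h0
    by_contra hcon
    simp only [w', if_neg hcon] at h0
    exact h h0
  have hw's : ∀ e f, w' e f = w' f e := fun e f => by
    simp only [w', hw e f, and_comm (a := e ∈ _)]
  obtain ⟨c, hc1, hc2⟩ := exists_cut (R := R) (w := w') hw's
    (fun e he F hF heF => (sum_le_sum fun f _ => hw'le e f).trans
      (h3 e (hRM he) F (hF.trans hRM) heF)) (by
    intro a ha b hb x hx d hd hab hax had hbx hbd hxd wab wax wad wbx wbd
    by_contra wxd
    have hne : ∀ e ∈ ({a, b, x, d} : Finset E), ∀ f ∈ ({a, b, x, d} : Finset E), e ≠ f →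
        w' e f ≠ 0 := by
      intro e he f hf hef
      simp only [mem_insert, mem_singleton] at he hf
      rcases he with rfl | rfl | rfl | rfl <;> rcases hf with rfl | rfl | rfl | rfl <;>
        first
        | exact (hef rfl).elim
        | assumption
        | (rw [hw's]; assumption)
    have hk : ({a, b, x, d} : Finset E) ∈ weightQuads M w := by
      refine mem_weightQuads.2 ⟨?_, ?_, fun e he f hf hef h0 => hne e he f hf hef ?_⟩
      · simp only [insert_subset_iff, singleton_subset_iff]
        exact ⟨hRM ha, hRM hb, hRM hx, hRM hd⟩
      · rw [card_insert_of_notMem, card_insert_of_notMem, card_insert_of_notMem, card_singleton] <;>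
          simp [hab, hax, had, hbx, hbd, hxd]
      · exact Nat.le_zero.1 (h0 ▸ hw'le e f)
    have hkQ : ¬ Q {a, b, x, d} := fun h => (mem_splitPart.1 ha).2 _ hk h (by simp)
    obtain ⟨e, f, hef, hpe⟩ := card_eq_two.1 (hp2 _ hk hkQ)
    have he : e ∈ p {a, b, x, d} := by rw [hpe]; simp
    have hf : f ∈ p {a, b, x, d} := by rw [hpe]; simp
    refine hne e (hpk _ hk hkQ he) f (hpk _ hk hkQ hf) hef ?_
    simp only [w']
    exact if_pos ⟨_, hk, hkQ, he, hf⟩)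
  have hle : ∀ e ∈ R, ∀ F ⊆ R, (∀ f ∈ F, f ≠ e ∧ c f = c e) → ∑ f ∈ F, w' e f ≤
      classWeight R w' c e := by
    intro e he F hF hFe
    rw [classWeight]
    exact sum_le_sum_of_subset fun f hf => mem_filter.2 ⟨hF hf, hFe f hf⟩
  have htwo : ∀ e ∈ R, ∀ f ∈ R, ∀ g ∈ R, f ≠ e → g ≠ e → w' e f ≠ 0 → w' e g ≠ 0 → c f = c e →
      c g = c e → f = g := by
    intro e he f hf g hg hfe hge wef weg cfe cge
    by_contra hfg
    have h1 := hle e he {f, g} (by simp [insert_subset_iff, hf, hg]) (by simp [hfe, hge, cfe, cge])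
    rw [sum_pair hfg] at h1
    have := hc1 e he
    omega
  have hmix : ∀ e ∈ R, ∀ f ∈ R, ∀ g ∈ R, f ≠ e → g ≠ e → w e f ≠ 0 → w e g ≠ 0 → c f = c e →
      c g = c e → w' e f = 0 → f = g := by
    intro e he f hf g hg hfe hge wef weg cfe cge h0
    by_contra hfg
    obtain ⟨k, hk, hkQ, hek, hfk⟩ := hw'0 e f wef h0
    have hgk : g ∈ k := mem_of_mem_weightQuads h3 hk (hpk k hk hkQ hek) (hRM hg) hge.symm weg
    have hgp : ∀ l ∈ weightQuads M w, ¬ Q l → g ∉ p l := by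
      intro l hl hlQ hgl
      obtain rfl := eq_of_mem_weightQuads h3 hk hl hgk (hpk l hl hlQ hgl)
      have h2 := card_le_card (s := {e, f, g}) (t := p k) (by
        simp only [insert_subset_iff, singleton_subset_iff]
        exact ⟨hek, hfk, hgl⟩)
      rw [hp2 k hk hkQ, card_insert_of_notMem (by simp [hfe.symm, hge.symm]), card_pair hfg] at h2
      omega
    have hwg : ∀ x, w g x ≠ 0 → w' g x ≠ 0 := by
      intro x hx h0
      obtain ⟨l, hl, hlQ, hgl, -⟩ := hw'0 g x hx h0
      exact hgp l hl hlQ hgl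
    have wgf : w g f ≠ 0 :=
      (mem_weightQuads.1 hk).2.2 g hgk f (hpk k hk hkQ hfk) (Ne.symm hfg)
    exact hfe.symm (htwo g hg e he f hf hge.symm hfg (hwg e (hw e g ▸ weg)) (hwg f wgf) cge.symm
      (cfe.trans cge.symm))
  have huniq : ∀ e ∈ R, ∀ f ∈ R, ∀ g ∈ R, f ≠ e → g ≠ e → w e f ≠ 0 → w e g ≠ 0 → c f = c e →
      c g = c e → f = g := by
    intro e he f hf g hg hfe hge wef weg cfe cge
    by_cases h0 : w' e f = 0
    · exact hmix e he f hf g hg hfe hge wef weg cfe cge h0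
    by_cases h1 : w' e g = 0
    · exact (hmix e he g hg f hf hge hfe weg wef cge cfe h1).symm
    · exact htwo e he f hf g hg hfe hge h0 h1 cfe cge
  refine ⟨c, huniq, ?_⟩
  set P := ({j ∈ splitPairs R w c true | Q j} : Finset _) ∪
    ({j ∈ splitPairs R w c false | Q j} : Finset _) with hP
  have hPm : ∀ j ∈ P, j ⊆ R ∧ #j = 2 ∧ Q j ∧ ∀ e ∈ j, ∀ f ∈ j, e ≠ f → w e f ≠ 0 ∧ c f = c e := by
    intro j hj
    rw [hP, mem_union, mem_filter, mem_filter, mem_splitPairs, mem_splitPairs] at hj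
    rcases hj with ⟨⟨h1, h2, h4, h5⟩, hjQ⟩ | ⟨⟨h1, h2, h4, h5⟩, hjQ⟩ <;>
      exact ⟨h1, h2, hjQ, fun e he f hf hef => ⟨h5 e he f hf hef, (h4 f hf).trans (h4 e he).symm⟩⟩
  have hother : ∀ j ∈ P, ∀ e ∈ j, ∃ f, f ≠ e ∧ f ∈ R ∧ j = {e, f} ∧ w e f ≠ 0 ∧ c f = c e := by
    intro j hj e he
    obtain ⟨h1, h2, -, h4⟩ := hPm j hj
    obtain ⟨f, hf, hfe⟩ := exists_mem_ne (by omega : 1 < #j) e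
    refine ⟨f, hfe, h1 hf, (eq_of_subset_of_card_le ?_ ?_).symm, h4 e he f hf hfe.symm⟩
    · simp [insert_subset_iff, he, hf]
    · rw [h2, card_pair hfe.symm]
  have hcount : ∑ e ∈ R, #{j ∈ P | e ∈ j} ≤ ∑ e ∈ R, classWeight R w' c e := by
    refine sum_le_sum fun e he => ?_
    rcases ({j ∈ P | e ∈ j} : Finset _).eq_empty_or_nonempty with h0 | ⟨j, hj⟩
    · simp [h0]
    · obtain ⟨hj, hej⟩ := mem_filter.1 hj
      have h1 : #{j ∈ P | e ∈ j} ≤ 1 := by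
        rw [card_le_one]
        intro j hj l hl
        obtain ⟨hj, hej⟩ := mem_filter.1 hj
        obtain ⟨hl, hel⟩ := mem_filter.1 hl
        obtain ⟨f, hfe, hfR, rfl, wef, cfe⟩ := hother j hj e hej
        obtain ⟨g, hge, hgR, rfl, weg, cge⟩ := hother l hl e hel
        rw [huniq e he f hfR g hgR hfe hge wef weg cfe cge]
      refine h1.trans ?_
      obtain ⟨f, hfe, hfR, hjf, wef, cfe⟩ := hother j hj e hej
      have h2 := hle e he {f} (by simpa using hfR) (by simp [hfe, cfe])
      rw [sum_singleton] at h2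
      refine le_trans (Nat.one_le_iff_ne_zero.2 fun h0 => ?_) h2
      obtain ⟨k, hk, hkQ, hek, hfk⟩ := hw'0 e f wef h0
      have h5 : {e, f} = p k := eq_of_subset_of_card_le (by simp [insert_subset_iff, hek, hfk])
        (by rw [hp2 k hk hkQ, card_pair hfe.symm])
      exact hpQ k hk hkQ (h5 ▸ hjf ▸ (hPm j hj).2.2.1)
  have hdc : ∑ e ∈ R, #{j ∈ P | e ∈ j} = #P * 2 := by
    refine (sum_card_bipartiteAbove_eq_sum_card_bipartiteBelow (fun e j => e ∈ j)).trans ?_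
    refine sum_const_nat fun j hj => ?_
    rw [← (hPm j hj).2.1]
    congr 1
    ext e
    rw [mem_bipartiteBelow]
    exact ⟨fun h => h.2, fun h => ⟨(hPm j hj).1 h, h⟩⟩
  have hPc : #P = #{j ∈ splitPairs R w c true | Q j} + #{j ∈ splitPairs R w c false | Q j} := by
    rw [hP, card_union_of_disjoint]
    rw [disjoint_left]
    intro j h1 h2
    rw [mem_filter, mem_splitPairs] at h1 h2
    obtain ⟨e, he⟩ := card_pos.1 (by omega : 0 < #j)
    have := (h1.1.2.2.1 e he).symm.trans (h2.1.2.2.1 e he)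
    simp at this
  omega

end Split

section Assembly

open Finset

variable {V : Type} {G : SimpleGraph V}

lemma HasNoCycleOfLength.eq_of_adj (h : HasNoCycleOfLength G 4) ⦃p q r r' : V⦄ (hpq : p ≠ q)
    (hpr : G.Adj p r) (hqr : G.Adj q r) (hpr' : G.Adj p r') (hqr' : G.Adj q r') : r = r' := by
  by_contra hr
  refine h p (.cons hpr (.cons hqr.symm (.cons hqr' (.cons hpr'.symm .nil)))) ?_ rfl
  rw [SimpleGraph.Walk.isCycle_def, SimpleGraph.Walk.isTrail_def]
  simp [hpr.ne, hpr'.ne, hqr'.ne, hpr.ne.symm, hqr.ne.symm, hpr'.ne.symm, hpq, hpq.symm, hr]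

/-- A graph without cycles of length four has at most thirteen edges on eight vertices. -/
lemma card_le_thirteen
    (hC : ∀ ⦃p q r r'⦄, p ≠ q → G.Adj p r → G.Adj q r → G.Adj p r' → G.Adj q r' → r = r')
    {F : Finset (Sym2 V)} (hF : ∀ e ∈ F, e ∈ G.edgeSet) {S : Finset V} (hS : #S ≤ 8)
    (hFS : ∀ e ∈ F, ∀ v ∈ e, v ∈ S) : #F ≤ 13 := by
  classical
  let N : V → Finset V := fun v => {u ∈ S | s(v, u) ∈ F}
  have hN : ∀ v u, u ∈ N v → s(v, u) ∈ F := fun v u hu => (mem_filter.1 hu).2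
  have hdeg : #F * 2 ≤ ∑ v ∈ S, #(N v) := by
    have h1 : ∑ e ∈ F, #{v ∈ S | v ∈ e} = #F * 2 := by
      refine sum_const_nat fun e he => ?_
      induction e using Sym2.ind with
      | _ x y =>
        have hxy : x ≠ y := (show G.Adj x y from hF _ he).ne
        rw [← card_pair hxy]
        congr 1
        ext v
        simp only [mem_filter, Sym2.mem_iff, mem_insert, mem_singleton]
        exact ⟨fun h => h.2, fun h => ⟨hFS _ he v (Sym2.mem_iff.2 h), h⟩⟩
    rw [← h1]
    refine (sum_card_bipartiteAbove_eq_sum_card_bipartiteBelow fun (v : V) e => v ∈ e).ge.trans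
      (sum_le_sum fun v _ => (card_le_card (t := (N v).image fun u => s(v, u)) ?_).trans
      card_image_le)
    intro e he
    obtain ⟨he, hv⟩ := (mem_bipartiteAbove _).1 he
    obtain ⟨u, rfl⟩ := hv
    exact mem_image.2 ⟨u, mem_filter.2 ⟨hFS _ he u (Sym2.mem_mk_right _ _), he⟩, rfl⟩
  have hoff : ∑ v ∈ S, #(N v).offDiag ≤ #S.offDiag := by
    rw [← card_biUnion]
    · refine card_le_card fun x hx => ?_
      obtain ⟨v, -, hx⟩ := mem_biUnion.1 hx
      exact offDiag_mono (filter_subset _ _) hx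
    · intro v _ u _ hvu
      rw [Function.onFun, disjoint_left]
      rintro ⟨x, y⟩ hx hy
      rw [mem_offDiag] at hx hy
      have hadj : ∀ {a b}, b ∈ N a → G.Adj b a := fun hb => (hF _ (hN _ _ hb) : G.Adj _ _).symm
      exact hvu (hC hx.2.2 (hadj hx.1) (hadj hx.2.1) (hadj hy.1) (hadj hy.2.1))
  have hS' : #S.offDiag ≤ 56 := by
    rw [offDiag_card]
    generalize #S = s at hS
    interval_cases s <;> simp
  have hq : ∑ v ∈ S, 4 * #(N v) ≤ ∑ v ∈ S, (#(N v).offDiag + 6) := by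
    refine sum_le_sum fun v _ => ?_
    rw [offDiag_card]
    generalize #(N v) = d
    rcases Nat.lt_or_ge d 5 with hd | hd
    · interval_cases d <;> simp
    · have := Nat.mul_le_mul_right d hd
      omega
  rw [← mul_sum, sum_add_distrib, sum_const, smul_eq_mul] at hq
  omega

lemma IsVertexDisjoint.exists_pair {k : Finset (Sym2 V)} (hk : ¬ IsVertexDisjoint k) :
    ∃ p ⊆ k, #p = 2 ∧ ¬ IsVertexDisjoint p := by
  classical
  unfold IsVertexDisjoint at hk
  push Not at hk
  obtain ⟨e, he, f, hf, v, hve, hvf, hef⟩ := hk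
  exact ⟨{e, f}, by simp [insert_subset_iff, he, hf], card_pair hef,
    fun h => hef (h e (by simp) f (by simp) v hve hvf)⟩

variable {D : PlaneDrawing G} {M : Finset (Sym2 V)} {c : Sym2 V → Bool}

/-- The vertex-disjoint quadruples of pairwise crossing edges. -/
noncomputable def PlaneDrawing.crossingQuads (D : PlaneDrawing G) (M : Finset (Sym2 V)) :
    Finset (Finset (Sym2 V)) := by
  classical exact {k ∈ weightQuads M D.crossingWeight | IsVertexDisjoint k}

lemma PlaneDrawing.mem_crossingQuads {k : Finset (Sym2 V)} : k ∈ D.crossingQuads M ↔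
    k ∈ weightQuads M D.crossingWeight ∧ IsVertexDisjoint k := by
  classical
  rw [crossingQuads, mem_filter]

/-- The edges in no vertex-disjoint quadruple of pairwise crossing edges. -/
noncomputable def PlaneDrawing.sparseEdges (D : PlaneDrawing G) (M : Finset (Sym2 V)) :
    Finset (Sym2 V) := splitPart M D.crossingWeight IsVertexDisjoint

lemma PlaneDrawing.mem_sparseEdges {e : Sym2 V} :
    e ∈ D.sparseEdges M ↔ e ∈ M ∧ ∀ k ∈ D.crossingQuads M, e ∉ k := by
  rw [sparseEdges, mem_splitPart]
  refine and_congr_right fun _ => ⟨fun h k hk => ?_, fun h k hk hkQ => ?_⟩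
  · exact h k (mem_crossingQuads.1 hk).1 (mem_crossingQuads.1 hk).2
  · exact h k (mem_crossingQuads.2 ⟨hk, hkQ⟩)

open Classical in
/-- A class of a cut of the sparse edges, together with the edges of all quadruples. -/
noncomputable def PlaneDrawing.layer (D : PlaneDrawing G) (M : Finset (Sym2 V))
    (c : Sym2 V → Bool) (b : Bool) : Finset (Sym2 V) :=
  {e ∈ D.sparseEdges M | c e = b} ∪ (D.crossingQuads M).biUnion id

lemma PlaneDrawing.mem_layer {b : Bool} {e : Sym2 V} : e ∈ D.layer M c b ↔
    (e ∈ D.sparseEdges M ∧ c e = b) ∨ ∃ k ∈ D.crossingQuads M, e ∈ k := by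
  simp [layer]

open Classical in
/-- The hubs of a layer: the quadruples and the crossing pairs. -/
noncomputable def PlaneDrawing.layerHubs (D : PlaneDrawing G) (M : Finset (Sym2 V))
    (c : Sym2 V → Bool) (b : Bool) : Finset (Finset (Sym2 V)) :=
  D.crossingQuads M ∪ splitPairs (D.sparseEdges M) D.crossingWeight c b

lemma PlaneDrawing.mem_layerHubs {b : Bool} {j : Finset (Sym2 V)} : j ∈ D.layerHubs M c b ↔
    j ∈ D.crossingQuads M ∨ j ∈ splitPairs (D.sparseEdges M) D.crossingWeight c b := by
  classical
  rw [layerHubs, mem_union]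

/-- Each edge of a class of `c` crosses at most one other edge of this class. -/
def PlaneDrawing.IsCrossingSplit (D : PlaneDrawing G) (M : Finset (Sym2 V))
    (c : Sym2 V → Bool) : Prop :=
  ∀ e ∈ D.sparseEdges M, ∀ f ∈ D.sparseEdges M, ∀ g ∈ D.sparseEdges M, f ≠ e → g ≠ e →
    D.crossingWeight e f ≠ 0 → D.crossingWeight e g ≠ 0 → c f = c e → c g = c e → f = g

namespace PlaneDrawing

lemma card_eq_four_of_mem_crossingQuads {k : Finset (Sym2 V)} (hk : k ∈ D.crossingQuads M) :
    #k = 4 := (mem_weightQuads.1 (mem_crossingQuads.1 hk).1).2.1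

lemma subset_of_mem_crossingQuads {k : Finset (Sym2 V)} (hk : k ∈ D.crossingQuads M) :
    k ⊆ M := (mem_weightQuads.1 (mem_crossingQuads.1 hk).1).1

lemma mem_layerHubs_and_card_eq_four {b : Bool} {j : Finset (Sym2 V)} :
    j ∈ D.layerHubs M c b ∧ #j = 4 ↔ j ∈ D.crossingQuads M := by
  rw [mem_layerHubs]
  constructor
  · rintro ⟨h | h, h4⟩
    · exact h
    · have := (mem_splitPairs.1 h).2.1
      omega
  · exact fun h => ⟨.inl h, card_eq_four_of_mem_crossingQuads h⟩

lemma mem_layerHubs_and_card_eq_two {b : Bool} {j : Finset (Sym2 V)} :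
    j ∈ D.layerHubs M c b ∧ #j = 2 ↔
      j ∈ splitPairs (D.sparseEdges M) D.crossingWeight c b := by
  rw [mem_layerHubs]
  constructor
  · rintro ⟨h | h, h2⟩
    · have := card_eq_four_of_mem_crossingQuads h
      omega
    · exact h
  · exact fun h => ⟨.inr h, (mem_splitPairs.1 h).2.1⟩

lemma layerHubs_unique
    (h3 : ∀ e ∈ M, ∀ F ⊆ M, e ∉ F → ∑ f ∈ F, D.crossingWeight e f ≤ 3)
    (hc : D.IsCrossingSplit M c) {b : Bool} {i j : Finset (Sym2 V)}
    (hi : i ∈ D.layerHubs M c b) (hj : j ∈ D.layerHubs M c b) {e : Sym2 V} (hei : e ∈ i)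
    (hej : e ∈ j) : i = j := by
  classical
  rw [mem_layerHubs] at hi hj
  rcases hi with hi | hi <;> rcases hj with hj | hj
  · exact eq_of_mem_weightQuads h3 (mem_crossingQuads.1 hi).1 (mem_crossingQuads.1 hj).1 hei hej
  · exact ((mem_sparseEdges.1 ((mem_splitPairs.1 hj).1 hej)).2 i hi hei).elim
  · exact ((mem_sparseEdges.1 ((mem_splitPairs.1 hi).1 hei)).2 j hj hej).elim
  · obtain ⟨hiR, hi2, hic, hiw⟩ := mem_splitPairs.1 hi
    obtain ⟨hjR, hj2, hjc, hjw⟩ := mem_splitPairs.1 hj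
    obtain ⟨f, hf, hfe⟩ := exists_mem_ne (by omega : 1 < #i) e
    obtain ⟨g, hg, hge⟩ := exists_mem_ne (by omega : 1 < #j) e
    obtain rfl := hc e (hiR hei) f (hiR hf) g (hjR hg) hfe hge (hiw e hei f hf hfe.symm)
      (hjw e hej g hg hge.symm) ((hic f hf).trans (hic e hei).symm)
      ((hjc g hg).trans (hjc e hej).symm)
    have hi' : {e, f} = i := eq_of_subset_of_card_le (by simp [insert_subset_iff, hei, hf])
      (by rw [hi2, card_pair hfe.symm])
    rw [← hi']
    exact eq_of_subset_of_card_le (by simp [insert_subset_iff, hej, hg])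
      (by rw [hj2, card_pair hfe.symm])

lemma layerHubs_subset {b : Bool} {j : Finset (Sym2 V)} (hj : j ∈ D.layerHubs M c b) :
    j ⊆ D.layer M c b := by
  intro e he
  rw [mem_layer]
  rcases mem_layerHubs.1 hj with h | h
  · exact .inr ⟨j, h, he⟩
  · exact .inl ⟨(mem_splitPairs.1 h).1 he, (mem_splitPairs.1 h).2.2.1 e he⟩

lemma layer_subset (b : Bool) : D.layer M c b ⊆ M := by
  intro e he
  rcases mem_layer.1 he with h | ⟨k, hk, hek⟩
  · exact (mem_sparseEdges.1 h.1).1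
  · exact subset_of_mem_crossingQuads hk hek

lemma card_of_mem_layerHubs {b : Bool} {j : Finset (Sym2 V)} (hj : j ∈ D.layerHubs M c b) :
    #j = 2 ∨ #j = 4 := by
  rcases mem_layerHubs.1 hj with h | h
  · exact .inr (card_eq_four_of_mem_crossingQuads h)
  · exact .inl (mem_splitPairs.1 h).2.1

lemma crossingWeight_ne_zero_of_mem_layerHubs {b : Bool} {j : Finset (Sym2 V)}
    (hj : j ∈ D.layerHubs M c b) {e f : Sym2 V} (he : e ∈ j) (hf : f ∈ j) (hef : e ≠ f) :
    D.crossingWeight e f ≠ 0 := by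
  rcases mem_layerHubs.1 hj with h | h
  · exact (mem_weightQuads.1 (mem_crossingQuads.1 h).1).2.2 e he f hf hef
  · exact (mem_splitPairs.1 h).2.2.2 e he f hf hef

lemma isHubSystem_layer
    (h3 : ∀ e ∈ M, ∀ F ⊆ M, e ∉ F → ∑ f ∈ F, D.crossingWeight e f ≤ 3)
    (hM : ∀ e ∈ M, e ∈ G.edgeSet)
    (hc : D.IsCrossingSplit M c) (b : Bool) :
    IsHubSystem G (D.layer M c b) (D.layerHubs M c b) where
  mem_edgeSet e he := hM e (layer_subset b he)
  subset _ hj := layerHubs_subset hj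
  unique _ hi _ hj _ hei hej := layerHubs_unique h3 hc hi hj hei hej
  card_eq _ hj := card_of_mem_layerHubs hj
  disjoint _ hj h4 :=
    (mem_crossingQuads.1 (mem_layerHubs_and_card_eq_four.1 ⟨hj, h4⟩)).2

lemma exists_layerHubs
    (h3 : ∀ e ∈ M, ∀ F ⊆ M, e ∉ F → ∑ f ∈ F, D.crossingWeight e f ≤ 3)
    {b : Bool} {e f : Sym2 V} (he : e ∈ D.layer M c b)
    (hf : f ∈ D.layer M c b) (hef : e ≠ f) (hw : D.crossingWeight e f ≠ 0) :
    ∃ j ∈ D.layerHubs M c b, e ∈ j ∧ f ∈ j := by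
  classical
  rcases mem_layer.1 he with he' | ⟨k, hk, hek⟩
  · rcases mem_layer.1 hf with hf' | ⟨k, hk, hfk⟩
    · refine ⟨{e, f}, mem_layerHubs.2 (.inr (mem_splitPairs.2 ⟨?_, card_pair hef, ?_, ?_⟩)),
        by simp, by simp⟩
      · simp [insert_subset_iff, he'.1, hf'.1]
      · simp [he'.2, hf'.2]
      · have hw' : D.crossingWeight f e ≠ 0 := by rwa [crossingWeight_comm]
        simp [hw, hw']
    · exact ⟨k, mem_layerHubs.2 (.inl hk), mem_of_mem_weightQuads h3 (mem_crossingQuads.1 hk).1 hfk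
        (layer_subset b he) hef.symm (by rwa [crossingWeight_comm]), hfk⟩
  · exact ⟨k, mem_layerHubs.2 (.inl hk), hek, mem_of_mem_weightQuads h3 (mem_crossingQuads.1 hk).1
      hek (layer_subset b hf) hef hw⟩

lemma hasTwoBasis_layer [Fintype V]
    (h3 : ∀ e ∈ M, ∀ F ⊆ M, e ∉ F → ∑ f ∈ F, D.crossingWeight e f ≤ 3)
    (hM : ∀ e ∈ M, e ∈ G.edgeSet)
    (hc : D.IsCrossingSplit M c) (b : Bool) :
    HasTwoBasis (cycleSpace (planarization (D.layer M c b) (D.layerHubs M c b))) := by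
  have hS := isHubSystem_layer h3 hM hc b
  refine D.hasTwoBasis_planarization _ _ hS.mem_edgeSet hS.subset hS.unique ?_ ?_ ?_
  · intro j hj e he
    have := hS.card_eq j hj
    exact exists_mem_ne (by omega) e
  · intro j hj e he f hf hfe
    exact (D.crossingWeight_ne_zero (hS.mem_edgeSet e (hS.subset j hj he))
      (hS.mem_edgeSet f (hS.subset j hj hf)) hfe.symm).1
      (crossingWeight_ne_zero_of_mem_layerHubs hj he hf hfe.symm)
  · intro e he f hf hef hx
    exact exists_layerHubs h3 he hf hef
      ((D.crossingWeight_ne_zero (hS.mem_edgeSet e he) (hS.mem_edgeSet f hf) hef).2 hx)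

lemma card_biUnion_crossingQuads [DecidableEq (Sym2 V)]
    (h3 : ∀ e ∈ M, ∀ F ⊆ M, e ∉ F → ∑ f ∈ F, D.crossingWeight e f ≤ 3) :
    #((D.crossingQuads M).biUnion id) = #(D.crossingQuads M) * 4 := by
  rw [card_biUnion]
  · exact sum_const_nat fun k hk => card_eq_four_of_mem_crossingQuads hk
  · intro k hk l hl hkl
    rw [Function.onFun, disjoint_left]
    exact fun e hek hel => hkl
      (eq_of_mem_weightQuads h3 (mem_crossingQuads.1 hk).1 (mem_crossingQuads.1 hl).1 hek hel)

lemma card_sparseEdges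
    (h3 : ∀ e ∈ M, ∀ F ⊆ M, e ∉ F → ∑ f ∈ F, D.crossingWeight e f ≤ 3) :
    #(D.sparseEdges M) + #(D.crossingQuads M) * 4 = #M := by
  classical
  rw [← card_biUnion_crossingQuads h3, ← card_union_of_disjoint]
  · congr 1
    ext e
    simp only [mem_union, mem_sparseEdges, mem_biUnion, id]
    constructor
    · rintro (h | ⟨k, hk, hek⟩)
      · exact h.1
      · exact subset_of_mem_crossingQuads hk hek
    · intro he
      by_cases h : ∃ k ∈ D.crossingQuads M, e ∈ k
      · exact .inr h
      · push Not at h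
        exact .inl ⟨he, h⟩
  · rw [disjoint_left]
    intro e he h
    obtain ⟨k, hk, hek⟩ := mem_biUnion.1 h
    exact (mem_sparseEdges.1 he).2 k hk hek

lemma card_layer_add_card_layer
    (h3 : ∀ e ∈ M, ∀ F ⊆ M, e ∉ F → ∑ f ∈ F, D.crossingWeight e f ≤ 3) :
    #(D.layer M c true) + #(D.layer M c false) = #(D.sparseEdges M) + #(D.crossingQuads M) * 8 := by
  classical
  have h : ∀ b, #(D.layer M c b) =
      #{e ∈ D.sparseEdges M | c e = b} + #(D.crossingQuads M) * 4 := by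
    intro b
    rw [layer, card_union_of_disjoint, card_biUnion_crossingQuads h3]
    rw [disjoint_left]
    intro e he h
    obtain ⟨k, hk, hek⟩ := mem_biUnion.1 h
    exact (mem_sparseEdges.1 (mem_filter.1 he).1).2 k hk hek
  have h2 := card_filter_add_card_filter_not (s := D.sparseEdges M) (fun e => c e = true)
  simp only [Bool.not_eq_true] at h2
  rw [h, h, ← h2]
  omega

lemma card_capturedEdges_le
    (hM : ∀ e ∈ M, e ∈ G.edgeSet)
    (hC : ∀ ⦃p q r r'⦄, p ≠ q → G.Adj p r → G.Adj q r → G.Adj p r' → G.Adj q r' → r = r')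
    {k : Finset (Sym2 V)} (hk : k ∈ D.crossingQuads M) :
    #(capturedEdges (D.layer M c true) (D.layerHubs M c true) k) +
      #(capturedEdges (D.layer M c false) (D.layerHubs M c false) k) ≤ 13 := by
  classical
  have hcap : ∀ b, ∀ e ∈ capturedEdges (D.layer M c b) (D.layerHubs M c b) k,
      e ∈ M ∧ c e = b ∧ ∀ v ∈ e, v ∈ hubEnds k := by
    intro b e he
    obtain ⟨h1, h2, h4⟩ := mem_capturedEdges.1 he
    refine ⟨layer_subset b h1, ?_, h4⟩
    rcases mem_layer.1 h1 with h | ⟨l, hl, hel⟩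
    · exact h.2
    · obtain ⟨hl', h4'⟩ := mem_layerHubs_and_card_eq_four.2 hl
      exact (h2 l hl' h4' hel).elim
  rw [← card_union_of_disjoint]
  · refine card_le_thirteen hC (S := hubEnds k) (fun e he => ?_) ?_ (fun e he => ?_)
    · exact (mem_union.1 he).elim (fun h => hM e (hcap _ e h).1) (fun h => hM e (hcap _ e h).1)
    · have := card_hubEnds_le k
      rwa [card_eq_four_of_mem_crossingQuads hk] at this
    · exact (mem_union.1 he).elim (fun h => (hcap _ e h).2.2) (fun h => (hcap _ e h).2.2)
  · rw [disjoint_left]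
    intro e h1 h2
    have := (hcap _ e h1).2.1.symm.trans (hcap _ e h2).2.1
    simp at this

/-- A drawing with at most three crossings on each edge of a graph without cycles of length four
has at most `54 n / 11` edges. -/
theorem eleven_mul_card_le [Fintype V]
    (hM : ∀ e ∈ M, e ∈ G.edgeSet)
    (hD : D.IsKPlane 3)
    (hC : ∀ ⦃p q r r'⦄, p ≠ q → G.Adj p r → G.Adj q r → G.Adj p r' → G.Adj q r' → r = r') :
    11 * #M ≤ 54 * Fintype.card V := by
  classical
  have h3 : ∀ e ∈ M, ∀ F ⊆ M, e ∉ F → ∑ f ∈ F, D.crossingWeight e f ≤ 3 :=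
    fun e he F hF heF => D.sum_crossingWeight_le hD (hM e he) F fun f hf =>
      ⟨hM f (hF hf), fun h => heF (h ▸ hf)⟩
  obtain ⟨c, hc, hx⟩ := exists_split (Q := IsVertexDisjoint) (fun e f => D.crossingWeight_comm e f)
    h3 (fun k _ hk => IsVertexDisjoint.exists_pair hk)
  have hb : ∀ b, 4 * #(D.layer M c b) + 7 * #(D.crossingQuads M) ≤ 9 * Fintype.card V +
      #{j ∈ splitPairs (D.sparseEdges M) D.crossingWeight c b | IsVertexDisjoint j} +
      2 * ∑ k ∈ D.crossingQuads M, #(capturedEdges (D.layer M c b) (D.layerHubs M c b) k) := by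
    intro b
    have h := (isHubSystem_layer h3 hM hc b).bound (hasTwoBasis_layer h3 hM hc b) hC
    have h4 : ({j ∈ D.layerHubs M c b | #j = 4} : Finset _) = D.crossingQuads M := by
      ext j
      rw [mem_filter, mem_layerHubs_and_card_eq_four]
    have h2 : ({j ∈ D.layerHubs M c b | #j = 2 ∧ IsVertexDisjoint j} : Finset _) =
        {j ∈ splitPairs (D.sparseEdges M) D.crossingWeight c b | IsVertexDisjoint j} := by
      ext j
      rw [mem_filter, mem_filter, ← and_assoc, mem_layerHubs_and_card_eq_two]
    rwa [h4, h2] at h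
  have hcap : ∑ k ∈ D.crossingQuads M,
        #(capturedEdges (D.layer M c true) (D.layerHubs M c true) k) +
      ∑ k ∈ D.crossingQuads M,
        #(capturedEdges (D.layer M c false) (D.layerHubs M c false) k) ≤
      #(D.crossingQuads M) * 13 := by
    rw [← sum_add_distrib]
    exact sum_le_card_nsmul _ _ _ fun k hk => card_capturedEdges_le hM hC hk
  have h1 := hb true
  have h2 := hb false
  have hl := card_layer_add_card_layer (c := c) h3
  have hs := card_sparseEdges h3
  change 3 * (#{j ∈ splitPairs (D.sparseEdges M) D.crossingWeight c true | IsVertexDisjoint j} +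
    #{j ∈ splitPairs (D.sparseEdges M) D.crossingWeight c false | IsVertexDisjoint j}) ≤
    #(D.sparseEdges M) at hx
  omega

end PlaneDrawing

end Assembly

theorem stmt_17 {V : Type} [Fintype V] (G : SimpleGraph V)
    (hC4 : HasNoCycleOfLength G 4) (hG : KPlanar G 3)
    (hn : 2 ≤ Fintype.card V) :
    (G.edgeSet.ncard : ℝ) ≤
        (3764475 / 31360 : ℝ) ^ ((1 : ℝ) / 3) * Fintype.card V ∧
      (G.edgeSet.ncard : ℝ) < 4.933 * Fintype.card V := by
  classical
  obtain ⟨D, hD⟩ := hG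
  have hmain := D.eleven_mul_card_le (M := G.edgeFinset) (by simp) hD hC4.eq_of_adj
  rw [← SimpleGraph.coe_edgeFinset, Set.ncard_coe_finset]
  have hm : (11 : ℝ) * G.edgeFinset.card ≤ 54 * Fintype.card V := by exact_mod_cast hmain
  have hn' : (2 : ℝ) ≤ Fintype.card V := by exact_mod_cast hn
  have hroot : (54 / 11 : ℝ) ≤ (3764475 / 31360 : ℝ) ^ ((1 : ℝ) / 3) := by
    rw [one_div, Real.le_rpow_inv_iff_of_pos] <;> norm_num
  constructor
  · nlinarith
  · norm_num
    linarith
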